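/- Let Γ be a reduct of (𝕃;C), and let Δ be the model-complete core of Γ. Then the following are equivalent: (1) Δ has a binary polymorphism f and endomorphisms e₁, e₂ such that e₁(f(x,y)) = e₂(f(y,x)) for all x, y; (2) for all elements a₁,…,a_n of Δ, there is no clone homomorphism from Pol(Δ, a₁,…,a_n) to 𝟏; (3) for all elements a₁,…,a_n of Δ, there is no continuous clone homomorphism from Pol(Δ, a₁,…,a_n) to 𝟏; (4) no expansion of Δ by finitely many constants admits a primitive positive interpretation of ({0,1}; NAE). -/

import Mathlib

/-! ### Relational structures and primitive positive formulas -/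

/-- A relational structure with relation symbols `σ`, arities `ar`, and domain `D`. -/
structure RelStruct (σ : Type) (ar : σ → ℕ) (D : Type) where
  rel : (s : σ) → (Fin (ar s) → D) → Prop

/-- Primitive positive formulas over the relational signature `(σ, ar)`, with `n` free
variables (built from atomic formulas using only conjunction and existential
quantification). -/
inductive PPFormula (σ : Type) (ar : σ → ℕ) : ℕ → Type
  | eq {n : ℕ} (i j : Fin n) : PPFormula σ ar n
  | rel {n : ℕ} (s : σ) (v : Fin (ar s) → Fin n) : PPFormula σ ar n
  | and {n : ℕ} (φ ψ : PPFormula σ ar n) : PPFormula σ ar n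
  | ex {n : ℕ} (φ : PPFormula σ ar (n + 1)) : PPFormula σ ar n

/-- Satisfaction of a primitive positive formula in a structure, under an assignment. -/
def PPFormula.Realize {σ : Type} {ar : σ → ℕ} {D : Type} (Γ : RelStruct σ ar D) :
    {n : ℕ} → PPFormula σ ar n → (Fin n → D) → Prop
  | _, .eq i j, t => t i = t j
  | _, .rel s v, t => Γ.rel s (fun m => t (v m))
  | _, .and φ ψ, t => φ.Realize Γ t ∧ ψ.Realize Γ t
  | _, .ex φ, t => ∃ d : D, φ.Realize Γ (Fin.snoc t d)

/-- A relation is primitive positive definable in `Γ` if it is the set of solutions of a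
primitive positive formula over the signature of `Γ`. -/
def PPDefinable {σ : Type} {ar : σ → ℕ} {D : Type} (Γ : RelStruct σ ar D) {n : ℕ}
    (R : (Fin n → D) → Prop) : Prop :=
  ∃ φ : PPFormula σ ar n, ∀ t, R t ↔ φ.Realize Γ t

/-- The expansion of a structure by the constants `a 0, …, a (n-1)`, realised as new
singleton unary relations. -/
def RelStruct.withConstants {σ : Type} {ar : σ → ℕ} {D : Type} (Γ : RelStruct σ ar D)
    {n : ℕ} (a : Fin n → D) : RelStruct (σ ⊕ Fin n) (Sum.elim ar fun _ => 1) D where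
  rel s := match s with
    | .inl s => fun t => Γ.rel s t
    | .inr i => fun t : Fin 1 → D => t 0 = a i

/-- Flattening a `k`-tuple of `d`-tuples into a `(k*d)`-tuple. -/
def flattenTuple {D : Type} {k d : ℕ} (ts : Fin k → Fin d → D) : Fin (k * d) → D :=
  fun j => ts (finProdFinEquiv.symm j).1 (finProdFinEquiv.symm j).2

/-- A primitive positive interpretation of the structure `Δ` in the structure `Γ`:
a dimension `dim`, a primitive positive domain formula, primitive positive defining
formulas for equality and for each atomic formula, and a coordinate map, surjective
onto `Δ`, from the `dim`-tuples satisfying the domain formula. -/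
structure PPInterpretation {σ₁ : Type} {ar₁ : σ₁ → ℕ} {D : Type} (Γ : RelStruct σ₁ ar₁ D)
    {σ₂ : Type} {ar₂ : σ₂ → ℕ} {E : Type} (Δ : RelStruct σ₂ ar₂ E) : Type where
  dim : ℕ
  domFml : PPFormula σ₁ ar₁ dim
  eqFml : PPFormula σ₁ ar₁ (2 * dim)
  relFml : (s : σ₂) → PPFormula σ₁ ar₁ (ar₂ s * dim)
  coord : (Fin dim → D) → E
  coord_surj : ∀ e : E, ∃ t, domFml.Realize Γ t ∧ coord t = e
  eq_iff : ∀ t₁ t₂ : Fin dim → D, domFml.Realize Γ t₁ → domFml.Realize Γ t₂ →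
    (coord t₁ = coord t₂ ↔ eqFml.Realize Γ (flattenTuple ![t₁, t₂]))
  rel_iff : ∀ (s : σ₂) (ts : Fin (ar₂ s) → Fin dim → D),
    (∀ i, domFml.Realize Γ (ts i)) →
    (Δ.rel s (fun i => coord (ts i)) ↔ (relFml s).Realize Γ (flattenTuple ts))

/-- The Boolean structure `({0,1}; NAE)`, where `NAE = {0,1}³ \ {(0,0,0),(1,1,1)}`. -/
def NAEStruct : RelStruct Unit (fun _ => 3) Bool where
  rel := fun _ t => (∃ i, t i = true) ∧ (∃ i, t i = false)
/-! ### First-order formulas, ω-categoricity, model-complete cores -/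

/-- First-order formulas over the relational signature `(σ, ar)` with `n` free variables. -/
inductive FOFormula (σ : Type) (ar : σ → ℕ) : ℕ → Type
  | eq {n : ℕ} (i j : Fin n) : FOFormula σ ar n
  | rel {n : ℕ} (s : σ) (v : Fin (ar s) → Fin n) : FOFormula σ ar n
  | not {n : ℕ} (φ : FOFormula σ ar n) : FOFormula σ ar n
  | and {n : ℕ} (φ ψ : FOFormula σ ar n) : FOFormula σ ar n
  | ex {n : ℕ} (φ : FOFormula σ ar (n + 1)) : FOFormula σ ar n

/-- Satisfaction of a first-order formula in a structure, under an assignment. -/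
def FOFormula.Realize {σ : Type} {ar : σ → ℕ} {D : Type} (Γ : RelStruct σ ar D) :
    {n : ℕ} → FOFormula σ ar n → (Fin n → D) → Prop
  | _, .eq i j, t => t i = t j
  | _, .rel s v, t => Γ.rel s (fun m => t (v m))
  | _, .not φ, t => ¬ φ.Realize Γ t
  | _, .and φ ψ, t => φ.Realize Γ t ∧ ψ.Realize Γ t
  | _, .ex φ, t => ∃ d : D, φ.Realize Γ (Fin.snoc t d)

/-- A relation is first-order definable in `Γ` if it is the set of solutions of a
first-order formula over the signature of `Γ`. -/
def FODefinable {σ : Type} {ar : σ → ℕ} {D : Type} (Γ : RelStruct σ ar D) {n : ℕ}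
    (R : (Fin n → D) → Prop) : Prop :=
  ∃ φ : FOFormula σ ar n, ∀ t, R t ↔ φ.Realize Γ t

/-- Isomorphism of relational structures over the same signature. -/
def RelStruct.Isomorphic {σ : Type} {ar : σ → ℕ} {D E : Type}
    (Γ : RelStruct σ ar D) (Δ : RelStruct σ ar E) : Prop :=
  ∃ g : D ≃ E, ∀ (s : σ) (t : Fin (ar s) → D), Γ.rel s t ↔ Δ.rel s (fun i => g (t i))

/-- A countable structure is ω-categorical if all countable models of its first-order
theory are isomorphic (to it). -/
def IsOmegaCategorical {σ : Type} {ar : σ → ℕ} {D : Type} (Γ : RelStruct σ ar D) : Prop :=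
  Countable D ∧ ∀ (E : Type) (Δ : RelStruct σ ar E), Countable E →
    (∀ φ : FOFormula σ ar 0, φ.Realize Γ Fin.elim0 → φ.Realize Δ Fin.elim0) →
    Γ.Isomorphic Δ

/-- A self-map of the domain of `Γ` is an elementary self-embedding if it preserves the
truth of all first-order formulas. -/
def IsElementarySelfEmbedding {σ : Type} {ar : σ → ℕ} {D : Type} (Γ : RelStruct σ ar D)
    (e : D → D) : Prop :=
  ∀ {n : ℕ} (φ : FOFormula σ ar n) (t : Fin n → D),
    φ.Realize Γ t ↔ φ.Realize Γ (fun i => e (t i))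

/-- A homomorphism between relational structures over the same signature. -/
def IsHom {σ : Type} {ar : σ → ℕ} {D E : Type} (Γ : RelStruct σ ar D) (Δ : RelStruct σ ar E)
    (h : D → E) : Prop :=
  ∀ (s : σ) (t : Fin (ar s) → D), Γ.rel s t → Δ.rel s (fun i => h (t i))

/-- Two structures are homomorphically equivalent if there are homomorphisms in both
directions. -/
def HomEquiv {σ : Type} {ar : σ → ℕ} {D E : Type} (Γ : RelStruct σ ar D)
    (Δ : RelStruct σ ar E) : Prop :=
  (∃ h, IsHom Γ Δ h) ∧ (∃ h, IsHom Δ Γ h)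

/-- A structure is a model-complete core if all its endomorphisms are elementary
self-embeddings. -/
def IsModelCompleteCore {σ : Type} {ar : σ → ℕ} {D : Type} (Γ : RelStruct σ ar D) : Prop :=
  ∀ e : D → D, IsHom Γ Γ e → IsElementarySelfEmbedding Γ e
/-! ### Polymorphisms and endomorphisms -/

/-- A `k`-ary operation `f` preserves an `m`-ary relation `R` if applying `f`
componentwise to `k` tuples of `R` yields a tuple of `R`. -/
def PreservesRel {D : Type} {k m : ℕ} (f : (Fin k → D) → D) (R : (Fin m → D) → Prop) : Prop :=
  ∀ ts : Fin k → Fin m → D, (∀ i, R (ts i)) → R (fun j => f (fun i => ts i j))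

/-- A polymorphism of `Γ` is a finitary operation on the domain preserving all
relations of `Γ`. -/
def IsPolymorphism {σ : Type} {ar : σ → ℕ} {D : Type} (Γ : RelStruct σ ar D) {k : ℕ}
    (f : (Fin k → D) → D) : Prop :=
  ∀ s, PreservesRel f (Γ.rel s)

/-- A binary operation as an operation on `Fin 2`-tuples. -/
def binOp {D : Type} (f : D → D → D) : (Fin 2 → D) → D := fun t => f (t 0) (t 1)

/-- An endomorphism of `Γ` (a unary polymorphism). -/
def IsEndomorphism {σ : Type} {ar : σ → ℕ} {D : Type} (Γ : RelStruct σ ar D)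
    (e : D → D) : Prop :=
  ∀ (s : σ) (t : Fin (ar s) → D), Γ.rel s t → Γ.rel s (fun i => e (t i))

/-- `Γ` has a symmetric polymorphism modulo endomorphisms: a binary polymorphism `f`
and endomorphisms `e₁, e₂` with `e₁(f(x,y)) = e₂(f(y,x))` for all `x, y`. -/
def HasSymmetricPolymorphismModEndos {σ : Type} {ar : σ → ℕ} {D : Type}
    (Γ : RelStruct σ ar D) : Prop :=
  ∃ (f : D → D → D) (e₁ e₂ : D → D),
    IsPolymorphism Γ (binOp f) ∧ IsEndomorphism Γ e₁ ∧ IsEndomorphism Γ e₂ ∧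
    ∀ x y, e₁ (f x y) = e₂ (f y x)
/-! ### Function clones and clone homomorphisms -/

/-- A function clone on `D`: a set of finitary operations containing all projections and
closed under composition. -/
structure Clone (D : Type) where
  ops : ∀ n : ℕ, Set ((Fin n → D) → D)
  proj_mem : ∀ (n : ℕ) (i : Fin n), (fun t => t i) ∈ ops n
  comp_mem : ∀ {n m : ℕ} (f : (Fin n → D) → D) (g : Fin n → (Fin m → D) → D),
    f ∈ ops n → (∀ i, g i ∈ ops m) → (fun t => f (fun i => g i t)) ∈ ops m

/-- The polymorphism clone `Pol(Γ)` of a relational structure `Γ`. -/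
def polClone {σ : Type} {ar : σ → ℕ} {D : Type} (Γ : RelStruct σ ar D) : Clone D where
  ops n := {f | IsPolymorphism Γ f}
  proj_mem n i := fun s ts h => h i
  comp_mem := by
    intro n m f g hf hg s ts h
    exact hf s (fun i j => g i (fun l => ts l j)) (fun i => hg i s ts h)

/-- The clone of all projections on a set. -/
def projClone (B : Type) : Clone B where
  ops n := {f | ∃ i : Fin n, f = fun t => t i}
  proj_mem n i := ⟨i, rfl⟩
  comp_mem := by
    rintro n m f g ⟨i, rfl⟩ hg
    obtain ⟨j, hj⟩ := hg i
    exact ⟨j, by funext t; exact congrFun hj t⟩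

/-- A clone homomorphism: an arity-preserving map sending projections to the
corresponding projections and commuting with composition. -/
structure CloneHom {D E : Type} (𝒞 : Clone D) (𝒟 : Clone E) where
  map : ∀ {n : ℕ}, {f : (Fin n → D) → D // f ∈ 𝒞.ops n} → {g : (Fin n → E) → E // g ∈ 𝒟.ops n}
  map_proj : ∀ {n : ℕ} (i : Fin n),
    (map ⟨fun t => t i, 𝒞.proj_mem n i⟩).1 = fun t => t i
  map_comp : ∀ {n m : ℕ} (f : {f : (Fin n → D) → D // f ∈ 𝒞.ops n})
    (g : Fin n → {g : (Fin m → D) → D // g ∈ 𝒞.ops m}),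
    (map ⟨fun t => f.1 (fun i => (g i).1 t),
      𝒞.comp_mem f.1 (fun i => (g i).1) f.2 (fun i => (g i).2)⟩).1
      = fun t => (map f).1 (fun i => (map (g i)).1 t)

/-- The topology of pointwise convergence on the `n`-ary operations on `D`
(with `D` discrete). -/
def opSpaceTopology (D : Type) (n : ℕ) : TopologicalSpace ((Fin n → D) → D) :=
  @Pi.topologicalSpace (Fin n → D) (fun _ => D) (fun _ => ⊥)

/-- A clone homomorphism is continuous if each of its arity components is continuous with
respect to the topology of pointwise convergence. -/
def CloneHom.IsContinuous {D E : Type} {𝒞 : Clone D} {𝒟 : Clone E}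
    (ξ : CloneHom 𝒞 𝒟) : Prop :=
  ∀ n : ℕ, @Continuous _ _ ((opSpaceTopology D n).induced Subtype.val)
    ((opSpaceTopology E n).induced Subtype.val)
    (fun f : {f : (Fin n → D) → D // f ∈ 𝒞.ops n} => ξ.map f)
/-! ### C-relations

`C z x y` encodes `C(z; x, y)`, also written `xy|z`: the smallest subtree containing
`x` and `y` does not contain `z`. -/

/-- The Adeleke–Neumann axioms for a C-relation. -/
def IsCRelation {L : Type} (C : L → L → L → Prop) : Prop :=
  (∀ z x y, C z x y → C z y x) ∧
  (∀ z x y, C z x y → ¬ C y x z) ∧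
  (∀ z x y, C z x y → ∀ w, C w x y ∨ C z w y) ∧
  (∀ z x, x ≠ z → C z x x)

/-- A C-relation is binary branching if for pairwise distinct `x, y, z` one of the three
groupings `xy|z`, `xz|y`, `yz|x` holds (by the axioms, exactly one then holds). -/
def IsBinaryBranching {L : Type} (C : L → L → L → Prop) : Prop :=
  ∀ x y z : L, x ≠ y → x ≠ z → y ≠ z → C z x y ∨ C y x z ∨ C x y z

/-- Density of a C-relation. -/
def IsDenseC {L : Type} (C : L → L → L → Prop) : Prop :=
  ∀ x y z, C x y z → ∃ w, C x w z ∧ C w y z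

/-- An automorphism of `(L; C)`. -/
def IsCAutomorphism {L : Type} (C : L → L → L → Prop) (g : L → L) : Prop :=
  Function.Bijective g ∧ ∀ z x y, C (g z) (g x) (g y) ↔ C z x y

/-- `(L; C)` is homogeneous: every isomorphism between finite induced substructures
extends to an automorphism. -/
def IsCHomogeneous {L : Type} (C : L → L → L → Prop) : Prop :=
  ∀ (A : Finset L) (f : L → L), Set.InjOn f ↑A →
    (∀ z ∈ A, ∀ x ∈ A, ∀ y ∈ A, C z x y ↔ C (f z) (f x) (f y)) →
    ∃ g : L → L, IsCAutomorphism C g ∧ ∀ a ∈ A, g a = f a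

/-- `(L; C)` is (isomorphic to) the countable homogeneous binary branching dense
C-relation `(𝕃; C)`. -/
def IsHomBBDenseC {L : Type} (C : L → L → L → Prop) : Prop :=
  Countable L ∧ Infinite L ∧ IsCRelation C ∧ IsBinaryBranching C ∧
    IsDenseC C ∧ IsCHomogeneous C

/-- The relation `N(x,y,z)` iff `xy|z` or `x|yz`. -/
def NRel {L : Type} (C : L → L → L → Prop) (x y z : L) : Prop := C z x y ∨ C x y z

/-- The quartet relation `Q(x,y,z,t)` iff (`xy|z` and `xy|t`) or (`zt|x` and `zt|y`). -/
def QRel {L : Type} (C : L → L → L → Prop) (x y z t : L) : Prop :=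
  (C z x y ∧ C t x y) ∨ (C x z t ∧ C y z t)

/-- The restriction `Q_d` of the quartet relation to quadruples of pairwise distinct
elements. -/
def QdRel {L : Type} (C : L → L → L → Prop) (x y z t : L) : Prop :=
  x ≠ y ∧ x ≠ z ∧ x ≠ t ∧ y ≠ z ∧ y ≠ t ∧ z ≠ t ∧ QRel C x y z t

/-- The structure `(L; C)` with a single ternary relation. -/
def CStruct {L : Type} (C : L → L → L → Prop) : RelStruct Unit (fun _ => 3) L where
  rel := fun _ t => C (t 0) (t 1) (t 2)

/-- The structure `(L; N)` with a single ternary relation. -/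
def NStruct {L : Type} (C : L → L → L → Prop) : RelStruct Unit (fun _ => 3) L where
  rel := fun _ t => NRel C (t 0) (t 1) (t 2)

/-- The structure `(L; Q_d)` with a single quaternary relation. -/
def QdStruct {L : Type} (C : L → L → L → Prop) : RelStruct Unit (fun _ => 4) L where
  rel := fun _ t => QdRel C (t 0) (t 1) (t 2) (t 3)
/-- A reduct of `(L; C)`: a relational structure on `L` all of whose relations are
first-order definable in `(L; C)`. -/
def IsReduct {L : Type} (C : L → L → L → Prop) {σ : Type} {ar : σ → ℕ}
    (Γ : RelStruct σ ar L) : Prop :=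
  ∀ s, FODefinable (CStruct C) (Γ.rel s)

namespace DC
open Set

variable {σ : Type} {ar : σ → ℕ} {E : Type}

/-! #### PP relations -/
def rename : {n m : ℕ} → (Fin n → Fin m) → PPFormula σ ar n → PPFormula σ ar m
  | _, _, f, .eq i j => .eq (f i) (f j)
  | _, _, f, .rel s v => .rel s (fun k => f (v k))
  | _, _, f, .and φ ψ => .and (rename f φ) (rename f ψ)
  | _, m, f, .ex φ => .ex (rename (Fin.snoc (α := fun _ => Fin (m+1)) (fun i => (f i).castSucc) (Fin.last m)) φ)

theorem realize_rename (Δ : RelStruct σ ar E) {n : ℕ} (φ : PPFormula σ ar n) :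
    ∀ {m : ℕ} (f : Fin n → Fin m) (t : Fin m → E),
    (rename f φ).Realize Δ t ↔ φ.Realize Δ (fun i => t (f i)) := by
  induction φ with
  | eq i j => intro m f t; simp [rename, PPFormula.Realize]
  | rel s v => intro m f t; simp [rename, PPFormula.Realize]
  | and φ ψ h1 h2 => intro m f t; simp [rename, PPFormula.Realize, h1, h2]
  | ex φ h =>
    intro m f t
    simp only [rename, PPFormula.Realize, h]
    refine exists_congr fun d => ?_
    have : (fun i => (Fin.snoc (α := fun _ => E) t d) ((Fin.snoc (α := fun _ => Fin (m+1)) (fun i => (f i).castSucc) (Fin.last m)) i))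
      = Fin.snoc (α := fun _ => E) (fun i => t (f i)) d := by
      funext i
      refine Fin.lastCases ?_ (fun i => ?_) i <;> simp
    rw [this]

/-- primitive positive relations over an arbitrary index type -/
def PP (Δ : RelStruct σ ar E) {I : Type} (R : (I → E) → Prop) : Prop :=
  ∃ (n : ℕ) (j : Fin n → I) (φ : PPFormula σ ar n), ∀ t, R t ↔ φ.Realize Δ (fun i => t (j i))

variable {Δ : RelStruct σ ar E} {I J : Type}

theorem PP.congr {R R' : (I → E) → Prop} (h : PP Δ R) (h' : ∀ t, R' t ↔ R t) : PP Δ R' := by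
  obtain ⟨n, j, φ, hφ⟩ := h
  exact ⟨n, j, φ, fun t => (h' t).trans (hφ t)⟩

theorem PP.eq (i j : I) : PP Δ (fun t : I → E => t i = t j) :=
  ⟨2, ![i, j], .eq 0 1, fun t => by simp [PPFormula.Realize]⟩

theorem PP.rel (s : σ) (v : Fin (ar s) → I) : PP Δ (fun t : I → E => Δ.rel s (fun m => t (v m))) :=
  ⟨ar s, v, .rel s id, fun t => by simp [PPFormula.Realize]⟩

theorem PP.true [Nonempty I] : PP Δ (fun _ : I → E => True) := by
  obtain ⟨i⟩ := ‹Nonempty I›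
  exact (PP.eq i i).congr (by simp)

theorem PP.and {R R' : (I → E) → Prop} (h : PP Δ R) (h' : PP Δ R') : PP Δ (fun t => R t ∧ R' t) := by
  obtain ⟨n, j, φ, hφ⟩ := h
  obtain ⟨n', j', φ', hφ'⟩ := h'
  refine ⟨n + n', Fin.append j j', .and (rename (Fin.castAdd n') φ) (rename (Fin.natAdd n) φ'), fun t => ?_⟩
  simp only [PPFormula.Realize, realize_rename, Fin.append_left, Fin.append_right, hφ, hφ']

theorem PP.comap {R : (I → E) → Prop} (h : PP Δ R) (f : I → J) : PP Δ (fun t : J → E => R (fun i => t (f i))) := by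
  obtain ⟨n, j, φ, hφ⟩ := h
  exact ⟨n, fun i => f (j i), φ, fun t => hφ _⟩

theorem PP.ex {R : (I → E) → E → Prop}
    (h : PP Δ (fun t : Option I → E => R (fun i => t (some i)) (t none))) : PP Δ (fun t => ∃ d, R t d) := by
  classical
  obtain ⟨n, j, φ, hφ⟩ := h
  by_cases hI : Nonempty I
  · obtain ⟨i0⟩ := hI
    refine ⟨n, fun k => (j k).getD i0, .ex (rename (fun k => if j k = none then Fin.last n else k.castSucc) φ), fun t => ?_⟩
    simp only [PPFormula.Realize, realize_rename]
    refine exists_congr fun d => ?_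
    have := hφ (fun o => o.elim d t)
    simp only [Option.elim] at this
    rw [this]
    apply iff_of_eq
    congr 1
    funext k
    cases hk : j k <;> simp [hk]
  · refine ⟨0, Fin.elim0, .ex (rename (fun _ => 0) φ), fun t => ?_⟩
    simp only [PPFormula.Realize, realize_rename]
    refine exists_congr fun d => ?_
    have := hφ (fun o => o.elim d t)
    simp only [Option.elim] at this
    rw [this]
    apply iff_of_eq
    congr 1
    funext k
    cases hk : j k with
    | none => simp [Fin.snoc]
    | some i => exact (hI ⟨i⟩).elim

theorem PP.exFin {R : (I → E) → (J → E) → Prop} [Finite J]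
    (h : PP Δ (fun t : I ⊕ J → E => R (fun i => t (.inl i)) (fun i => t (.inr i)))) :
    PP Δ (fun t => ∃ u, R t u) := by
  have key : ∀ (n : ℕ) (I : Type) (R : (I → E) → (Fin n → E) → Prop),
      PP Δ (fun t : I ⊕ Fin n → E => R (fun i => t (.inl i)) (fun i => t (.inr i))) →
      PP Δ (fun t => ∃ u, R t u) := by
    intro n
    induction n with
    | zero =>
      intro I R h
      refine (h.comap (J := I) (Sum.elim id Fin.elim0)).congr fun t => ?_
      constructor
      · rintro ⟨u, hu⟩
        rw [Subsingleton.elim u (fun i => t (Sum.elim id Fin.elim0 (.inr i : I ⊕ Fin 0)))] at hu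
        exact hu
      · intro h; exact ⟨_, h⟩
    | succ n ih =>
      intro I R h
      have h2 : PP Δ (fun t : I → E => ∃ d, ∃ u : Fin n → E, R t (Fin.cons d u)) := by
        apply PP.ex
        apply ih (Option I) (fun t u => R (fun i => t (some i)) (Fin.cons (t none) u))
        refine (h.comap (J := Option I ⊕ Fin n) (Sum.elim (fun i => .inl (some i))
          (Fin.cons (.inl none) (fun k => .inr k)))).congr fun t => ?_
        apply iff_of_eq
        congr 1
        funext k
        refine Fin.cases ?_ (fun k => ?_) k <;> simp
      refine h2.congr fun t => ?_
      constructor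
      · rintro ⟨u, hu⟩
        exact ⟨u 0, fun k => u k.succ, by convert hu; funext k; refine Fin.cases ?_ (fun k => ?_) k <;> simp⟩
      · rintro ⟨d, u, h⟩; exact ⟨_, h⟩
  obtain ⟨n, ⟨e⟩⟩ := Finite.exists_equiv_fin J
  have h2 := key n I (fun t u => R t (fun i => u (e i))) (h.comap (Sum.map id e))
  refine h2.congr fun t => ?_
  constructor
  · rintro ⟨u, hu⟩
    exact ⟨fun k => u (e.symm k), by simpa using hu⟩
  · rintro ⟨u, hu⟩; exact ⟨_, hu⟩

theorem PP.all {K : Type} [Finite K] [Nonempty I] (R : K → (I → E) → Prop) (h : ∀ k, PP Δ (R k)) :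
    PP Δ (fun t => ∀ k, R k t) := by
  classical
  have := Fintype.ofFinite K
  have key : ∀ s : Finset K, PP Δ (fun t => ∀ k ∈ s, R k t) := by
    intro s
    induction s using Finset.induction_on with
    | empty => exact PP.true.congr (by simp)
    | insert a s _ ih => exact ((h a).and ih).congr (by simp)
  exact (key Finset.univ).congr (by simp)

theorem PP.fml {n : ℕ} {R : (Fin n → E) → Prop} (h : PP Δ R) : ∃ φ : PPFormula σ ar n, ∀ t, R t ↔ φ.Realize Δ t := by
  obtain ⟨m, j, φ, hφ⟩ := h
  exact ⟨rename j φ, fun t => by rw [hφ, realize_rename]⟩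

theorem PP.of_fml {n : ℕ} (φ : PPFormula σ ar n) : PP Δ (fun t : Fin n → E => φ.Realize Δ t) :=
  ⟨n, id, φ, fun _ => Iff.rfl⟩

/-- homomorphisms preserve pp relations -/
theorem realize_hom {D : Type} {Γ : RelStruct σ ar D} {e : D → E} (he : IsHom Γ Δ e) {n : ℕ} (φ : PPFormula σ ar n) (t : Fin n → D)
    (h : φ.Realize Γ t) : φ.Realize Δ (fun i => e (t i)) := by
  induction φ with
  | eq i j => simp only [PPFormula.Realize] at h ⊢; rw [h]
  | rel s v => exact he _ _ h
  | and φ ψ h1 h2 => exact ⟨h1 _ h.1, h2 _ h.2⟩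
  | ex φ ih =>
    obtain ⟨d, hd⟩ := h
    refine ⟨e d, ?_⟩
    have := ih _ hd
    convert this using 1
    funext i
    refine Fin.lastCases ?_ (fun i => ?_) i <;> simp

theorem PP.hom {R : (I → E) → Prop} (h : PP Δ R) {e : E → E} (he : IsHom Δ Δ e) (t : I → E) (ht : R t) :
    R (fun i => e (t i)) := by
  obtain ⟨n, j, φ, hφ⟩ := h
  rw [hφ] at ht ⊢
  exact realize_hom he φ _ ht

/-! #### automorphisms and orbits -/
def IsAut (Δ : RelStruct σ ar E) (γ : Equiv.Perm E) : Prop :=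
  ∀ s t, Δ.rel s t ↔ Δ.rel s (fun i => γ (t i))

theorem IsAut.hom {γ : Equiv.Perm E} (h : IsAut Δ γ) : IsHom Δ Δ γ := fun s t ht => (h s t).1 ht
theorem IsAut.symm {γ : Equiv.Perm E} (h : IsAut Δ γ) : IsAut Δ γ.symm := fun s t => by
  rw [h s (fun i => γ.symm (t i))]; simp
theorem IsAut.trans {γ γ' : Equiv.Perm E} (h : IsAut Δ γ) (h' : IsAut Δ γ') : IsAut Δ (γ.trans γ') := fun s t => by
  rw [h s t, h']; rfl

def Orb (Δ : RelStruct σ ar E) (s t : I → E) : Prop := ∃ γ, IsAut Δ γ ∧ ∀ i, γ (s i) = t i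

theorem Orb.refl (s : I → E) : Orb Δ s s := ⟨Equiv.refl _, fun _ _ => Iff.rfl, fun _ => rfl⟩
theorem Orb.symm {s t : I → E} (h : Orb Δ s t) : Orb Δ t s := by
  obtain ⟨γ, h, h'⟩ := h
  exact ⟨γ.symm, h.symm, fun i => by rw [← h']; simp⟩
theorem Orb.trans {s t u : I → E} (h : Orb Δ s t) (h' : Orb Δ t u) : Orb Δ s u := by
  obtain ⟨γ, h, h1⟩ := h
  obtain ⟨γ', h', h2⟩ := h'
  exact ⟨_, h.trans h', fun i => by simp [h1, h2]⟩
theorem Orb.comap {s t : I → E} (h : Orb Δ s t) (f : J → I) : Orb Δ (fun j => s (f j)) (fun j => t (f j)) := by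
  obtain ⟨γ, h, h1⟩ := h
  exact ⟨γ, h, fun i => h1 _⟩
theorem Orb.eq_iff {s t : I → E} (h : Orb Δ s t) (i j : I) : s i = s j ↔ t i = t j := by
  obtain ⟨γ, h, h1⟩ := h
  rw [← h1, ← h1]; simp
theorem PP.orb {R : (I → E) → Prop} (h : PP Δ R) {s t : I → E} (ho : Orb Δ s t) (hs : R s) : R t := by
  obtain ⟨γ, hγ, h1⟩ := ho
  have := h.hom hγ.hom s hs
  simpa only [h1] using this

/-- what we need from model theory -/
structure OC (Δ : RelStruct σ ar E) : Prop where
  cnt : Countable E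
  fin : ∀ n : ℕ, ∃ (N : Type) (_ : Finite N) (c : (Fin n → E) → N), ∀ s t, c s = c t → Orb Δ s t
  endo : ∀ e, IsHom Δ Δ e → ∀ (n : ℕ) (s : Fin n → E), Orb Δ s (fun i => e (s i))

theorem OC.finI (h : OC Δ) (I : Type) [Finite I] :
    ∃ (N : Type) (_ : Finite N) (c : (I → E) → N), ∀ s t, c s = c t → Orb Δ s t := by
  obtain ⟨n, ⟨e⟩⟩ := Finite.exists_equiv_fin I
  obtain ⟨N, hN, c, hc⟩ := h.fin n
  refine ⟨N, hN, fun s => c (fun i => s (e.symm i)), fun s t hst => ?_⟩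
  have := (hc _ _ hst).comap e
  simpa using this

theorem OC.endoI (h : OC Δ) {I : Type} [Finite I] {e : E → E} (he : IsHom Δ Δ e) (s : I → E) :
    Orb Δ s (fun i => e (s i)) := by
  obtain ⟨n, ⟨f⟩⟩ := Finite.exists_equiv_fin I
  have := (h.endo e he n (fun i => s (f.symm i))).comap f
  simpa using this

/-- isolation -/
theorem isolate {X N : Type} [Finite N] (c : X → N) (Q : Set (X → Prop)) (hne : Q.Nonempty)
    (hand : ∀ p ∈ Q, ∀ q ∈ Q, (fun x => p x ∧ q x) ∈ Q)
    (hinv : ∀ p ∈ Q, ∀ x y, c x = c y → p x → p y) :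
    ∃ p ∈ Q, ∀ y, p y → ∀ q ∈ Q, q y := by
  classical
  have := Fintype.ofFinite N
  have h1 : ∀ n : N, ∃ q ∈ Q, ∀ y, c y = n → q y → ∀ q' ∈ Q, q' y := by
    intro n
    by_cases h : ∃ q ∈ Q, ∃ y, c y = n ∧ ¬ q y
    · obtain ⟨q, hq, y, hy, hn⟩ := h
      exact ⟨q, hq, fun z hz hqz => (hn (hinv q hq z y (hz.trans hy.symm) hqz)).elim⟩
    · push Not at h
      obtain ⟨q, hq⟩ := hne
      exact ⟨q, hq, fun y hy _ q' hq' => h q' hq' y hy⟩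
  choose f hf hf' using h1
  have key : ∀ s : Finset N, ∃ p ∈ Q, ∀ y, p y → ∀ n ∈ s, f n y := by
    intro s
    induction s using Finset.induction_on with
    | empty => obtain ⟨q, hq⟩ := hne; exact ⟨q, hq, by simp⟩
    | insert a s _ ih =>
      obtain ⟨p, hp, hp'⟩ := ih
      refine ⟨_, hand _ (hf a) _ hp, fun y hy n hn => ?_⟩
      rcases Finset.mem_insert.1 hn with rfl | hn
      · exact hy.1
      · exact hp' y hy.2 n hn
  obtain ⟨p, hp, hp'⟩ := key Finset.univ
  exact ⟨p, hp, fun y hy => hf' (c y) y rfl (hp' y hy _ (Finset.mem_univ _))⟩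

end DC

namespace DC
open Set

section forth
variable {A B : Type} (R : ∀ n, (Fin n → A) → (Fin n → B) → Prop)

def Good (S : Finset (A × B)) : Prop :=
  ∀ n (p : Fin n → A × B), (∀ i, p i ∈ S) → R n (fun i => (p i).1) (fun i => (p i).2)

variable {R}
def Reix (R : ∀ n, (Fin n → A) → (Fin n → B) → Prop) : Prop :=
  ∀ n m (f : Fin m → Fin n) s t, R n s t → R m (fun i => s (f i)) (fun i => t (f i))

theorem good_range (hre : Reix R) {n : ℕ} {s : Fin n → A} {t : Fin n → B} (h : R n s t) (S : Finset (A × B))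
    (hS : ∀ x ∈ S, ∃ i, x = (s i, t i)) : Good R S := by
  intro m p hp
  choose f hf using fun i => hS _ (hp i)
  have := hre n m f s t h
  convert this using 2 with i i
  · rw [hf i]
  · rw [hf i]

theorem good_enum {S : Finset (A × B)} (h : Good R S) : ∃ (n : ℕ) (s : Fin n → A) (t : Fin n → B),
    R n s t ∧ ∀ x ∈ S, ∃ i, x = (s i, t i) :=
  ⟨_, _, _, h S.card (fun i => (S.equivFin.symm i).1) (fun i => (S.equivFin.symm i).2),
    fun x hx => ⟨S.equivFin ⟨x, hx⟩, by simp⟩⟩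

theorem forthG (hre : Reix R) [Countable A] [Countable B] (P : Prop)
    (hf : ∀ n s t a, R n s t → ∃ b, R (n+1) (Fin.snoc s a) (Fin.snoc t b))
    (hb : P → ∀ n s t b, R n s t → ∃ a, R (n+1) (Fin.snoc s a) (Fin.snoc t b))
    {n : ℕ} (s : Fin n → A) (t : Fin n → B) (h0 : R n s t) :
    ∃ G : Set (A × B), (∀ i, (s i, t i) ∈ G) ∧
      (∀ n (p : Fin n → A × B), (∀ i, p i ∈ G) → R n (fun i => (p i).1) (fun i => (p i).2)) ∧
      (∀ a, ∃ b, (a, b) ∈ G) ∧ (P → ∀ b, ∃ a, (a, b) ∈ G) := by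
  classical
  let St := {S : Finset (A × B) // Good R S}
  have := Encodable.ofCountable A
  have := Encodable.ofCountable B
  let D : A ⊕ B → Order.Cofinal St := fun x => match x with
    | .inl a => ⟨{S | ∃ b, (a, b) ∈ S.1}, by
        rintro ⟨S, hS⟩
        obtain ⟨n, s, t, h, h'⟩ := good_enum hS
        obtain ⟨b, hb⟩ := hf n s t a h
        refine ⟨⟨insert (a, b) S, good_range hre hb _ ?_⟩, ⟨b, by simp⟩, Finset.subset_insert _ _⟩
        intro x hx
        rcases Finset.mem_insert.1 hx with rfl | hx
        · exact ⟨Fin.last n, by simp⟩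
        · obtain ⟨i, hi⟩ := h' x hx
          exact ⟨i.castSucc, by simp [hi]⟩⟩
    | .inr b => ⟨{S | P → ∃ a, (a, b) ∈ S.1}, by
        rintro ⟨S, hS⟩
        by_cases hP : P
        · obtain ⟨n, s, t, h, h'⟩ := good_enum hS
          obtain ⟨a, hb⟩ := hb hP n s t b h
          refine ⟨⟨insert (a, b) S, good_range hre hb _ ?_⟩, fun _ => ⟨a, by simp⟩, Finset.subset_insert _ _⟩
          intro x hx
          rcases Finset.mem_insert.1 hx with rfl | hx
          · exact ⟨Fin.last n, by simp⟩
          · obtain ⟨i, hi⟩ := h' x hx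
            exact ⟨i.castSucc, by simp [hi]⟩
        · exact ⟨⟨S, hS⟩, fun h => (hP h).elim, le_rfl⟩⟩
  let S0 : St := ⟨Finset.univ.image (fun i => (s i, t i)), good_range hre h0 _ (by
    intro x hx
    simp only [Finset.mem_image, Finset.mem_univ, true_and] at hx
    obtain ⟨i, hi⟩ := hx
    exact ⟨i, hi.symm⟩)⟩
  let K := Order.idealOfCofinals S0 D
  refine ⟨{x | ∃ S ∈ K, x ∈ S.1}, fun i => ⟨S0, Order.mem_idealOfCofinals _ _, by simpa [S0] using ⟨i, rfl, rfl⟩⟩, ?_, ?_, ?_⟩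
  · intro n p hp
    choose T hT hT' using hp
    have : ∃ S ∈ K, ∀ i, T i ≤ S := by
      have key : ∀ F : Finset (Fin n), ∃ S ∈ K, ∀ i ∈ F, T i ≤ S := by
        intro F
        induction F using Finset.induction_on with
        | empty => exact ⟨S0, Order.mem_idealOfCofinals _ _, by simp⟩
        | insert a F _ ih =>
          obtain ⟨S, hS, h⟩ := ih
          obtain ⟨S', hS', h1, h2⟩ := K.directed S hS (T a) (hT a)
          refine ⟨S', hS', fun i hi => ?_⟩
          rcases Finset.mem_insert.1 hi with rfl | hi
          · exact h2
          · exact (h i hi).trans h1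
      obtain ⟨S, hS, h⟩ := key Finset.univ
      exact ⟨S, hS, fun i => h i (Finset.mem_univ i)⟩
    obtain ⟨S, _, hS⟩ := this
    exact S.2 n p fun i => hS i (hT' i)
  · intro a
    obtain ⟨S, ⟨b, hb⟩, hS⟩ := Order.cofinal_meets_idealOfCofinals S0 D (.inl a)
    exact ⟨b, S, hS, hb⟩
  · intro hP b
    obtain ⟨S, hh, hS⟩ := Order.cofinal_meets_idealOfCofinals S0 D (.inr b)
    obtain ⟨a, ha⟩ := hh hP
    exact ⟨a, S, hS, ha⟩

theorem forth (hre : Reix R) [Countable A] [Countable B]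
    (hf : ∀ n s t a, R n s t → ∃ b, R (n+1) (Fin.snoc s a) (Fin.snoc t b))
    (hfun : ∀ n s t i j, R n s t → s i = s j → t i = t j)
    {n : ℕ} (s : Fin n → A) (t : Fin n → B) (h0 : R n s t) :
    ∃ e : A → B, (∀ i, e (s i) = t i) ∧ ∀ n (s : Fin n → A), R n s (fun i => e (s i)) := by
  obtain ⟨G, h1, h2, h3, -⟩ := forthG hre False hf (fun h => h.elim) s t h0
  choose e he using h3
  refine ⟨e, fun i => ?_, fun n s => h2 n (fun i => (s i, e (s i))) fun i => he _⟩
  have := h2 2 ![(s i, e (s i)), (s i, t i)] (by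
    intro k
    refine Fin.cases ?_ (fun k => ?_) k
    · simpa using he _
    · simpa using h1 _)
  simpa using hfun 2 _ _ 0 1 this
end forth

variable {σ : Type} {ar : σ → ℕ} {E : Type} {Δ : RelStruct σ ar E} {I J : Type}

theorem snoc_comp_equiv {n : ℕ} {X : Type} (t : Fin n → X) (d : X) :
   (Fin.snoc t d : Fin (n+1) → X) = fun i => (Fin.snoc (α := fun _ => Option (Fin n)) (fun i => some i) none i).elim d t := by
  funext i
  refine Fin.lastCases ?_ (fun i => ?_) i <;> simp

theorem PP.snoc_ex {n : ℕ} {R : (Fin (n+1) → E) → Prop} (h : PP Δ R) :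
    PP Δ (fun t : Fin n → E => ∃ d, R (Fin.snoc t d)) := by
  obtain ⟨φ, hφ⟩ := h.fml
  refine (PP.of_fml (.ex φ)).congr fun t => ?_
  simp only [PPFormula.Realize]
  exact exists_congr fun d => hφ _

theorem OC.gen_endo (h : OC Δ) [Nonempty E] {n : ℕ} {s t : Fin n → E} (hst : ∀ R : (Fin n → E) → Prop, PP Δ R → R s → R t) :
    Orb Δ s t := by
  have := h.cnt
  obtain ⟨e, he, he'⟩ := forth (R := fun n (s t : Fin n → E) => ∀ R : (Fin n → E) → Prop, PP Δ R → R s → R t)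
    (by intro n m f s t H R hR hs
        exact H _ (hR.comap f) hs)
    (by
      intro n s t a H
      obtain ⟨N, hN, c, hc⟩ := h.fin (n+1)
      obtain ⟨p, ⟨hp, hp1⟩, hp2⟩ := isolate c {R | PP Δ R ∧ R (Fin.snoc s a)} ⟨fun _ => True, PP.true, trivial⟩
        (by rintro p ⟨hp, hp'⟩ q ⟨hq, hq'⟩; exact ⟨hp.and hq, hp', hq'⟩)
        (by rintro p ⟨hp, hp'⟩ x y hxy hx; exact hp.orb (hc _ _ hxy) hx)
      obtain ⟨b, hb⟩ := H _ hp.snoc_ex ⟨a, hp1⟩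
      exact ⟨b, fun R hR hs => hp2 _ hb R ⟨hR, hs⟩⟩)
    (by intro n s t i j H hij; exact H _ (PP.eq i j) hij)
    s t hst
  have hh : IsHom Δ Δ e := fun r v hv => he' _ v _ (PP.rel r id) hv
  have := h.endo e hh n s
  simpa only [he] using this

theorem OC.orb_pp (h : OC Δ) [Finite I] [Nonempty I] (s : I → E) : PP Δ (fun t => Orb Δ s t) := by
  have : Nonempty E := ⟨s (Classical.arbitrary I)⟩
  obtain ⟨N, hN, c, hc⟩ := h.finI I
  obtain ⟨p, ⟨hp, hp1⟩, hp2⟩ := isolate c {R | PP Δ R ∧ R s} ⟨fun _ => True, PP.true, trivial⟩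
    (by rintro p ⟨hp, hp'⟩ q ⟨hq, hq'⟩; exact ⟨hp.and hq, hp', hq'⟩)
    (by rintro p ⟨hp, hp'⟩ x y hxy hx; exact hp.orb (hc _ _ hxy) hx)
  refine hp.congr fun t => ⟨fun ho => hp.orb ho hp1, fun ht => ?_⟩
  obtain ⟨n, ⟨e⟩⟩ := Finite.exists_equiv_fin I
  have : Orb Δ (fun i => s (e.symm i)) (fun i => t (e.symm i)) :=
    h.gen_endo fun R hR hs => hp2 t ht (fun t => R (fun i => t (e.symm i))) ⟨hR.comap e.symm, hs⟩
  simpa using this.comap e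

open Filter in
theorem OC.compact (h : OC Δ) [Countable I] (𝒰 : Ultrafilter ℕ) (w : ℕ → I → E) :
    ∃ v : I → E, ∀ n (j : Fin n → I), ∀ᶠ k in (𝒰 : Filter ℕ), Orb Δ (fun i => w k (j i)) (fun i => v (j i)) := by
  have := h.cnt
  obtain ⟨e, -, he'⟩ := forth (R := fun n (s : Fin n → I) (t : Fin n → E) =>
      ∀ᶠ k in (𝒰 : Filter ℕ), Orb Δ (fun i => w k (s i)) t)
    (by intro n m f s t H; filter_upwards [H] with k hk; exact hk.comap f)
    (by
      intro n s t a H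
      obtain ⟨N, hN, c, hc⟩ := h.fin (n+1)
      have H' : ∀ᶠ k in (𝒰 : Filter ℕ), ∃ b, Orb Δ (fun i => w k (Fin.snoc (α := fun _ => I) s a i)) (Fin.snoc t b) := by
        filter_upwards [H] with k hk
        obtain ⟨γ, hγ, hk⟩ := hk
        refine ⟨γ (w k a), γ, hγ, fun i => ?_⟩
        refine Fin.lastCases ?_ (fun i => ?_) i <;> simp [hk]
      have H2 : ∀ᶠ k in (𝒰 : Filter ℕ), ∃ x : N, ∃ b, c (Fin.snoc t b) = x ∧ Orb Δ (fun i => w k (Fin.snoc (α := fun _ => I) s a i)) (Fin.snoc t b) := by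
        filter_upwards [H'] with k ⟨b, hb⟩
        exact ⟨_, b, rfl, hb⟩
      rw [Ultrafilter.eventually_exists_iff] at H2
      obtain ⟨x, hx⟩ := H2
      obtain ⟨k, b, hb, -⟩ := hx.exists
      refine ⟨b, ?_⟩
      filter_upwards [hx] with k ⟨b', hb', ho⟩
      exact ho.trans (hc _ _ (hb'.trans hb.symm)))
    (by
      intro n s t i j H hij
      obtain ⟨k, hk⟩ := H.exists
      exact (hk.eq_iff i j).1 (by rw [hij]))
    Fin.elim0 Fin.elim0 (Eventually.of_forall fun k => ⟨Equiv.refl _, fun _ _ => Iff.rfl, fun i => i.elim0⟩)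
  exact ⟨e, he'⟩

/-! #### pseudoloops -/
def PPs (Δ : RelStruct σ ar E) (S : (I → E) → (I → E) → Prop) : Prop :=
  PP Δ (fun t : I ⊕ I → E => S (fun i => t (.inl i)) (fun i => t (.inr i)))

def NoPLF (Δ : RelStruct σ ar E) (I : Type) : Prop :=
  ∀ S : (I → E) → (I → E) → Prop, PPs Δ S → (∀ u v, S u v → S v u) → (∃ u v, S u v) → ∃ u v, S u v ∧ Orb Δ u v

theorem OC.lg_aux (h : OC Δ) {K : Type} [Finite K] [Nonempty K] (hK : NoPLF Δ K) [Finite I]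
    (S : (I → E) → (I → E) → Prop) (hS : PPs Δ S) (hsym : ∀ u v, S u v → S v u) (hne : ∃ u v, S u v) :
    ∃ S' : (I → E) → (I → E) → Prop, PPs Δ S' ∧ (∀ u v, S' u v → S' v u) ∧ (∃ u v, S' u v) ∧
      (∀ u v, S' u v → S u v) ∧
      ∀ (f : K → I), ∃ w : K → E, ∀ u v, S' u v → Orb Δ w (fun i => u (f i)) ∧ Orb Δ w (fun i => v (f i)) := by
  classical
  have := Fintype.ofFinite (K → I)
  have key : ∀ F : Finset (K → I), ∃ S' : (I → E) → (I → E) → Prop, PPs Δ S' ∧ (∀ u v, S' u v → S' v u) ∧ (∃ u v, S' u v) ∧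
      (∀ u v, S' u v → S u v) ∧
      ∀ f ∈ F, ∃ w : K → E, ∀ u v, S' u v → Orb Δ w (fun i => u (f i)) ∧ Orb Δ w (fun i => v (f i)) := by
    intro F
    induction F using Finset.induction_on with
    | empty => exact ⟨S, hS, hsym, hne, fun _ _ h => h, by simp⟩
    | insert f F _ ih =>
      obtain ⟨S', h1, h2, ⟨u, v, h3⟩, h4, h5⟩ := ih
      obtain ⟨p, q, ⟨u', v', hS', rfl, rfl⟩, ho⟩ := hK
        (fun p q => ∃ u v, S' u v ∧ p = (fun i => u (f i)) ∧ q = (fun i => v (f i))) (by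
          have : Nonempty K := inferInstance
          have h6 : PP Δ (fun t : K ⊕ K → E => ∃ w : I ⊕ I → E, (S' (fun i => w (.inl i)) (fun i => w (.inr i)) ∧
             (∀ k, t (.inl k) = w (.inl (f k))) ∧ (∀ k, t (.inr k) = w (.inr (f k))))) := by
            apply PP.exFin
            refine PP.and ?_ (PP.and ?_ ?_)
            · exact h1.comap (J := (K ⊕ K) ⊕ (I ⊕ I)) Sum.inr
            · exact PP.all _ fun k => PP.eq _ _
            · exact PP.all _ fun k => PP.eq _ _
          refine h6.congr fun t => ?_
          constructor
          · rintro ⟨u, v, h, h', h''⟩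
            exact ⟨Sum.elim u v, h, fun k => congrFun h' k, fun k => congrFun h'' k⟩
          · rintro ⟨w, h, h', h''⟩
            exact ⟨_, _, h, funext h', funext h''⟩)
        (by rintro p q ⟨u, v, h, rfl, rfl⟩; exact ⟨v, u, h2 _ _ h, rfl, rfl⟩)
        ⟨_, _, u, v, h3, rfl, rfl⟩
      refine ⟨fun u v => S' u v ∧ Orb Δ (fun i => u' (f i)) (fun i => u (f i)) ∧ Orb Δ (fun i => u' (f i)) (fun i => v (f i)), ?_, ?_, ?_, ?_, ?_⟩
      · refine PP.and h1 (PP.and ?_ ?_)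
        · exact (h.orb_pp (fun i => u' (f i))).comap (J := I ⊕ I) (fun k => .inl (f k))
        · exact (h.orb_pp (fun i => u' (f i))).comap (J := I ⊕ I) (fun k => .inr (f k))
      · rintro u v ⟨h, h', h''⟩; exact ⟨h2 _ _ h, h'', h'⟩
      · exact ⟨u', v', hS', Orb.refl _, ho⟩
      · rintro u v ⟨h, -⟩; exact h4 _ _ h
      · intro f' hf'
        rcases Finset.mem_insert.1 hf' with rfl | hf'
        · exact ⟨_, fun u v h => h.2⟩
        · obtain ⟨w, hw⟩ := h5 f' hf'
          exact ⟨w, fun u v h => hw u v h.1⟩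
  obtain ⟨S', h1, h2, h3, h4, h5⟩ := key Finset.univ
  exact ⟨S', h1, h2, h3, h4, fun f => h5 f (Finset.mem_univ f)⟩

theorem OC.lg (h : OC Δ) {K : Type} [Finite K] [Nonempty K] (hK : NoPLF Δ K) [Finite I]
    (hloc : ∀ u v : I → E, (∀ f : K → I, Orb Δ (fun i => u (f i)) (fun i => v (f i))) → Orb Δ u v) : NoPLF Δ I := by
  intro S hS hsym hne
  obtain ⟨S', h1, h2, ⟨u, v, h3⟩, h4, h5⟩ := h.lg_aux hK S hS hsym hne
  refine ⟨u, v, h4 _ _ h3, hloc u v fun f => ?_⟩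
  obtain ⟨w, hw⟩ := h5 f
  exact (hw u v h3).1.symm.trans (hw u v h3).2

end DC

namespace DC
open Set Filter

variable {σ : Type} {ar : σ → ℕ} {E : Type} {Δ : RelStruct σ ar E} {I J : Type}

/-- generic relation generated by two tuples -/
theorem OC.gen (h : OC Δ) [Finite I] [Nonempty I] (s t : I → E) :
    ∃ S : (I → E) → (I → E) → Prop, PPs Δ S ∧ S s t ∧ S t s ∧ (∀ u v, S u v → S v u) ∧
      ∀ u v, S u v → ∀ R : (I ⊕ I → E) → Prop, PP Δ R → R (Sum.elim s t) → R (Sum.elim t s) → R (Sum.elim u v) := by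
  obtain ⟨N, hN, c, hc⟩ := h.finI (I ⊕ I)
  obtain ⟨p, ⟨hp, hp1, hp1'⟩, hp2⟩ := isolate c {R | PP Δ R ∧ R (Sum.elim s t) ∧ R (Sum.elim t s)}
    ⟨fun _ => True, PP.true, trivial, trivial⟩
    (by rintro p ⟨hp, hp', hp''⟩ q ⟨hq, hq', hq''⟩; exact ⟨hp.and hq, ⟨hp', hq'⟩, hp'', hq''⟩)
    (by rintro p ⟨hp, -⟩ x y hxy hx; exact hp.orb (hc _ _ hxy) hx)
  have e1 : ∀ w : I ⊕ I → E, Sum.elim (fun i => w (.inl i)) (fun i => w (.inr i)) = w := by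
    intro w; funext i; cases i <;> rfl
  refine ⟨fun u v => p (Sum.elim u v), hp.congr fun w => by simp only [e1], hp1, hp1', ?_, ?_⟩
  · intro u v huv
    have := hp2 _ huv (fun w => p (fun i => w i.swap)) ⟨hp.comap Sum.swap, by
      convert hp1' using 1; funext i; cases i <;> rfl, by
      convert hp1 using 1; funext i; cases i <;> rfl⟩
    convert this using 1; funext i; cases i <;> rfl
  · intro u v huv R hR h1 h2
    exact hp2 _ huv R ⟨hR, h1, h2⟩

theorem OC.sym (h : OC Δ) [Nonempty E] (hno : ∀ (I : Type) [Finite I], NoPLF Δ I) :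
    HasSymmetricPolymorphismModEndos Δ := by
  classical
  have := h.cnt
  obtain ⟨ι, hι⟩ := exists_injective_nat E
  let e0 : E := Classical.arbitrary E
  let Jn : ℕ → Type := fun n => {p : E × E // ι p.1 ≤ ι e0 + n ∧ ι p.2 ≤ ι e0 + n}
  have hfin : ∀ n, Finite (Jn n) := by
    intro n
    have : Set.Finite {p : E × E | ι p.1 ≤ ι e0 + n ∧ ι p.2 ≤ ι e0 + n} := by
      have h1 : Set.Finite {x : E | ι x ≤ ι e0 + n} := Set.Finite.preimage hι.injOn (Set.finite_le_nat _)
      exact (h1.prod h1).subset fun p hp => ⟨hp.1, hp.2⟩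
    exact this.to_subtype
  have hmem : ∀ p : E × E, ∀ᶠ n in (hyperfilter ℕ : Filter ℕ), ι p.1 ≤ ι e0 + n ∧ ι p.2 ≤ ι e0 + n := by
    intro p
    have : ∀ᶠ n in (atTop : Filter ℕ), ι p.1 ≤ ι e0 + n ∧ ι p.2 ≤ ι e0 + n := by
      filter_upwards [eventually_ge_atTop (ι p.1 + ι p.2)] with n hn
      omega
    exact (Nat.hyperfilter_le_atTop) this
  have hU : ∀ n, ∃ w : E × E → E,
      (∀ s (x y : Fin (ar s) → E), (∀ i, ι (x i) ≤ ι e0 + n ∧ ι (y i) ≤ ι e0 + n) → Δ.rel s x → Δ.rel s y → Δ.rel s (fun i => w (x i, y i))) ∧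
      ∃ γ, IsAut Δ γ ∧ ∀ p : E × E, (ι p.1 ≤ ι e0 + n ∧ ι p.2 ≤ ι e0 + n) → γ (w p) = w p.swap := by
    intro n
    have := hfin n
    have : Nonempty (Jn n) := ⟨⟨(e0, e0), by simp⟩⟩
    obtain ⟨S, h1, h2, h2', h3, h4⟩ := h.gen (fun p : Jn n => p.1.1) (fun p : Jn n => p.1.2)
    obtain ⟨u, v, huv, ho⟩ := hno (Jn n) S h1 h3 ⟨_, _, h2⟩
    obtain ⟨γ, hγ, hγ'⟩ := ho
    refine ⟨fun p => if hp : (ι p.1 ≤ ι e0 + n ∧ ι p.2 ≤ ι e0 + n) then u ⟨p, hp⟩ else e0, ?_, γ, hγ, ?_⟩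
    · intro s x y hxy hx hy
      have := h4 u v huv _ (PP.rel (I := Jn n ⊕ Jn n) s (fun i => Sum.inl ⟨(x i, y i), hxy i⟩)) hx hy
      simpa [hxy] using this
    · intro p hp
      have := h4 u v huv _ (PP.eq (I := Jn n ⊕ Jn n) (Sum.inl ⟨p.swap, hp.2, hp.1⟩) (Sum.inr ⟨p, hp⟩)) rfl rfl
      simp only [Sum.elim_inl, Sum.elim_inr] at this
      simp [hp, hγ', ← this]
  choose w hw1 γ hγ hw2 using hU
  obtain ⟨f, hf⟩ := h.compact (hyperfilter ℕ) w
  have hfo : ∀ n (p : Fin n → E × E), Orb Δ (fun i => f (p i)) (fun i => f (p i).swap) := by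
    intro n p
    have h1 : ∀ᶠ k in (hyperfilter ℕ : Filter ℕ), ∀ i, ι (p i).1 ≤ ι e0 + k ∧ ι (p i).2 ≤ ι e0 + k :=
      eventually_all.2 fun i => hmem (p i)
    obtain ⟨k, h1, h2, h3⟩ := (h1.and ((hf n p).and (hf n (fun i => (p i).swap)))).exists
    exact h2.symm.trans (Orb.trans ⟨γ k, hγ k, fun i => hw2 k _ (h1 i)⟩ h3)
  have hfo' : ∀ n, ∃ γ, IsAut Δ γ ∧ ∀ p : E × E, (ι p.1 ≤ ι e0 + n ∧ ι p.2 ≤ ι e0 + n) → γ (f p) = f p.swap := by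
    intro n
    have := hfin n
    obtain ⟨m, ⟨e⟩⟩ := Finite.exists_equiv_fin (Jn n)
    obtain ⟨γ, hγ, h2⟩ := hfo m (fun i => (e.symm i).1)
    exact ⟨γ, hγ, fun p hp => by simpa using h2 (e ⟨p, hp⟩)⟩
  choose δ hδ hδ' using hfo'
  obtain ⟨g, hg⟩ := h.compact (hyperfilter ℕ) (fun n => Sum.elim (δ n) (id : E → E))
  have hpres : ∀ (s : σ) (j : Fin (ar s) → E ⊕ E), (∀ n, Δ.rel s (fun i => Sum.elim (δ n) (id : E → E) (j i))) →
      Δ.rel s (fun i => g (j i)) := by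
    intro s j hj
    obtain ⟨n, hn⟩ := (hg _ j).exists
    exact (PP.rel s id).orb hn (hj n)
  refine ⟨fun x y => f (x, y), fun x => g (.inl x), fun x => g (.inr x), ?_, ?_, ?_, ?_⟩
  · intro s ts hts
    have h1 : ∀ᶠ k in (hyperfilter ℕ : Filter ℕ), ∀ i, ι (ts 0 i) ≤ ι e0 + k ∧ ι (ts 1 i) ≤ ι e0 + k :=
      eventually_all.2 fun i => hmem (ts 0 i, ts 1 i)
    obtain ⟨k, h1, h2⟩ := (h1.and (hf _ (fun i => (ts 0 i, ts 1 i)))).exists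
    exact (PP.rel s id).orb h2 (hw1 k s _ _ h1 (hts 0) (hts 1))
  · intro s t ht
    exact hpres s (fun i => .inl (t i)) fun n => (hδ n s t).1 ht
  · intro s t ht
    exact hpres s (fun i => .inr (t i)) fun n => ht
  · intro x y
    obtain ⟨k, h1, h2⟩ := ((hmem (x, y)).and (hg 2 ![.inl (f (x, y)), .inr (f (y, x))])).exists
    have := (h2.eq_iff 0 1).1 (by simpa using hδ' k (x, y) h1)
    simpa using this

/-! #### establishing OC -/
theorem OC.of_core {N : ℕ → Type} [∀ n, Finite (N n)] [Countable E] (hcore : IsModelCompleteCore Δ)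
    (c : ∀ n, (Fin n → E) → N n)
    (hc : ∀ n (s t : Fin n → E), c n s = c n t → ∀ φ : FOFormula σ ar n, φ.Realize Δ s → φ.Realize Δ t) : OC Δ := by
  have key : ∀ n (s t : Fin n → E), (∀ φ : FOFormula σ ar n, φ.Realize Δ s ↔ φ.Realize Δ t) → Orb Δ s t := by
    intro n s t hst
    have hfo : ∀ n (s t : Fin n → E) a, (∀ φ : FOFormula σ ar n, φ.Realize Δ s ↔ φ.Realize Δ t) →
        ∃ b, ∀ φ : FOFormula σ ar (n+1), φ.Realize Δ (Fin.snoc s a) ↔ φ.Realize Δ (Fin.snoc t b) := by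
      intro n s t a H
      obtain ⟨p, ⟨φ, rfl, hp1⟩, hp2⟩ := isolate (c (n+1)) {R | ∃ φ : FOFormula σ ar (n+1), R = φ.Realize Δ ∧ φ.Realize Δ (Fin.snoc s a)}
        ⟨_, .eq 0 0, rfl, by simp [FOFormula.Realize]⟩
        (by rintro p ⟨φ, rfl, hp⟩ q ⟨ψ, rfl, hq⟩; exact ⟨.and φ ψ, rfl, hp, hq⟩)
        (by rintro p ⟨φ, rfl, hp⟩ x y hxy hx; exact hc _ _ _ hxy _ hx)
      obtain ⟨b, hb⟩ := (H (.ex φ)).1 ⟨a, hp1⟩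
      refine ⟨b, fun ψ => ⟨fun hs => hp2 _ hb _ ⟨ψ, rfl, hs⟩, fun hs => ?_⟩⟩
      by_contra hn
      exact hp2 _ hb _ ⟨.not ψ, rfl, hn⟩ hs
    obtain ⟨G, h1, h2, h3, h4⟩ := forthG (R := fun n (s t : Fin n → E) => ∀ φ : FOFormula σ ar n, φ.Realize Δ s ↔ φ.Realize Δ t)
      (by
        intro n m f s t H φ
        have ren : ∀ {m} (φ : FOFormula σ ar m), ∀ {n} (f : Fin m → Fin n), ∃ ψ : FOFormula σ ar n,
            ∀ s : Fin n → E, ψ.Realize Δ s ↔ φ.Realize Δ (fun i => s (f i)) := by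
          intro m φ
          induction φ with
          | eq i j => intro n f; exact ⟨.eq (f i) (f j), fun s => Iff.rfl⟩
          | rel r v => intro n f; exact ⟨.rel r (fun k => f (v k)), fun s => Iff.rfl⟩
          | not φ ih => intro n f; obtain ⟨ψ, h⟩ := ih f; exact ⟨.not ψ, fun s => not_congr (h s)⟩
          | and φ φ' ih ih' =>
            intro n f; obtain ⟨ψ, h⟩ := ih f; obtain ⟨ψ', h'⟩ := ih' f
            exact ⟨.and ψ ψ', fun s => and_congr (h s) (h' s)⟩
          | ex φ ih =>
            intro n f
            obtain ⟨ψ, h⟩ := ih (Fin.snoc (α := fun _ => Fin (n+1)) (fun i => (f i).castSucc) (Fin.last n))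
            refine ⟨.ex ψ, fun s => exists_congr fun d => (h _).trans (iff_of_eq ?_)⟩
            congr 1
            funext i
            refine Fin.lastCases ?_ (fun i => ?_) i <;> simp
        obtain ⟨ψ, h⟩ := ren φ f
        rw [← h, ← h]; exact H ψ)
      True hfo
      (fun _ n s t b H => by
        obtain ⟨a, ha⟩ := hfo n t s b fun φ => (H φ).symm
        exact ⟨a, fun φ => (ha φ).symm⟩)
      s t hst
    have h4 := h4 trivial
    have inj : ∀ p ∈ G, ∀ q ∈ G, p.1 = q.1 ↔ p.2 = q.2 := by
      intro p hp q hq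
      have := h2 2 ![p, q] (by
        intro k
        refine Fin.cases ?_ (fun k => ?_) k
        · simpa using hp
        · simpa using hq) (.eq 0 1)
      simpa [FOFormula.Realize] using this
    choose a ha using h3
    choose b hb using h4
    refine ⟨⟨a, b, fun x => (inj _ (hb (a x)) _ (ha x)).2 rfl, fun x => (inj _ (ha (b x)) _ (hb x)).1 rfl⟩, ?_, ?_⟩
    · intro r v
      have := h2 _ (fun i => (v i, a (v i))) (fun i => ha _) (.rel r id)
      simpa [FOFormula.Realize] using this
    · intro i
      exact (inj _ (ha (s i)) _ (h1 i)).1 rfl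
  refine ⟨inferInstance, fun n => ⟨N n, inferInstance, c n, fun s t hst => key n s t fun φ => ⟨hc n s t hst φ, hc n t s hst.symm φ⟩⟩, ?_⟩
  intro e he n s
  exact key n _ _ fun φ => hcore e he φ s

end DC

namespace DC
open Set Filter

variable {σ : Type} {ar : σ → ℕ} {L E : Type} {C : L → L → L → Prop} {Γ : RelStruct σ ar L} {Δ : RelStruct σ ar E} {I J : Type}

theorem fo_aut {τ : Type} {at' : τ → ℕ} {D : Type} {Θ : RelStruct τ at' D} {α : D → D} (hb : Function.Bijective α)
    (h : ∀ s t, Θ.rel s t ↔ Θ.rel s (fun i => α (t i))) {n : ℕ} (φ : FOFormula τ at' n) :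
    ∀ t, φ.Realize Θ t ↔ φ.Realize Θ (fun i => α (t i)) := by
  induction φ with
  | eq i j => intro t; simp [FOFormula.Realize, hb.1.eq_iff]
  | rel s v => intro t; exact h _ _
  | not φ ih => intro t; exact not_congr (ih t)
  | and φ ψ ih ih' => intro t; exact and_congr (ih t) (ih' t)
  | ex φ ih =>
    intro t
    simp only [FOFormula.Realize]
    have e : ∀ d, (fun i => α (Fin.snoc (α := fun _ => D) t d i)) = Fin.snoc (α := fun _ => D) (fun i => α (t i)) (α d) := by
      intro d; funext i
      refine Fin.lastCases ?_ (fun i => ?_) i <;> simp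
    constructor
    · rintro ⟨d, hd⟩
      exact ⟨α d, by rw [← e]; exact (ih _).1 hd⟩
    · rintro ⟨d, hd⟩
      obtain ⟨d, rfl⟩ := hb.2 d
      exact ⟨d, by rw [← e] at hd; exact (ih _).2 hd⟩

/-- C-isomorphic tuples -/
def CIso (C : L → L → L → Prop) (s t : I → L) : Prop :=
  (∀ i j, s i = s j ↔ t i = t j) ∧ ∀ i j k, C (s i) (s j) (s k) ↔ C (t i) (t j) (t k)

theorem CIso.aut (hL : IsHomBBDenseC C) [Finite I] {s t : I → L} (h : CIso C s t) :
    ∃ α, IsCAutomorphism C α ∧ ∀ i, α (s i) = t i := by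
  classical
  have := Fintype.ofFinite I
  have hf : Function.FactorsThrough t s := fun i j hij => (h.1 i j).1 hij
  have hx : ∀ i, Function.extend s t id (s i) = t i := fun i => hf.extend_apply _ _
  obtain ⟨g, hg, hg'⟩ := hL.2.2.2.2.2 (Finset.univ.image s) (Function.extend s t id)
    (by
      rintro x hx' y hy' hxy
      simp only [Finset.coe_image, Finset.coe_univ, image_univ, mem_range] at hx' hy'
      obtain ⟨i, rfl⟩ := hx'
      obtain ⟨j, rfl⟩ := hy'
      rw [hx, hx] at hxy
      exact (h.1 i j).2 hxy)
    (by
      simp only [Finset.mem_image, Finset.mem_univ, true_and]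
      rintro _ ⟨i, rfl⟩ _ ⟨j, rfl⟩ _ ⟨k, rfl⟩
      rw [hx, hx, hx]; exact h.2 i j k)
  exact ⟨g, hg, fun i => by rw [hg' _ (by simp), hx]⟩

theorem CIso.refl (s : I → L) : CIso C s s := ⟨fun _ _ => Iff.rfl, fun _ _ _ => Iff.rfl⟩
theorem CIso.symm {s t : I → L} (h : CIso C s t) : CIso C t s :=
  ⟨fun i j => (h.1 i j).symm, fun i j k => (h.2 i j k).symm⟩
theorem CIso.trans {s t u : I → L} (h : CIso C s t) (h' : CIso C t u) : CIso C s u :=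
  ⟨fun i j => (h.1 i j).trans (h'.1 i j), fun i j k => (h.2 i j k).trans (h'.2 i j k)⟩
theorem CIso.comap {s t : I → L} (h : CIso C s t) (f : J → I) : CIso C (fun j => s (f j)) (fun j => t (f j)) :=
  ⟨fun i j => h.1 _ _, fun i j k => h.2 _ _ _⟩
theorem CIso.of_aut {α : L → L} (h : IsCAutomorphism C α) (s : I → L) : CIso C s (fun i => α (s i)) :=
  ⟨fun i j => h.1.1.eq_iff.symm, fun i j k => (h.2 _ _ _).symm⟩

structure Setup (C : L → L → L → Prop) (Γ : RelStruct σ ar L) (Δ : RelStruct σ ar E) (h : L → E) (g : E → L) : Prop where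
  hL : IsHomBBDenseC C
  oc : OC Δ
  hh : IsHom Γ Δ h
  hg : IsHom Δ Γ g
  aut : ∀ α, IsCAutomorphism C α → IsHom Γ Γ α

theorem hcomp {A B D : Type} {X : RelStruct σ ar A} {Y : RelStruct σ ar B} {Z : RelStruct σ ar D} {f : A → B} {g : B → D}
    (hf : IsHom X Y f) (hg : IsHom Y Z g) : IsHom X Z (fun x => g (f x)) := fun s t ht => hg s _ (hf s t ht)

theorem Setup.mk' (hL : IsHomBBDenseC C) (hred : IsReduct C Γ) (hcore : IsModelCompleteCore Δ) (hE : Countable E)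
    {h : L → E} {g : E → L} (hh : IsHom Γ Δ h) (hg : IsHom Δ Γ g) : Setup C Γ Δ h g := by
  have aut : ∀ α, IsCAutomorphism C α → IsHom Γ Γ α := by
    intro α hα s t ht
    obtain ⟨φ, hφ⟩ := hred s
    rw [hφ] at ht ⊢
    exact (fo_aut hα.1 (fun s t => (hα.2 _ _ _).symm) φ t).1 ht
  refine ⟨hL, ?_, hh, hg, aut⟩
  refine OC.of_core (N := fun n => (Fin n → Fin n → Prop) × (Fin n → Fin n → Fin n → Prop)) hcore
    (fun n s => (fun i j => g (s i) = g (s j), fun i j k => C (g (s i)) (g (s j)) (g (s k)))) ?_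
  intro n s t hst φ hφ
  simp only [Prod.mk.injEq] at hst
  obtain ⟨α, hα, h2⟩ := CIso.aut (C := C) (s := fun i => g (s i)) (t := fun i => g (t i)) hL
    ⟨fun i j => iff_of_eq (congrFun (congrFun hst.1 i) j), fun i j k => iff_of_eq (congrFun (congrFun (congrFun hst.2 i) j) k)⟩
  have h3 := (hcore _ (hcomp (hcomp hg (aut α hα)) hh) φ s).1 hφ
  simp only [h2] at h3
  exact (hcore _ (hcomp hg hh) φ t).2 h3

/-! #### (1) → (2) -/
theorem one_two (oc : OC Δ) (H : HasSymmetricPolymorphismModEndos Δ) (n : ℕ) (a : Fin n → E)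
    (ξ : CloneHom (polClone (Δ.withConstants a)) (projClone Bool)) : False := by
  obtain ⟨f, e1, e2, hf, h1, h2, hfe⟩ := H
  have hu : IsHom Δ Δ (fun x => f x x) := fun s t ht => hf s (fun _ => t) (fun _ => ht)
  obtain ⟨γ, hγ, hγa⟩ := oc.endo _ hu n a
  simp only at hγa
  have h1' : IsHom Δ Δ (fun x => e1 (γ x)) := hcomp hγ.hom h1
  have h2' : IsHom Δ Δ (fun x => e2 (γ x)) := hcomp hγ.hom h2
  obtain ⟨δ, hδ, hδa⟩ := oc.endo _ h1' n a
  simp only at hδa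
  have key1 : ∀ x y, δ.symm (e1 (γ (γ.symm (f x y)))) = δ.symm (e2 (γ (γ.symm (f y x)))) := by
    intro x y; simp [hfe]
  have mem1 : ∀ e : E → E, IsHom Δ Δ e → (∀ i, e (a i) = a i) → (fun t : Fin 1 → E => e (t 0)) ∈ (polClone (Δ.withConstants a)).ops 1 := by
    intro e he hea s
    cases s with
    | inl s => intro ts hts; exact he s _ (hts 0)
    | inr i =>
      intro ts hts
      have := hts 0
      show e (ts 0 (0 : Fin 1)) = a i
      rw [show ts 0 (0 : Fin 1) = a i from this, hea]
  have memf : (fun t : Fin 2 → E => γ.symm (f (t 0) (t 1))) ∈ (polClone (Δ.withConstants a)).ops 2 := by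
    intro s
    cases s with
    | inl s => intro ts hts; exact hγ.symm.hom s _ (hf s ts hts)
    | inr i =>
      intro ts hts
      show γ.symm (f (ts 0 (0 : Fin 1)) (ts 1 (0 : Fin 1))) = a i
      rw [show ts 0 (0 : Fin 1) = a i from hts 0, show ts 1 (0 : Fin 1) = a i from hts 1]
      rw [← hγa]; simp
  have m1 := mem1 (fun x => δ.symm (e1 (γ x))) (hcomp h1' hδ.symm.hom) (fun i => by rw [← hδa]; simp)
  have m2 := mem1 (fun x => δ.symm (e2 (γ x))) (hcomp h2' hδ.symm.hom) (fun i => by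
    rw [hγa, ← hfe, ← hγa, ← hδa]; simp)
  have un : ∀ e : {f // f ∈ (polClone (Δ.withConstants a)).ops 1}, ∀ t, (ξ.map e).1 t = t 0 := by
    intro e t
    obtain ⟨i, hi⟩ := (ξ.map e).2
    rw [hi, Subsingleton.elim i 0]
  have swap : ∀ i : Fin 2, (fun t : Fin 2 → E => t (Equiv.swap 0 1 i)) ∈ (polClone (Δ.withConstants a)).ops 2 :=
    fun i => (polClone (Δ.withConstants a)).proj_mem 2 _
  have c1 := ξ.map_comp ⟨_, m1⟩ (fun _ : Fin 1 => ⟨_, memf⟩)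
  have c2 := ξ.map_comp ⟨_, memf⟩ (fun i => ⟨_, swap i⟩)
  have c3 := ξ.map_comp ⟨_, m2⟩ (fun _ : Fin 1 => ⟨_, (polClone (Δ.withConstants a)).comp_mem _ _ memf swap⟩)
  have pr : ∀ i : Fin 2, (ξ.map ⟨_, swap i⟩).1 = fun t => t (Equiv.swap 0 1 i) := fun i => ξ.map_proj _
  have eq : (⟨fun t => δ.symm (e1 (γ (γ.symm (f (t 0) (t 1))))), (polClone (Δ.withConstants a)).comp_mem _ (fun _ => _) m1 (fun _ => memf)⟩ : {f // f ∈ (polClone (Δ.withConstants a)).ops 2})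
    = ⟨fun t => δ.symm (e2 (γ (γ.symm (f (t (Equiv.swap 0 1 0)) (t (Equiv.swap 0 1 1)))))), (polClone (Δ.withConstants a)).comp_mem _ (fun _ => _) m2 (fun _ => (polClone (Δ.withConstants a)).comp_mem _ _ memf swap)⟩ := by
    apply Subtype.ext
    funext t
    simp only [Equiv.swap_apply_left, Equiv.swap_apply_right]
    exact key1 _ _
  have c4 : ∀ t, (ξ.map ⟨_, memf⟩).1 t = (ξ.map ⟨_, memf⟩).1 (fun i => t (Equiv.swap 0 1 i)) := by
    intro t
    have e1 := congrFun c1 t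
    have e2 := congrFun c2 t
    have e3 := congrFun c3 t
    simp only [un, pr] at e1 e2 e3
    rw [← e1, ← e2, ← e3]
    exact congrFun (congrArg (fun z => (ξ.map z).1) eq) t
  obtain ⟨i, hi⟩ := (ξ.map ⟨_, memf⟩).2
  rw [hi] at c4
  have := c4 ![true, false]
  revert this
  fin_cases i <;> simp

/-! #### (3) → (4) -/
theorem nae_proj {n : ℕ} (q : (Fin n → Bool) → Bool) (hq : PreservesRel q (NAEStruct.rel ())) :
    ∃ i, ∀ x, xor (q x) (q (fun _ => false)) = x i := by
  classical
  have nae : ∀ x y z : Fin n → Bool, (∀ i, ¬ (x i = y i ∧ y i = z i)) → ¬ (q x = q y ∧ q y = q z) := by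
    intro x y z h h'
    have := hq (fun i k => (![x, y, z] k) i) (by
      intro i
      have := h i
      simp only [NAEStruct, Fin.exists_fin_succ]
      cases h1 : x i <;> cases h2 : y i <;> cases h3 : z i <;> simp_all)
    simp only [NAEStruct, Fin.exists_fin_succ] at this
    cases h1 : q x <;> cases h2 : q y <;> cases h3 : q z <;> simp_all
  have dual : ∀ x, q (fun i => !x i) = !q x := by
    intro x
    have := nae x x (fun i => !x i) (by intro i; simp)
    cases h1 : q x <;> cases h2 : q (fun i => !x i) <;> simp_all
  have meet : ∀ x y, q x = !q (fun _ => false) → q y = !q (fun _ => false) → q (fun i => x i && y i) = !q (fun _ => false) := by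
    intro x y hx hy
    have := nae x y (fun i => !(x i && y i)) (by intro i; cases x i <;> cases y i <;> simp)
    rw [dual (fun i => x i && y i), hx, hy] at this
    revert this
    generalize q (fun i => x i && y i) = b
    generalize q (fun _ => false) = c
    revert b c; decide
  have ex : ∃ i, ∀ x, q x = (!q (fun _ => false)) → x i = true := by
    by_contra hn
    push Not at hn
    choose x hx hx' using hn
    have key : ∀ s : Finset (Fin n), ∃ y, (q y = !q (fun _ => false)) ∧ ∀ i ∈ s, y i = false := by
      intro s
      induction s using Finset.induction_on with
      | empty => exact ⟨fun _ => true, by rw [← dual]; rfl, by simp⟩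
      | insert a s _ ih =>
        obtain ⟨y, hy, hy'⟩ := ih
        refine ⟨_, meet _ _ (hx a) hy, fun i hi => ?_⟩
        rcases Finset.mem_insert.1 hi with rfl | hi
        · simp [Bool.eq_false_iff.2 (hx' i)]
        · simp [hy' i hi]
    obtain ⟨y, hy, hy'⟩ := key Finset.univ
    rw [show y = fun _ => false from funext fun i => hy' i (Finset.mem_univ i)] at hy
    revert hy
    generalize q (fun _ => false) = c
    revert c; decide
  obtain ⟨i, hi⟩ := ex
  refine ⟨i, fun x => ?_⟩
  have h1 := hi x
  have h2 := hi (fun i => !x i)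
  rw [dual] at h2
  cases h3 : q x <;> cases h4 : q (fun _ => false) <;> simp_all

theorem PPFormula.pol {D : Type} {Θ : RelStruct σ ar D} {k : ℕ} {f : (Fin k → D) → D} (hf : IsPolymorphism Θ f) {m : ℕ}
    (φ : PPFormula σ ar m) : ∀ ts : Fin k → Fin m → D, (∀ i, φ.Realize Θ (ts i)) → φ.Realize Θ (fun j => f (fun i => ts i j)) := by
  induction φ with
  | eq i j =>
    intro ts h
    show f _ = f _
    congr 1; funext k; exact h k
  | rel s v => intro ts h; exact hf s _ h
  | and φ ψ h1 h2 => intro ts h; exact ⟨h1 _ fun i => (h i).1, h2 _ fun i => (h i).2⟩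
  | ex φ ih =>
    intro ts h
    choose d hd using h
    refine ⟨f d, ?_⟩
    have := ih _ hd
    convert this using 1
    funext i
    refine Fin.lastCases ?_ (fun i => ?_) i <;> simp

theorem three_four {D : Type} {Θ : RelStruct σ ar D} (P : PPInterpretation Θ NAEStruct) :
    ∃ ξ : CloneHom (polClone Θ) (projClone Bool), ξ.IsContinuous := by
  choose rep hrep hrep' using P.coord_surj
  let Φ : ∀ {n : ℕ}, ((Fin n → D) → D) → (Fin n → Bool) → Bool := fun f b => P.coord (fun d => f (fun i => rep (b i) d))
  have dom : ∀ {n : ℕ} (f : (Fin n → D) → D), IsPolymorphism Θ f → ∀ ts : Fin n → Fin P.dim → D, (∀ i, P.domFml.Realize Θ (ts i)) →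
      P.domFml.Realize Θ (fun d => f (fun i => ts i d)) := fun f hf ts h => PPFormula.pol hf _ ts h
  have wd : ∀ {n : ℕ} (f : (Fin n → D) → D), IsPolymorphism Θ f → ∀ ts : Fin n → Fin P.dim → D, (∀ i, P.domFml.Realize Θ (ts i)) →
      P.coord (fun d => f (fun i => ts i d)) = Φ f (fun i => P.coord (ts i)) := by
    intro n f hf ts h
    refine (P.eq_iff _ _ (dom f hf ts h) (dom f hf _ fun i => hrep _)).2 ?_
    have := PPFormula.pol hf P.eqFml (fun i => flattenTuple ![ts i, rep (P.coord (ts i))])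
      (fun i => (P.eq_iff _ _ (h i) (hrep _)).1 (hrep' _).symm)
    convert this using 1
    funext j
    simp only [flattenTuple]
    generalize (finProdFinEquiv.symm j).1 = z
    fin_cases z <;> rfl
  have pres : ∀ {n : ℕ} (f : (Fin n → D) → D), IsPolymorphism Θ f → PreservesRel (Φ f) (NAEStruct.rel ()) := by
    intro n f hf ts hts
    have h1 : ∀ i, (P.relFml ()).Realize Θ (flattenTuple (fun k => rep (ts i k))) := fun i =>
      (P.rel_iff () (fun k => rep (ts i k)) (fun k => hrep _)).1 (by simpa only [hrep'] using hts i)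
    have h2 := PPFormula.pol hf (P.relFml ()) _ h1
    exact (P.rel_iff () (fun k d => f (fun i => rep (ts i k) d)) (fun k => dom f hf _ fun i => hrep _)).2 h2
  have hpr : ∀ {n : ℕ} (f : (Fin n → D) → D), IsPolymorphism Θ f → ∃ i, ∀ x, xor (Φ f x) (Φ f (fun _ => false)) = x i :=
    fun f hf => nae_proj _ (pres f hf)
  let ξ : CloneHom (polClone Θ) (projClone Bool) :=
    { map := fun {n} f => ⟨fun x => xor (Φ f.1 x) (Φ f.1 (fun _ => false)), by
        obtain ⟨i, hi⟩ := hpr f.1 f.2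
        exact ⟨i, funext hi⟩⟩
      map_proj := by
        intro n i
        funext t
        show xor (P.coord (rep (t i))) (P.coord (rep false)) = t i
        rw [hrep', hrep']; simp
      map_comp := by
        intro n m f g
        funext t
        have e : ∀ t, Φ (fun t => f.1 (fun i => (g i).1 t)) t = Φ f.1 (fun i => Φ (g i).1 t) := fun t =>
          wd f.1 f.2 (fun i d => (g i).1 (fun j => rep (t j) d)) (fun i => dom _ (g i).2 _ fun j => hrep _)
        show xor (Φ (fun t => f.1 (fun i => (g i).1 t)) t) (Φ (fun t => f.1 (fun i => (g i).1 t)) fun _ => false) = _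
        rw [e, e]
        obtain ⟨i, hi⟩ := hpr f.1 f.2
        show _ = xor (Φ f.1 _) (Φ f.1 (fun _ => false))
        rw [hi]
        show _ = xor (Φ (g i).1 t) (Φ (g i).1 (fun _ => false))
        have h1 := hi (fun i => Φ (g i).1 t)
        have h2 := hi (fun i => Φ (g i).1 (fun _ => false))
        rw [← h1, ← h2]
        cases Φ f.1 (fun i => Φ (g i).1 t) <;> cases Φ f.1 (fun i => Φ (g i).1 (fun _ => false)) <;> cases Φ f.1 (fun _ => false) <;> rfl }
  refine ⟨ξ, fun n => ?_⟩
  letI : TopologicalSpace D := ⊥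
  haveI : DiscreteTopology D := ⟨rfl⟩
  have hc : ∀ b, Continuous (fun f : (Fin n → D) → D => Φ f b) := by
    intro b
    have h1 : Continuous (fun f : (Fin n → D) → D => (fun d => f (fun i => rep (b i) d) : Fin P.dim → D)) :=
      continuous_pi fun d => continuous_apply _
    exact (continuous_of_discreteTopology (f := P.coord)).comp h1
  have hc2 : Continuous (fun f : (Fin n → D) → D => (fun x => xor (Φ f x) (Φ f (fun _ => false)) : (Fin n → Bool) → Bool)) :=
    continuous_pi fun b => (continuous_of_discreteTopology (f := fun p : Bool × Bool => xor p.1 p.2)).comp ((hc b).prodMk (hc _))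
  have hc3 : Continuous (fun f : {f : (Fin n → D) → D // f ∈ (polClone Θ).ops n} => ξ.map f) := by
    refine Continuous.subtype_mk (hc2.comp continuous_subtype_val) _
  exact hc3

/-! #### building interpretations -/
theorem mkInterp {d : ℕ} (dom : (Fin d → E) → Prop) (hd : PP Δ dom) (val : (Fin d → E) → Bool)
    (surj : ∀ b, ∃ t, dom t ∧ val t = b) (R2 : (Fin d → E) → (Fin d → E) → Prop)
    (R3 : (Fin d → E) → (Fin d → E) → (Fin d → E) → Prop)
    (h2 : PP Δ (fun t : Fin 2 × Fin d → E => R2 (fun i => t (0, i)) (fun i => t (1, i))))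
    (h3 : PP Δ (fun t : Fin 3 × Fin d → E => R3 (fun i => t (0, i)) (fun i => t (1, i)) (fun i => t (2, i))))
    (e2 : ∀ s t, dom s → dom t → (val s = val t ↔ R2 s t))
    (e3 : ∀ s t u, dom s → dom t → dom u → (¬ (val s = val t ∧ val t = val u) ↔ R3 s t u)) :
    Nonempty (PPInterpretation Δ NAEStruct) := by
  obtain ⟨φ, hφ⟩ := hd.fml
  obtain ⟨φ2, hφ2⟩ := (h2.comap (J := Fin (2 * d)) finProdFinEquiv).fml
  obtain ⟨φ3, hφ3⟩ := (h3.comap (J := Fin (3 * d)) finProdFinEquiv).fml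
  refine ⟨⟨d, φ, φ2, fun _ => φ3, val, fun b => ?_, ?_, ?_⟩⟩
  · obtain ⟨t, ht, ht'⟩ := surj b
    exact ⟨t, (hφ t).1 ht, ht'⟩
  · intro s t hs ht
    rw [← hφ2, e2 s t ((hφ s).2 hs) ((hφ t).2 ht)]
    simp [flattenTuple]
  · intro _ ts hts
    rw [← hφ3]
    simp only [flattenTuple, Equiv.symm_apply_apply]
    rw [← e3 _ _ _ ((hφ _).2 (hts 0)) ((hφ _).2 (hts 1)) ((hφ _).2 (hts 2))]
    simp only [NAEStruct, Fin.exists_fin_succ]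
    show _ ↔ ¬(val (ts 0) = val (ts 1) ∧ val (ts 1) = val (ts 2))
    simp only [Fin.succ_zero_eq_one, Fin.succ_one_eq_two]
    have hn : ∀ p : Fin 0 → Prop, (∃ i, p i) ↔ False := fun p => by simp
    simp only [hn]
    cases val (ts 0) <;> cases val (ts 1) <;> cases val (ts 2) <;> simp

theorem PP.withC {R : (I → E) → Prop} (h : PP Δ R) {n : ℕ} (a : Fin n → E) : PP (Δ.withConstants a) R := by
  have key : ∀ {m : ℕ} (φ : PPFormula σ ar m), ∃ ψ : PPFormula (σ ⊕ Fin n) (Sum.elim ar fun _ => 1) m, ∀ t, φ.Realize Δ t ↔ ψ.Realize (Δ.withConstants a) t := by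
    intro m φ
    induction φ with
    | eq i j => exact ⟨.eq i j, fun t => Iff.rfl⟩
    | rel s v => exact ⟨.rel (.inl s) v, fun t => Iff.rfl⟩
    | and φ ψ h1 h2 =>
      obtain ⟨φ', h1⟩ := h1
      obtain ⟨ψ', h2⟩ := h2
      exact ⟨.and φ' ψ', fun t => and_congr (h1 t) (h2 t)⟩
    | ex φ h =>
      obtain ⟨φ', h⟩ := h
      exact ⟨.ex φ', fun t => exists_congr fun d => h _⟩
  obtain ⟨m, j, φ, hφ⟩ := h
  obtain ⟨ψ, hψ⟩ := key φ
  exact ⟨m, j, ψ, fun t => (hφ t).trans (hψ _)⟩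

theorem PP.const {n : ℕ} (a : Fin n → E) (k : Fin n) (i : I) : PP (Δ.withConstants a) (fun t : I → E => t i = a k) :=
  ⟨1, fun _ => i, .rel (.inr k) id, fun t => Iff.rfl⟩

end DC

namespace DC
open Set Filter

variable {σ : Type} {ar : σ → ℕ} {E : Type} {Δ : RelStruct σ ar E}

def PP4 (Δ : RelStruct σ ar E) (S : E → E → E → E → Prop) : Prop :=
  ∀ (I : Type) (a b c d : I), PP Δ (fun t : I → E => S (t a) (t b) (t c) (t d))

theorem PP4.comp {S T : E → E → E → E → Prop} (hS : PP4 Δ S) (hT : PP4 Δ T) :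
    PP4 Δ (fun x y z w => ∃ p q, S x y p q ∧ T p q z w) := by
  intro I a b c d
  apply PP.ex; apply PP.ex
  exact PP.and (hS _ _ _ _ _) (hT _ _ _ _ _)

def PPB (Δ : RelStruct σ ar E) (R : Prop → Prop → Prop → Prop) : Prop :=
  ∀ (I : Type) (a b c d e f : I), PP Δ (fun t : I → E => R (t a = t b) (t c = t d) (t e = t f))

set_option maxHeartbeats 1000000 in
theorem xor_hard (oc : OC Δ) (h2t : ∀ x y z w : E, x ≠ y → z ≠ w → ∃ γ, IsAut Δ γ ∧ γ x = z ∧ γ y = w)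
    (h3 : ∀ x y : E, ∃ z, z ≠ x ∧ z ≠ y)
    (hna : ∀ a c d : E, a ≠ c → a ≠ d → ∃ a', a' ≠ a ∧ ∃ γ, IsAut Δ γ ∧ γ a = a' ∧ γ c = c ∧ γ d = d)
    [Nonempty E] (hno : ¬ NoPLF Δ (Fin 2)) : Nonempty (PPInterpretation Δ NAEStruct) := by
  classical
  have h1t : ∀ x z : E, ∃ γ, IsAut Δ γ ∧ γ x = z := by
    intro x z
    obtain ⟨y, hy, -⟩ := h3 x x
    obtain ⟨w, hw, -⟩ := h3 z z
    obtain ⟨γ, h, h', -⟩ := h2t x y z w hy.symm hw.symm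
    exact ⟨γ, h, h'⟩
  simp only [NoPLF, not_forall] at hno
  obtain ⟨S, hS, hsym, ⟨u, v, huv⟩, hnl⟩ := hno
  push Not at hnl
  set s : E → E → E → E → Prop := fun x y z w => S ![x, y] ![z, w] with hs
  have eta : ∀ u : Fin 2 → E, ![u 0, u 1] = u := fun u => by funext i; fin_cases i <;> rfl
  have sPP : PP4 Δ s := by
    intro I a b c d
    refine (hS.comap (J := I) (Sum.elim ![a, b] ![c, d])).congr fun t => ?_
    apply iff_of_eq
    simp only [hs]
    congr 1 <;> · funext i; fin_cases i <;> rfl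
  have ssym : ∀ {x y z w}, s x y z w → s z w x y := fun h => hsym _ _ h
  have styp : ∀ {x y z w}, s x y z w → ¬ (x = y ↔ z = w) := by
    intro x y z w h hxy
    refine hnl _ _ h ?_
    by_cases e : x = y
    · obtain ⟨γ, hγ, h1⟩ := h1t x z
      have e' := hxy.1 e
      subst e e'
      exact ⟨γ, hγ, fun i => by fin_cases i <;> simpa using h1⟩
    · obtain ⟨γ, hγ, h1, h2⟩ := h2t x y z w e (fun e' => e (hxy.2 e'))
      exact ⟨γ, hγ, fun i => by fin_cases i <;> simpa⟩
  have saut : ∀ {x y z w} (γ : Equiv.Perm E), IsAut Δ γ → s x y z w → s (γ x) (γ y) (γ z) (γ w) := by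
    intro x y z w γ hγ h
    have := (sPP (Fin 4) 0 1 2 3).orb (s := ![x, y, z, w]) (t := fun i => γ (![x, y, z, w] i)) ⟨γ, hγ, fun _ => rfl⟩ (by simpa using h)
    simpa using this
  have sdiag : ∃ a c d, s a a c d := by
    have h : s (u 0) (u 1) (v 0) (v 1) := by simp only [hs, eta]; exact huv
    have := styp h
    by_cases e : u 0 = u 1
    · exact ⟨_, _, _, by rw [← e] at h; exact h⟩
    · have e' : v 0 = v 1 := by tauto
      rw [← e'] at h
      exact ⟨_, _, _, ssym h⟩
  obtain ⟨a0, c0, d0, h0⟩ := sdiag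
  have hcd0 : c0 ≠ d0 := by have := styp h0; simpa using this
  have tot1 : ∀ a, ∃ c d, s a a c d := by
    intro a
    obtain ⟨γ, hγ, rfl⟩ := h1t a0 a
    exact ⟨_, _, saut γ hγ h0⟩
  have tot2 : ∀ c d, c ≠ d → ∃ a, s c d a a := by
    intro c d hcd
    obtain ⟨γ, hγ, rfl, rfl⟩ := h2t c0 d0 c d hcd0 hcd
    exact ⟨_, saut γ hγ (ssym h0)⟩
  have tot : ∀ x y, ∃ z w, s x y z w := by
    intro x y
    by_cases e : x = y
    · subst e; exact tot1 x
    · obtain ⟨a, ha⟩ := tot2 x y e; exact ⟨_, _, ha⟩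
  let T0 : E → E → E → E → Prop := fun x y z w => ∃ p q, s x y p q ∧ s p q z w
  have T0PP : PP4 Δ T0 := sPP.comp sPP
  have sswap : PP4 Δ (fun x y z w => s y x z w) := fun I a b c d => sPP I b a c d
  let T1 : E → E → E → E → Prop := fun x y z w => ∃ p q, s x y p q ∧ s q p z w
  have T1PP : PP4 Δ T1 := sPP.comp sswap
  let T2 : E → E → E → E → Prop := fun x y z w => ∃ p q, T1 x y p q ∧ T1 p q z w
  have T2PP : PP4 Δ T2 := T1PP.comp T1PP
  let Th : E → E → E → E → Prop := fun x y z w => ∃ p q, T0 x y p q ∧ T2 p q z w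
  have ThPP : PP4 Δ Th := T0PP.comp T2PP
  let U : E → E → E → E → Prop := fun x y z w => ∃ p q, s x y p q ∧ Th p q z w
  have UPP : PP4 Δ U := sPP.comp ThPP
  let Sm : E → E → E → E → Prop := fun x y z w => ∃ p q, U x y p q ∧ U p q z w
  have SmPP : PP4 Δ Sm := UPP.comp UPP
  have T0typ : ∀ {x y z w}, T0 x y z w → (x = y ↔ z = w) := by
    rintro x y z w ⟨p, q, h, h'⟩; have := styp h; have := styp h'; tauto
  have T1typ : ∀ {x y z w}, T1 x y z w → (x = y ↔ z = w) := by
    rintro x y z w ⟨p, q, h, h'⟩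
    have := styp h; have := styp h'; have : p = q ↔ q = p := eq_comm; tauto
  have T2typ : ∀ {x y z w}, T2 x y z w → (x = y ↔ z = w) := by
    rintro x y z w ⟨p, q, h, h'⟩; exact (T1typ h).trans (T1typ h')
  have Thtyp : ∀ {x y z w}, Th x y z w → (x = y ↔ z = w) := by
    rintro x y z w ⟨p, q, h, h'⟩; exact (T0typ h).trans (T2typ h')
  have Utyp : ∀ {x y z w}, U x y z w → ¬ (x = y ↔ z = w) := by
    rintro x y z w ⟨p, q, h, h'⟩; have := styp h; have := Thtyp h'; tauto
  have Smtyp : ∀ {x y z w}, Sm x y z w → (x = y ↔ z = w) := by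
    rintro x y z w ⟨p, q, h, h'⟩; have := Utyp h; have := Utyp h'; tauto
  have T0refl : ∀ x y, T0 x y x y := by
    intro x y; obtain ⟨p, q, h⟩ := tot x y; exact ⟨p, q, h, ssym h⟩
  have T2refl : ∀ x y, T2 x y x y := by
    intro x y
    obtain ⟨p, q, h⟩ := tot x y
    obtain ⟨z, w, h'⟩ := tot q p
    exact ⟨z, w, ⟨p, q, h, h'⟩, ⟨q, p, ssym h', ssym h⟩⟩
  have Threfl : ∀ x y, Th x y x y := fun x y => ⟨x, y, T0refl x y, T2refl x y⟩
  have Thdiag : ∀ a d, Th a a d d := by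
    intro a d
    by_cases had : a = d
    · subst had; exact Threfl _ _
    by_cases hac : a0 = c0 ∨ a0 = d0
    · have T1d : ∀ a d, a ≠ d → T1 a a d d := by
        intro a d had
        rcases hac with rfl | rfl
        · have h1 : ∀ a d, a ≠ d → s a a a d := by
            intro a d had
            obtain ⟨γ, hγ, rfl, rfl⟩ := h2t a0 d0 a d hcd0 had
            exact saut γ hγ h0
          exact ⟨a, d, h1 _ _ had, ssym (h1 d a (Ne.symm had))⟩
        · have h1 : ∀ a d, a ≠ d → s a a d a := by
            intro a d had
            obtain ⟨γ, hγ, rfl, rfl⟩ := h2t a0 c0 a d hcd0.symm had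
            exact saut γ hγ h0
          exact ⟨d, a, h1 _ _ had, ssym (h1 d a (Ne.symm had))⟩
      obtain ⟨e, he, he'⟩ := h3 a d
      exact ⟨a, a, T0refl a a, e, e, T1d _ _ he.symm, T1d _ _ he'⟩
    · push Not at hac
      obtain ⟨a', ha', γ, hγ, g1, g2, g3⟩ := hna a0 c0 d0 hac.1 hac.2
      have h1 := saut γ hγ h0
      rw [g1, g2, g3] at h1
      obtain ⟨δ, hδ, rfl, rfl⟩ := h2t a0 a' a d ha'.symm had
      refine ⟨_, _, ⟨δ c0, δ d0, saut δ hδ h0, saut δ hδ (ssym h1)⟩, T2refl _ _⟩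
  have Smfull : ∀ {x y z w}, (x = y ↔ z = w) → Sm x y z w := by
    intro x y z w h
    by_cases e : x = y
    · have e' := h.1 e
      subst e e'
      obtain ⟨p, q, hp⟩ := tot1 x
      exact ⟨p, q, ⟨p, q, hp, Threfl _ _⟩, ⟨x, x, ssym hp, Thdiag _ _⟩⟩
    · obtain ⟨a, ha⟩ := tot2 _ _ e
      obtain ⟨b, hb⟩ := tot2 _ _ (fun e' => e (h.2 e'))
      exact ⟨b, b, ⟨a, a, ha, Thdiag _ _⟩, ⟨z, w, ssym hb, Threfl _ _⟩⟩
  have Same : PP4 Δ (fun x y z w => (x = y ↔ z = w)) := fun I a b c d =>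
    (SmPP I a b c d).congr fun t => ⟨Smfull, Smtyp⟩
  have Neg : PP4 Δ (fun x y z w => ¬ (x = y ↔ z = w)) := fun I a b c d =>
    ((Same.comp sPP) I a b c d).congr fun t => by
      constructor
      · intro h
        by_cases e : t c = t d
        · obtain ⟨p, q, hp⟩ := tot (t c) (t d)
          have := styp hp
          exact ⟨p, q, by tauto, ssym hp⟩
        · obtain ⟨a, ha⟩ := tot2 _ _ e
          exact ⟨a, a, by have := styp ha; tauto, ssym ha⟩
      · rintro ⟨p, q, hp, hq⟩
        have := styp hq
        tauto
  have tv : ∀ P : Prop, ∃ x y : E, (x = y ↔ P) := by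
    intro P
    obtain ⟨x⟩ := ‹Nonempty E›
    obtain ⟨y, hy, -⟩ := h3 x x
    by_cases hP : P
    · exact ⟨x, x, by simpa using hP⟩
    · exact ⟨y, x, by simpa [hy] using hP⟩
  have K : PPB Δ (fun P Q R => (P ∧ Q → R) ∧ (Q ∧ R → P) ∧ (P ∧ R → Q)) := by
    intro I a b c d e f
    have : PP Δ (fun t : I → E => ∃ x y z : E, (t a = t b ↔ x = y) ∧ (t c = t d ↔ y = z) ∧ (t e = t f ↔ x = z)) := by
      apply PP.ex; apply PP.ex; apply PP.ex
      exact (Same _ _ _ _ _).and ((Same _ _ _ _ _).and (Same _ _ _ _ _))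
    refine this.congr fun t => ?_
    constructor
    · rintro ⟨h1, h2, h3'⟩
      obtain ⟨x⟩ := ‹Nonempty E›
      obtain ⟨y, hy, -⟩ := h3 x x
      obtain ⟨z, hz, hz'⟩ := h3 x y
      by_cases P : t a = t b
      · by_cases Q : t c = t d
        · exact ⟨x, x, x, by simp [P, Q, h1 ⟨P, Q⟩]⟩
        · have : ¬ t e = t f := fun h => Q (h3' ⟨P, h⟩)
          exact ⟨x, x, y, by simp [P, Q, this, hy.symm]⟩
      · by_cases Q : t c = t d
        · have : ¬ t e = t f := fun h => P (h2 ⟨Q, h⟩)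
          exact ⟨x, y, y, by simp [P, Q, this, hy.symm]⟩
        · by_cases R : t e = t f
          · exact ⟨x, y, x, by simp [P, Q, R, hy.symm, hy]⟩
          · exact ⟨x, y, z, by simp [P, Q, R, hy.symm, hz.symm, hz'.symm]⟩
    · rintro ⟨x, y, z, h1, h2, h3⟩
      rw [h1, h2, h3]
      refine ⟨fun h => h.1.trans h.2, fun h => h.2.trans h.1.symm, fun h => h.1.symm.trans h.2⟩
  have Ne' : ∀ (I : Type) (a b : I), PP Δ (fun t : I → E => ¬ t a = t b) := fun I a b =>
    (Neg I a b a a).congr fun t => by simp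
  have Nand : PP4 Δ (fun x y z w => ¬ (x = y ∧ z = w)) := by
    intro I a b c d
    have : PP Δ (fun t : I → E => ∃ f g : E, (¬ f = g) ∧ ((t a = t b ∧ t c = t d → f = g) ∧ (t c = t d ∧ f = g → t a = t b) ∧ (t a = t b ∧ f = g → t c = t d))) := by
      apply PP.ex; apply PP.ex
      exact (Ne' _ _ _).and (K _ _ _ _ _ _ _)
    refine this.congr fun t => ?_
    obtain ⟨x, y, hxy⟩ := tv False
    constructor
    · intro h; exact ⟨x, y, by tauto⟩
    · rintro ⟨f, g, h⟩; tauto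
  have Imp : PP4 Δ (fun x y z w => (x = y → z = w)) := by
    intro I a b c d
    have : PP Δ (fun t : I → E => ∃ f g : E, ¬ (t c = t d ↔ f = g) ∧ ¬ (t a = t b ∧ f = g)) := by
      apply PP.ex; apply PP.ex
      exact (Neg _ _ _ _ _).and (Nand _ _ _ _ _)
    refine this.congr fun t => ?_
    constructor
    · intro h
      obtain ⟨f, g, hfg⟩ := tv (¬ t c = t d)
      exact ⟨f, g, by tauto⟩
    · rintro ⟨f, g, h⟩; tauto
  have H : PPB Δ (fun P Q R => (P ∧ Q → R)) := by
    intro I a b c d e f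
    have : PP Δ (fun t : I → E => ∃ p p' q q' : E, (t a = t b → p = p') ∧ (t c = t d → q = q') ∧
        ((p = p' ∧ q = q' → t e = t f) ∧ (q = q' ∧ t e = t f → p = p') ∧ (p = p' ∧ t e = t f → q = q'))) := by
      apply PP.ex; apply PP.ex; apply PP.ex; apply PP.ex
      exact (Imp _ _ _ _ _).and ((Imp _ _ _ _ _).and (K _ _ _ _ _ _ _))
    refine this.congr fun t => ?_
    constructor
    · intro h
      by_cases R : t e = t f
      · obtain ⟨p, p', hp⟩ := tv True
        exact ⟨p, p', p, p', by tauto⟩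
      · exact ⟨t a, t b, t c, t d, by tauto⟩
    · rintro ⟨p, p', q, q', h⟩; tauto
  have N : PPB Δ (fun P Q R => (P ∧ Q → ¬ R) ∧ (¬ P ∧ ¬ Q → R)) := by
    intro I a b c d e f
    have : PP Δ (fun t : I → E => ∃ p p' q q' r r' : E, ¬ (t a = t b ↔ p = p') ∧ ¬ (t c = t d ↔ q = q') ∧ ¬ (t e = t f ↔ r = r') ∧
        (t a = t b ∧ t c = t d → r = r') ∧ (p = p' ∧ q = q' → t e = t f)) := by
      apply PP.ex; apply PP.ex; apply PP.ex; apply PP.ex; apply PP.ex; apply PP.ex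
      exact (Neg _ _ _ _ _).and ((Neg _ _ _ _ _).and ((Neg _ _ _ _ _).and ((H _ _ _ _ _ _ _).and (H _ _ _ _ _ _ _))))
    refine this.congr fun t => ?_
    constructor
    · intro h
      obtain ⟨p, p', hp⟩ := tv (¬ t a = t b)
      obtain ⟨q, q', hq⟩ := tv (¬ t c = t d)
      obtain ⟨r, r', hr⟩ := tv (¬ t e = t f)
      refine ⟨p, p', q, q', r, r', ?_⟩
      rw [hp, hq, hr]
      clear hp hq hr
      by_cases P : t a = t b <;> by_cases Q : t c = t d <;> by_cases R : t e = t f <;> simp [P, Q, R] at h ⊢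
    · rintro ⟨p, p', q, q', r, r', h1, h2, h3, h4, h5⟩
      refine ⟨fun hh hr => h3 (iff_of_true hr (h4 hh)), fun hh => h5 ⟨?_, ?_⟩⟩
      · by_contra hp; exact h1 (iff_of_false hh.1 hp)
      · by_contra hp; exact h2 (iff_of_false hh.2 hp)
  refine mkInterp (d := 2) (fun _ => True) PP.true (fun t => decide (t 0 = t 1)) ?_ (fun s t => (s 0 = s 1 ↔ t 0 = t 1))
    (fun s t u => (s 0 = s 1 ∧ t 0 = t 1 → ¬ u 0 = u 1) ∧ (¬ s 0 = s 1 ∧ ¬ t 0 = t 1 → u 0 = u 1)) ?_ ?_ ?_ ?_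
  · intro b
    obtain ⟨x, y, hxy⟩ := tv (b = true)
    refine ⟨![x, y], trivial, ?_⟩
    cases b <;> simp_all
  · exact Same _ (0, 0) (0, 1) (1, 0) (1, 1)
  · exact N _ (0, 0) (0, 1) (1, 0) (1, 1) (2, 0) (2, 1)
  · intro s t _ _
    simp
  · intro s t u _ _ _
    simp only [decide_eq_decide]
    tauto

end DC

namespace DC
open Set Filter

variable {σ : Type} {ar : σ → ℕ} {E : Type} {Δ : RelStruct σ ar E}

def PP3 (Δ : RelStruct σ ar E) (S : E → E → E → Prop) : Prop :=
  ∀ (I : Type) (a b c : I), PP Δ (fun t : I → E => S (t a) (t b) (t c))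

/-- C-axioms on a subset -/
structure CAx (V : E → Prop) (C : E → E → E → Prop) : Prop where
  symm : ∀ z x y, V x → V y → V z → C z x y → C z y x
  asym : ∀ z x y, V x → V y → V z → C z x y → ¬ C y x z
  tr : ∀ z x y, V x → V y → V z → C z x y → ∀ w, V w → C w x y ∨ C z w y
  bin : ∀ x y z, V x → V y → V z → x ≠ y → x ≠ z → y ≠ z → C z x y ∨ C y x z ∨ C x y z

theorem CAx.ne {V : E → Prop} {C : E → E → E → Prop} (hC : CAx V C) {x y z : E} (hx : V x) (hy : V y) (hz : V z) (h : C z x y) :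
    x ≠ z ∧ y ≠ z := by
  constructor
  · rintro rfl
    have := hC.symm _ _ _ hx hy hx h
    exact hC.asym _ _ _ hy hx hx this this
  · rintro rfl
    exact hC.asym _ _ _ hx hy hy h h

theorem CAx.cross {V : E → Prop} {C : E → E → E → Prop} (hC : CAx V C) {a b u z : E} (ha : V a) (hb : V b) (hu : V u) (hz : V z)
    (h1 : C b a u) (h2 : C a b z) : C z a u := by
  rcases hC.tr _ _ _ ha hu hb h1 z hz with h | h
  · exact h
  · exfalso
    rcases hC.tr _ _ _ hu hz hb (hC.symm _ _ _ hz hu hb h) a ha with h3 | h3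
    · rcases hC.tr _ _ _ hz hb ha (hC.symm _ _ _ hb hz ha h2) u hu with h4 | h4
      · exact hC.asym _ _ _ hz hu hb h h4
      · exact hC.asym _ _ _ hu ha hb (hC.symm _ _ _ ha hu hb h1) h4
    · exact hC.asym _ _ _ hz hb ha (hC.symm _ _ _ hb hz ha h2) (hC.symm _ _ _ ha hz hb h3)

/-- au|b, av|b → uv|b -/
theorem CAx.join {V : E → Prop} {C : E → E → E → Prop} (hC : CAx V C) {a b u v : E} (ha : V a) (hb : V b) (hu : V u) (hv : V v)
    (h1 : C b a u) (h2 : C b a v) : C b u v := by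
  rcases hC.tr _ _ _ ha hv hb h2 u hu with h | h
  · rcases hC.tr _ _ _ ha hu hb h1 v hv with h3 | h3
    · exact absurd (hC.symm _ _ _ ha hv hu h) (fun h' => hC.asym _ _ _ ha hu hv h3 h)
    · exact hC.symm _ _ _ hv hu hb h3
  · exact h

set_option maxHeartbeats 1000000 in
theorem nae_hard {V : E → Prop} {C N : E → E → E → Prop} (hC : CAx V C) (hN : PP3 Δ N)
    (hNd : ∀ x y z, N x y z ↔ V x ∧ V y ∧ V z ∧ x ≠ y ∧ x ≠ z ∧ y ≠ z ∧ (C z x y ∨ C x y z))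
    (a b : E) (ha : V a) (hb : V b)
    (hca : ∀ (I : Type) (i : I), PP Δ (fun t : I → E => t i = a)) (hcb : ∀ (I : Type) (i : I), PP Δ (fun t : I → E => t i = b))
    (hA : ∃ x y z, x ≠ y ∧ x ≠ z ∧ y ≠ z ∧ (V x ∧ x ≠ a ∧ x ≠ b ∧ C b a x) ∧ (V y ∧ y ≠ a ∧ y ≠ b ∧ C b a y) ∧ (V z ∧ z ≠ a ∧ z ≠ b ∧ C b a z))
    (hB : ∃ x y z, x ≠ y ∧ x ≠ z ∧ y ≠ z ∧ (V x ∧ x ≠ a ∧ x ≠ b ∧ C a b x) ∧ (V y ∧ y ≠ a ∧ y ≠ b ∧ C a b y) ∧ (V z ∧ z ≠ a ∧ z ≠ b ∧ C a b z)) :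
    Nonempty (PPInterpretation Δ NAEStruct) := by
  classical
  let A : E → Prop := fun x => V x ∧ x ≠ a ∧ x ≠ b ∧ C b a x
  let B : E → Prop := fun x => V x ∧ x ≠ a ∧ x ≠ b ∧ C a b x
  have hab : a ≠ b := by
    obtain ⟨x, -, -, -, -, -, ⟨h1, -, -, h2⟩, -⟩ := hA
    exact (hC.ne ha h1 hb h2).1
  have AB : ∀ x, A x → ¬ B x := by
    rintro x ⟨h1, h2, h3, h4⟩ ⟨h5, h6, h7, h8⟩
    exact hC.asym _ _ _ h1 ha hb (hC.symm _ _ _ ha h1 hb h4) (hC.symm _ _ _ hb h1 ha h8)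
  let D : E → Prop := fun x => N a x b
  have hD : ∀ x, D x ↔ A x ∨ B x := by
    intro x
    show N a x b ↔ _
    rw [hNd]
    constructor
    · rintro ⟨-, h1, -, h2, h3, h4, h5 | h5⟩
      · exact .inl ⟨h1, h2.symm, h4, h5⟩
      · exact .inr ⟨h1, h2.symm, h4, hC.symm _ _ _ h1 hb ha h5⟩
    · rintro (⟨h1, h2, h3, h4⟩ | ⟨h1, h2, h3, h4⟩)
      · exact ⟨ha, h1, hb, h2.symm, hab, h3, .inl h4⟩
      · exact ⟨ha, h1, hb, h2.symm, hab, h3, .inr (hC.symm _ _ _ hb h1 ha h4)⟩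
  have AxB : ∀ u z, A u → B z → u ≠ z ∧ C z a u ∧ C u b z := fun u z hu hz =>
    ⟨fun e => AB u hu (e ▸ hz), hC.cross ha hb hu.1 hz.1 hu.2.2.2 hz.2.2.2, hC.cross hb ha hz.1 hu.1 hz.2.2.2 hu.2.2.2⟩
  let Df : E → E → Prop := fun u z => N u a z ∧ N u b z
  have hDf : ∀ u z, D u → D z → (Df u z ↔ (A u ∧ B z) ∨ (B u ∧ A z)) := by
    intro u z hu hz
    rw [hD] at hu hz
    show (N u a z ∧ N u b z) ↔ _
    rw [hNd, hNd]
    constructor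
    · rintro ⟨⟨-, -, -, -, -, -, h1⟩, ⟨-, -, -, -, -, -, h2⟩⟩
      rcases hu with hu | hu <;> rcases hz with hz | hz
      · exfalso
        have h := hC.join ha hb hu.1 hz.1 hu.2.2.2 hz.2.2.2
        rcases h2 with h2 | h2
        · exact hC.asym _ _ _ hu.1 hz.1 hb h h2
        · exact hC.asym _ _ _ hz.1 hu.1 hb (hC.symm _ _ _ hu.1 hz.1 hb h) (hC.symm _ _ _ hb hz.1 hu.1 h2)
      · exact .inl ⟨hu, hz⟩
      · exact .inr ⟨hu, hz⟩
      · exfalso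
        have h := hC.join hb ha hu.1 hz.1 hu.2.2.2 hz.2.2.2
        rcases h1 with h2 | h2
        · exact hC.asym _ _ _ hu.1 hz.1 ha h h2
        · exact hC.asym _ _ _ hz.1 hu.1 ha (hC.symm _ _ _ hu.1 hz.1 ha h) (hC.symm _ _ _ ha hz.1 hu.1 h2)
    · rintro (⟨hu, hz⟩ | ⟨hu, hz⟩)
      · have h := AxB u z hu hz
        exact ⟨⟨hu.1, ha, hz.1, hu.2.1, h.1, hz.2.1.symm, .inl (hC.symm _ _ _ ha hu.1 hz.1 h.2.1)⟩,
          ⟨hu.1, hb, hz.1, hu.2.2.1, h.1, hz.2.2.1.symm, .inr h.2.2⟩⟩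
      · have h := AxB z u hz hu
        exact ⟨⟨hu.1, ha, hz.1, hu.2.1, h.1.symm, hz.2.1.symm, .inr h.2.1⟩,
          ⟨hu.1, hb, hz.1, hu.2.2.1, h.1.symm, hz.2.2.1.symm, .inl (hC.symm _ _ _ hb hu.1 hz.1 h.2.2)⟩⟩
  have exA : ∃ x, A x := by obtain ⟨x, -, -, -, -, -, h, -⟩ := hA; exact ⟨x, h⟩
  have exB : ∃ x, B x := by obtain ⟨x, -, -, -, -, -, h, -⟩ := hB; exact ⟨x, h⟩
  have three : ∀ P : E → Prop, (∀ x, P x → V x) → (∃ x y z, x ≠ y ∧ x ≠ z ∧ y ≠ z ∧ P x ∧ P y ∧ P z) → ∃ x u y, P x ∧ P u ∧ P y ∧ N x u y := by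
    rintro P hP ⟨x, y, z, h1, h2, h3, hx, hy, hz⟩
    have vx := hP x hx
    have vy := hP y hy
    have vz := hP z hz
    rcases hC.bin x y z vx vy vz h1 h2 h3 with h | h | h
    · exact ⟨x, y, z, hx, hy, hz, (hNd _ _ _).2 ⟨vx, vy, vz, h1, h2, h3, .inl h⟩⟩
    · exact ⟨x, z, y, hx, hz, hy, (hNd _ _ _).2 ⟨vx, vz, vy, h2, h1, h3.symm, .inl h⟩⟩
    · exact ⟨x, y, z, hx, hy, hz, (hNd _ _ _).2 ⟨vx, vy, vz, h1, h2, h3, .inr h⟩⟩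
  have threeA := three A (fun x h => h.1) hA
  have threeB := three B (fun x h => h.1) hB
  have DPP : ∀ (I : Type) (i : I), PP Δ (fun t : I → E => D (t i)) := by
    intro I i
    have : PP Δ (fun t : I → E => ∃ p q, p = a ∧ q = b ∧ N p (t i) q) := by
      apply PP.ex; apply PP.ex
      exact (hca _ _).and ((hcb _ _).and (hN _ _ _ _))
    exact this.congr fun t => by simp [D]
  have DfPP : ∀ (I : Type) (i j : I), PP Δ (fun t : I → E => Df (t i) (t j)) := by
    intro I i j
    have : PP Δ (fun t : I → E => ∃ p q, p = a ∧ q = b ∧ N (t i) p (t j) ∧ N (t i) q (t j)) := by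
      apply PP.ex; apply PP.ex
      exact (hca _ _).and ((hcb _ _).and ((hN _ _ _ _).and (hN _ _ _ _)))
    exact this.congr fun t => by simp [Df]
  let Sm : E → E → Prop := fun u z => ∃ w, D w ∧ Df u w ∧ Df w z
  have SmPP : ∀ (I : Type) (i j : I), PP Δ (fun t : I → E => Sm (t i) (t j)) := by
    intro I i j
    apply PP.ex
    exact (DPP _ _).and ((DfPP _ _ _).and (DfPP _ _ _))
  have hSm : ∀ u z, D u → D z → (Sm u z ↔ (A u ↔ A z)) := by
    intro u z hu hz
    have hu' := (hD u).1 hu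
    have hz' := (hD z).1 hz
    have a1 := AB u
    have a2 := AB z
    constructor
    · rintro ⟨w, hw, h1, h2⟩
      have a3 := AB w
      rw [hDf _ _ hu hw] at h1
      rw [hDf _ _ hw hz] at h2
      rcases h1 with ⟨p1, p2⟩ | ⟨p1, p2⟩ <;> rcases h2 with ⟨q1, q2⟩ | ⟨q1, q2⟩
      · exact absurd p2 (a3 q1)
      · exact iff_of_true p1 q2
      · exact iff_of_false (fun h => a1 h p1) (fun h => a2 h q2)
      · exact absurd q1 (a3 p2)
    · intro h
      by_cases h1 : A u
      · obtain ⟨w, hw⟩ := exB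
        have hw' := (hD w).2 (.inr hw)
        refine ⟨w, hw', (hDf _ _ hu hw').2 (.inl ⟨h1, hw⟩), (hDf _ _ hw' hz).2 (.inr ⟨hw, h.1 h1⟩)⟩
      · obtain ⟨w, hw⟩ := exA
        have hw' := (hD w).2 (.inl hw)
        have h2 : ¬ A z := fun h' => h1 (h.2 h')
        refine ⟨w, hw', (hDf _ _ hu hw').2 (.inr ⟨hu'.resolve_left h1, hw⟩), (hDf _ _ hw' hz).2 (.inl ⟨hw, hz'.resolve_left h2⟩)⟩
  let T : E → E → E → Prop := fun x y z => ∃ x' y' z' u, D x' ∧ D y' ∧ D z' ∧ D u ∧ Sm x x' ∧ Sm y y' ∧ Sm z z' ∧ N x' u y' ∧ Df u z'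
  have TPP : PP3 Δ T := by
    intro I i j k
    apply PP.ex; apply PP.ex; apply PP.ex; apply PP.ex
    exact (DPP _ _).and ((DPP _ _).and ((DPP _ _).and ((DPP _ _).and ((SmPP _ _ _).and ((SmPP _ _ _).and ((SmPP _ _ _).and
      ((hN _ _ _ _).and (DfPP _ _ _))))))))
  have hT : ∀ x y z, D x → D y → D z → (¬ ((A x ↔ A y) ∧ (A y ↔ A z)) ↔ T x y z) := by
    intro x y z hx hy hz
    constructor
    · intro h
      have mk : ∀ x' y' z' u, (A x' ∨ B x') → (A y' ∨ B y') → (A z' ∨ B z') → (A u ∨ B u) → (A x ↔ A x') → (A y ↔ A y') → (A z ↔ A z') →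
          N x' u y' → ((A u ∧ B z') ∨ (B u ∧ A z')) → T x y z := by
        intro x' y' z' u h1 h2 h3 h4 h5 h6 h7 h8 h9
        rw [← hD] at h1 h2 h3 h4
        exact ⟨x', y', z', u, h1, h2, h3, h4, (hSm _ _ hx h1).2 h5, (hSm _ _ hy h2).2 h6, (hSm _ _ hz h3).2 h7, h8, (hDf _ _ h4 h3).2 h9⟩
      have NA : ∀ x u y, A x → A u → B y → x ≠ u → N x u y := by
        intro x u y hx hu hy hxu
        exact (hNd _ _ _).2 ⟨hx.1, hu.1, hy.1, hxu, (AxB x y hx hy).1, (AxB u y hu hy).1,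
          .inl (hC.join ha hy.1 hx.1 hu.1 (AxB x y hx hy).2.1 (AxB u y hu hy).2.1)⟩
      have NB : ∀ x u y, B x → B u → A y → x ≠ u → N x u y := by
        intro x u y hx hu hy hxu
        exact (hNd _ _ _).2 ⟨hx.1, hu.1, hy.1, hxu, (AxB y x hy hx).1.symm, (AxB y u hy hu).1.symm,
          .inl (hC.join hb hy.1 hx.1 hu.1 (AxB y x hy hx).2.2 (AxB y u hy hu).2.2)⟩
      have Nsw : ∀ x u y, N x u y → N y u x := by
        intro x u y h
        rw [hNd] at h ⊢
        obtain ⟨h1, h2, h3, h4, h5, h6, h7⟩ := h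
        exact ⟨h3, h2, h1, h6.symm, h5.symm, h4.symm, h7.symm.imp (hC.symm _ _ _ h2 h3 h1) (hC.symm _ _ _ h1 h2 h3)⟩
      obtain ⟨p, u, q, hp, hu, hq, hN1⟩ := threeA
      obtain ⟨p', u', q', hp', hu', hq', hN2⟩ := threeB
      have hpu : p ≠ u := ((hNd _ _ _).1 hN1).2.2.2.1
      have hpu' : p' ≠ u' := ((hNd _ _ _).1 hN2).2.2.2.1
      have n1 : ∀ {x}, B x → ¬ A x := fun hb ha => AB _ ha hb
      have ff : ∀ {P Q : Prop}, ¬ P → ¬ Q → (P ↔ Q) := fun h h' => iff_of_false h h'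
      by_cases X : A x <;> by_cases Y : A y <;> by_cases Z : A z
      · exact absurd ⟨iff_of_true X Y, iff_of_true Y Z⟩ h
      · exact mk p q p' u (.inl hp) (.inl hq) (.inr hp') (.inl hu) (iff_of_true X hp) (iff_of_true Y hq) (ff Z (n1 hp')) hN1 (.inl ⟨hu, hp'⟩)
      · exact mk p p' p u' (.inl hp) (.inr hp') (.inl hp) (.inr hu') (iff_of_true X hp) (ff Y (n1 hp')) (iff_of_true Z hp) (Nsw _ _ _ (NB _ _ _ hp' hu' hp hpu')) (.inr ⟨hu', hp⟩)
      · exact mk p p' p' u (.inl hp) (.inr hp') (.inr hp') (.inl hu) (iff_of_true X hp) (ff Y (n1 hp')) (ff Z (n1 hp')) (NA _ _ _ hp hu hp' hpu) (.inl ⟨hu, hp'⟩)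
      · exact mk p' p p u' (.inr hp') (.inl hp) (.inl hp) (.inr hu') (ff X (n1 hp')) (iff_of_true Y hp) (iff_of_true Z hp) (NB _ _ _ hp' hu' hp hpu') (.inr ⟨hu', hp⟩)
      · exact mk p' p p' u (.inr hp') (.inl hp) (.inr hp') (.inl hu) (ff X (n1 hp')) (iff_of_true Y hp) (ff Z (n1 hp')) (Nsw _ _ _ (NA _ _ _ hp hu hp' hpu)) (.inl ⟨hu, hp'⟩)
      · exact mk p' q' p u' (.inr hp') (.inr hq') (.inl hp) (.inr hu') (ff X (n1 hp')) (ff Y (n1 hq')) (iff_of_true Z hp) hN2 (.inr ⟨hu', hp⟩)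
      · exact absurd ⟨ff X Y, ff Y Z⟩ h
    · rintro ⟨x', y', z', u, h1, h2, h3, h4, h5, h6, h7, h8, h9⟩ ⟨e1, e2⟩
      rw [hSm _ _ hx h1] at h5
      rw [hSm _ _ hy h2] at h6
      rw [hSm _ _ hz h3] at h7
      rw [hDf _ _ h4 h3] at h9
      rw [hD] at h1 h2 h3 h4
      obtain ⟨-, -, -, -, -, -, h8⟩ := (hNd _ _ _).1 h8
      rcases h9 with ⟨hu, hz'⟩ | ⟨hu, hz'⟩
      · have nz : ¬ A z' := fun h => AB _ h hz'
        have bx : B x' := h1.resolve_left fun h => nz (h7.1 (e2.1 (e1.1 (h5.2 h))))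
        have bby : B y' := h2.resolve_left fun h => nz (h7.1 (e2.1 (h6.2 h)))
        have := hC.join hb hu.1 bx.1 bby.1 (AxB _ _ hu bx).2.2 (AxB _ _ hu bby).2.2
        rcases h8 with h8 | h8
        · exact hC.asym _ _ _ bx.1 bby.1 hu.1 this h8
        · exact hC.asym _ _ _ bby.1 bx.1 hu.1 (hC.symm _ _ _ bx.1 bby.1 hu.1 this) (hC.symm _ _ _ hu.1 bby.1 bx.1 h8)
      · have bx : A x' := h5.1 (e1.2 (e2.2 (h7.2 hz')))
        have bby : A y' := h6.1 (e2.2 (h7.2 hz'))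
        have := hC.join ha hu.1 bx.1 bby.1 (AxB _ _ bx hu).2.1 (AxB _ _ bby hu).2.1
        rcases h8 with h8 | h8
        · exact hC.asym _ _ _ bx.1 bby.1 hu.1 this h8
        · exact hC.asym _ _ _ bby.1 bx.1 hu.1 (hC.symm _ _ _ bx.1 bby.1 hu.1 this) (hC.symm _ _ _ hu.1 bby.1 bx.1 h8)
  refine mkInterp (d := 1) (fun t => D (t 0)) (DPP _ _) (fun t => decide (A (t 0))) ?_ (fun s t => Sm (s 0) (t 0))
    (fun s t u => T (s 0) (t 0) (u 0)) (SmPP _ (0, 0) (1, 0)) (TPP _ (0, 0) (1, 0) (2, 0)) ?_ ?_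
  · intro b'
    cases b'
    · obtain ⟨x, hx⟩ := exB
      exact ⟨fun _ => x, (hD x).2 (.inr hx), by simpa using fun h => AB _ h hx⟩
    · obtain ⟨x, hx⟩ := exA
      exact ⟨fun _ => x, (hD x).2 (.inl hx), by simpa using hx⟩
  · intro s t hs ht
    rw [hSm _ _ hs ht, decide_eq_decide]
  · intro s t u hs ht hu
    rw [← hT _ _ _ hs ht hu, decide_eq_decide, decide_eq_decide]

end DC

namespace DC
open Set Filter

variable {L : Type} {C : L → L → L → Prop}

structure CG (C : L → L → L → Prop) : Prop where
  symm : ∀ {z x y}, C z x y → C z y x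
  asym : ∀ {z x y}, C z x y → ¬ C y x z
  tr : ∀ {z x y}, C z x y → ∀ w, C w x y ∨ C z w y
  rfl' : ∀ {z x}, x ≠ z → C z x x
  bin : ∀ {x y z}, x ≠ y → x ≠ z → y ≠ z → C z x y ∨ C y x z ∨ C x y z
  den : ∀ {x y z}, C x y z → ∃ w, C x w z ∧ C w y z
  hom : IsCHomogeneous C
  inf : Infinite L

theorem CG.of (hL : IsHomBBDenseC C) : CG C := by
  obtain ⟨-, h1, ⟨h2, h3, h4, h5⟩, h6, h7, h8⟩ := hL
  exact ⟨h2 _ _ _, h3 _ _ _, h4 _ _ _, h5 _ _, h6 _ _ _, h7 _ _ _, h8, h1⟩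

namespace CG

theorem ne (G : CG C) {z x y : L} (h : C z x y) : x ≠ z ∧ y ≠ z := by
  constructor
  · rintro rfl
    have := G.symm h
    exact G.asym this this
  · rintro rfl
    exact G.asym h h

theorem join (G : CG C) {q x y z : L} (h : C q x y) (h' : C q y z) : C q x z := by
  rcases G.tr h' x with h1 | h1
  · rcases G.tr (G.symm h) z with h2 | h2
    · exact absurd h2 (G.asym h1)
    · exact G.symm h2
  · exact h1

/-- x,x' inside the cone around x' against q, y not -/
theorem out (G : CG C) {q p x x' y : L} (h : C q x p) (h' : C q x' p) (hy : ¬ C q y p) : C y x x' := by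
  rcases G.tr (G.join h (G.symm h')) y with h1 | h1
  · exact h1
  · exact absurd (G.join h1 h') hy

theorem cross (G : CG C) {a b u z : L} (h1 : C b a u) (h2 : C a b z) : C z a u := by
  rcases G.tr h1 z with h | h
  · exact h
  · exact absurd (G.symm h2) (G.asym (G.symm (G.join h1 (G.symm h))))

end CG

def Cone (C : L → L → L → Prop) (p q : L) : Set L := {z | C q z p}
def IsCone (C : L → L → L → Prop) (K : Set L) : Prop := ∃ p q, p ≠ q ∧ K = Cone C p q
def Sep (C : L → L → L → Prop) (X Y : Set L) : Prop :=
  (∀ x ∈ X, ∀ x' ∈ X, ∀ y ∈ Y, C y x x') ∧ (∀ x ∈ X, ∀ y ∈ Y, ∀ y' ∈ Y, C x y y')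

theorem Sep.symm {X Y : Set L} (h : Sep C X Y) : Sep C Y X := ⟨fun _ h1 _ h2 _ h3 => h.2 _ h3 _ h1 _ h2, fun _ h1 _ h2 _ h3 => h.1 _ h2 _ h3 _ h1⟩
theorem Sep.mono {X Y X' Y' : Set L} (h : Sep C X Y) (h1 : X' ⊆ X) (h2 : Y' ⊆ Y) : Sep C X' Y' :=
  ⟨fun _ a _ b _ c => h.1 _ (h1 a) _ (h1 b) _ (h2 c), fun _ a _ b _ c => h.2 _ (h1 a) _ (h2 b) _ (h2 c)⟩

namespace CG

theorem Sep_ne (G : CG C) {X Y : Set L} (h : Sep C X Y) {x y : L} (hx : x ∈ X) (hy : y ∈ Y) : x ≠ y := (G.ne (h.1 x hx x hx y hy)).1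

theorem mem_cone (G : CG C) {p q : L} (h : p ≠ q) : p ∈ Cone C p q := G.rfl' h
theorem cone_eq (G : CG C) {p q z : L} (h : z ∈ Cone C p q) : Cone C p q = Cone C z q := by
  ext w
  exact ⟨fun hw => G.join hw (G.symm h), fun hw => G.join hw h⟩
theorem cone_at (G : CG C) {K : Set L} (hK : IsCone C K) {z : L} (hz : z ∈ K) : ∃ q, z ≠ q ∧ K = Cone C z q := by
  obtain ⟨p, q, -, rfl⟩ := hK
  exact ⟨q, (G.ne hz).1, G.cone_eq hz⟩
theorem isCone (G : CG C) {p q : L} (h : p ≠ q) : IsCone C (Cone C p q) := ⟨p, q, h, rfl⟩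

theorem cone_out (G : CG C) {K : Set L} (hK : IsCone C K) {x x' y : L} (hx : x ∈ K) (hx' : x' ∈ K) (hy : y ∉ K) : C y x x' := by
  obtain ⟨p, q, -, rfl⟩ := hK
  exact G.out hx hx' hy

theorem nested (G : CG C) {K K' : Set L} (hK : IsCone C K) (hK' : IsCone C K') {z : L} (hz : z ∈ K) (hz' : z ∈ K') : K ⊆ K' ∨ K' ⊆ K := by
  obtain ⟨q, h1, rfl⟩ := G.cone_at hK hz
  obtain ⟨q', h2, rfl⟩ := G.cone_at hK' hz'
  by_cases h : q' ∈ Cone C z q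
  · right
    intro x hx
    by_contra hn
    exact G.asym (G.symm hx) (G.cone_out (G.isCone h1) hz h hn)
  · left
    intro x hx
    exact G.cone_out (G.isCone h1) hx hz h

theorem sep_cone (G : CG C) {K K' : Set L} (hK : IsCone C K) (hK' : IsCone C K') (h : Disjoint K K') : Sep C K K' :=
  ⟨fun _ hx _ hx' _ hy => G.cone_out hK hx hx' (fun h' => (Set.disjoint_left.1 h h' hy)),
   fun _ hx _ hy _ hy' => G.cone_out hK' hy hy' (fun h' => (Set.disjoint_left.1 h hx h'))⟩

theorem disj (G : CG C) {p p' : L} : Disjoint (Cone C p p') (Cone C p' p) := by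
  rw [Set.disjoint_left]
  intro z h h'
  exact G.asym h h'

/-- smallest cone around p avoiding F -/
theorem small_cone (G : CG C) (p q : L) (hpq : p ≠ q) (F : Set L) (hF : F.Finite) (hp : p ∉ F) : ∃ f, p ≠ f ∧ Cone C p f ⊆ Cone C p q ∧ ∀ f' ∈ F, Cone C p f ⊆ Cone C p f' := by
  induction F, hF using Set.Finite.induction_on with
  | empty => exact ⟨q, hpq, subset_rfl, by simp⟩
  | @insert a s _ _ ih =>
    obtain ⟨f, h1, h2, h3⟩ := ih (fun h => hp (mem_insert_of_mem _ h))
    have ha : p ≠ a := fun h => hp (h ▸ mem_insert _ _)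
    rcases G.nested (G.isCone h1) (G.isCone ha) (G.mem_cone h1) (G.mem_cone ha) with h | h
    · refine ⟨f, h1, h2, ?_⟩
      rintro f' (rfl | hf')
      · exact h
      · exact h3 _ hf'
    · refine ⟨a, ha, h.trans h2, ?_⟩
      rintro f' (rfl | hf')
      · exact subset_rfl
      · exact h.trans (h3 _ hf')

theorem cone_two (G : CG C) {p q : L} (h : p ≠ q) : ∃ p', p' ≠ p ∧ p' ∈ Cone C p q := by
  obtain ⟨w, h1, h2⟩ := G.den (G.rfl' h)
  exact ⟨w, (G.ne h2).1.symm, h1⟩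

theorem sub_cone (G : CG C) {p q p' : L} (h : p' ∈ Cone C p q) (hne : p' ≠ p) : Cone C p p' ⊆ Cone C p q := by
  have hpq : p ≠ q := (G.ne h).2
  intro z hz
  by_contra hn
  exact G.asym (G.symm hz) (G.cone_out (G.isCone hpq) (G.mem_cone hpq) h hn)

/-- topmost pair -/
theorem top_pair (G : CG C) (F : Set L) (hF : F.Finite) (hne : F.Nonempty) : ∃ x0 ∈ F, ∃ y0 ∈ F, ∀ x ∈ F, ¬ C x x0 y0 := by
  induction F, hF using Set.Finite.induction_on with
  | empty => exact absurd hne (by simp)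
  | @insert a s ha hs ih =>
    rcases s.eq_empty_or_nonempty with rfl | hs
    · refine ⟨a, mem_insert _ _, a, mem_insert _ _, ?_⟩
      rintro x (rfl | h) h'
      · exact (G.ne h').1 rfl
      · exact h
    · obtain ⟨x0, hx0, y0, hy, h⟩ := ih hs
      by_cases hxx : C a x0 y0
      · refine ⟨x0, mem_insert_of_mem _ hx0, a, mem_insert _ _, ?_⟩
        rintro x (rfl | hx) h'
        · exact (G.ne h').2 rfl
        · rcases G.tr hxx x with h1 | h1
          · exact h x hx h1
          · exact G.asym h' (G.symm (G.join h1 (G.symm hxx)))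
      · refine ⟨x0, mem_insert_of_mem _ hx0, y0, mem_insert_of_mem _ hy, ?_⟩
        rintro x (rfl | hx)
        · exact hxx
        · exact h x hx

/-- 3-point existence: above any pair there is a point -/
theorem above (G : CG C) (x y : L) : ∃ z, C z x y := by
  have := G.inf
  by_cases hxy : x = y
  · obtain ⟨z, hz⟩ := exists_ne x
    exact ⟨z, hxy ▸ G.rfl' hz.symm⟩
  · obtain ⟨p, q, r, h⟩ : ∃ p q r, p ≠ q ∧ C r p q := by
      obtain ⟨z, hz⟩ := exists_ne x
      obtain ⟨w, hw, hw'⟩ := G.cone_two hz.symm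
      exact ⟨w, x, z, hw, hw'⟩
    classical
    obtain ⟨γ, h1, h2⟩ := G.hom {p, q} (fun z => if z = p then x else y) (by
      intro a ha b hb hab
      have := h.1
      simp only [Finset.coe_insert, Finset.coe_singleton, mem_insert_iff, mem_singleton_iff] at ha hb
      rcases ha with rfl | rfl <;> rcases hb with rfl | rfl <;> simp_all [eq_comm]) (by
      have n1 : ∀ a b, ¬ C a a b := fun a b h => (G.ne h).1 rfl
      have n2 : ∀ a b, ¬ C a b a := fun a b h => (G.ne h).2 rfl
      have := h.1
      have := h.1.symm
      have h3 := Ne.symm hxy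
      intro a ha b hb c hc
      simp only [Finset.mem_insert, Finset.mem_singleton] at ha hb hc
      have r1 : C p q q := G.rfl' h.1.symm
      have r2 : C q p p := G.rfl' h.1
      have r3 : C x y y := G.rfl' h3
      have r4 : C y x x := G.rfl' hxy
      rcases ha with rfl | rfl <;> rcases hb with rfl | rfl <;> rcases hc with rfl | rfl <;> simp [*])
    have e1 := h2 p (by simp)
    have e2 := h2 q (by simp)
    simp only [if_true, if_neg h.1.symm] at e1 e2
    exact ⟨γ r, by rw [← e1, ← e2]; exact (h1.2 _ _ _).2 h.2⟩

theorem top_point (G : CG C) (F : Set L) (hF : F.Finite) : ∃ q, ∀ x ∈ F, ∀ y ∈ F, C q x y := by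
  rcases F.eq_empty_or_nonempty with rfl | hne
  · have := G.inf
    exact ⟨Classical.arbitrary L, by simp⟩
  obtain ⟨x0, h0, y0, h1, h⟩ := G.top_pair F hF hne
  obtain ⟨q, hq⟩ := G.above x0 y0
  have : ∀ x ∈ F, C q x y0 := fun x hx => (G.tr hq x).resolve_left (h x hx)
  exact ⟨q, fun x hx y hy => G.join (this x hx) (G.symm (this y hy))⟩

theorem split_set (G : CG C) (F : Set L) (hF : F.Finite) (hne : F.Nontrivial) : ∃ F1 F2, F1 ∪ F2 = F ∧ F1.Nonempty ∧ F2.Nonempty ∧ Sep C F1 F2 := by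
  obtain ⟨x0, h0, y0, h1, h⟩ := G.top_pair F hF hne.nonempty
  have hxy : x0 ≠ y0 := by
    rintro rfl
    obtain ⟨z, hz, hz'⟩ := hne.exists_ne x0
    exact h z hz (G.rfl' hz'.symm)
  refine ⟨F ∩ Cone C x0 y0, F ∩ Cone C y0 x0, ?_, ⟨x0, h0, G.mem_cone hxy⟩, ⟨y0, h1, G.mem_cone hxy.symm⟩,
    (G.sep_cone (G.isCone hxy) (G.isCone hxy.symm) G.disj).mono inter_subset_right inter_subset_right⟩
  rw [← inter_union_distrib_left, inter_eq_left]
  intro x hx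
  by_cases e1 : x = x0
  · subst e1; exact .inl (G.mem_cone hxy)
  by_cases e2 : x = y0
  · subst e2; exact .inr (G.mem_cone hxy.symm)
  rcases G.bin e1 e2 hxy with h3 | h3 | h3
  · exact .inl h3
  · exact .inr h3
  · exact absurd h3 (h x hx)

end CG

/-! Big sets -/
def Big (C : L → L → L → Prop) (X : Set L) : Prop := ∃ K0, IsCone C K0 ∧ ∀ K, IsCone C K → K ⊆ K0 → (K ∩ X).Nonempty

theorem Big.mono {X Y : Set L} (h : Big C X) (hXY : X ⊆ Y) : Big C Y := by
  obtain ⟨K0, h1, h2⟩ := h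
  exact ⟨K0, h1, fun K hK hK' => (h2 K hK hK').mono (inter_subset_inter_right _ hXY)⟩

theorem Big.union {X Y : Set L} (h : Big C (X ∪ Y)) : Big C X ∨ Big C Y := by
  obtain ⟨K0, h1, h2⟩ := h
  by_cases hX : Big C X
  · exact .inl hX
  · right
    simp only [Big, not_exists, not_and, not_forall] at hX
    obtain ⟨K, hK, hK', hn⟩ := hX K0 h1
    refine ⟨K, hK, fun K' h3 h4 => ?_⟩
    obtain ⟨z, hz, hz'⟩ := h2 K' h3 (h4.trans hK')
    rcases hz' with hz' | hz'
    · exact absurd ⟨z, h4 hz, hz'⟩ hn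
    · exact ⟨z, hz, hz'⟩

theorem Big.part {X : Set L} (h : Big C X) (Y : Set L) : Big C (X ∩ Y) ∨ Big C (X \ Y) := by
  apply Big.union
  rwa [inter_union_diff]

namespace CG

theorem big_cone (G : CG C) {K : Set L} (h : IsCone C K) : Big C K := by
  refine ⟨K, h, fun K' h1 h2 => ?_⟩
  obtain ⟨p, q, hpq, rfl⟩ := h1
  exact ⟨p, G.mem_cone hpq, h2 (G.mem_cone hpq)⟩

theorem big_nonempty (G : CG C) {X : Set L} (h : Big C X) : X.Nonempty := by
  obtain ⟨K0, h1, h2⟩ := h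
  exact (h2 K0 h1 subset_rfl).mono inter_subset_right

theorem big_split (G : CG C) {X : Set L} (h : Big C X) : ∃ Y Z, Y ⊆ X ∧ Z ⊆ X ∧ Big C Y ∧ Big C Z ∧ Sep C Y Z := by
  obtain ⟨K0, ⟨p, q, hpq, rfl⟩, h2⟩ := h
  obtain ⟨p', h3, h4⟩ := G.cone_two hpq
  refine ⟨Cone C p p' ∩ X, Cone C p' p ∩ X, inter_subset_right, inter_subset_right, ⟨Cone C p p', G.isCone h3.symm, ?_⟩, ⟨Cone C p' p, G.isCone h3, ?_⟩,
    (G.sep_cone (G.isCone h3.symm) (G.isCone h3) G.disj).mono inter_subset_left inter_subset_left⟩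
  · intro K hK hK'
    obtain ⟨z, hz, hz'⟩ := h2 K hK (hK'.trans (G.sub_cone h4 h3))
    exact ⟨z, hz, hK' hz, hz'⟩
  · intro K hK hK'
    obtain ⟨z, hz, hz'⟩ := h2 K hK (hK'.trans (by rw [G.cone_eq h4]; exact G.sub_cone (G.cone_eq h4 ▸ G.mem_cone hpq) h3.symm))
    exact ⟨z, hz, hK' hz, hz'⟩

theorem big_near (G : CG C) {X : Set L} (h : Big C X) : ∃ p ∈ X, ∀ F : Set L, F.Finite → p ∉ F → ∃ X' ⊆ X, Big C X' ∧ ∀ x ∈ X', ∀ f ∈ F, C f x p := by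
  obtain ⟨K0, h1, h2⟩ := h
  obtain ⟨p, hp, hp'⟩ := h2 K0 h1 subset_rfl
  refine ⟨p, hp', fun F hF hpF => ?_⟩
  obtain ⟨q, hpq, rfl⟩ := G.cone_at h1 hp
  obtain ⟨f, hf, h3, h4⟩ := G.small_cone p q hpq F hF hpF
  refine ⟨Cone C p f ∩ X, inter_subset_right, ⟨Cone C p f, G.isCone hf, fun K hK hK' => ?_⟩, fun x hx f' hf' => h4 f' hf' hx.1⟩
  obtain ⟨z, hz, hz'⟩ := h2 K hK (hK'.trans h3)
  exact ⟨z, hz, hK' hz, hz'⟩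

theorem not_big_sub (G : CG C) {X : Set L} (hX : X.Subsingleton) : ¬ Big C X := by
  intro h
  obtain ⟨Y, Z, h1, h2, h3, h4, h5⟩ := G.big_split h
  obtain ⟨y, hy⟩ := G.big_nonempty h3
  obtain ⟨z, hz⟩ := G.big_nonempty h4
  exact G.Sep_ne h5 hy hz (hX (h1 hy) (h2 hz))

theorem big_diff (G : CG C) {X Y : Set L} (hX : Big C X) (hY : ¬ Big C Y) : Big C (X \ Y) :=
  (hX.part Y).resolve_left fun h => hY (h.mono inter_subset_right)

theorem big_diff_iUnion (G : CG C) {ι : Type} {X : Set L} (hX : Big C X) (I : Set ι) (hI : I.Finite) (Y : ι → Set L) (hY : ∀ i ∈ I, ¬ Big C (X ∩ Y i)) :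
    Big C {x ∈ X | ∀ i ∈ I, x ∉ Y i} := by
  induction I, hI using Set.Finite.induction_on with
  | empty => simpa using hX
  | @insert a s _ _ ih =>
    have h1 := ih fun i hi => hY i (mem_insert_of_mem _ hi)
    rcases h1.part (Y a) with h2 | h2
    · exact absurd (h2.mono (inter_subset_inter_left _ (fun x hx => hx.1))) (hY a (mem_insert _ _))
    · refine h2.mono ?_
      rintro x ⟨⟨h3, h4⟩, h5⟩
      refine ⟨h3, ?_⟩
      rintro i (rfl | hi)
      · exact h5
      · exact h4 i hi

theorem big_diff_fin (G : CG C) {X F : Set L} (hX : Big C X) (hF : F.Finite) : Big C (X \ F) := by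
  refine (G.big_diff_iUnion hX F hF (fun f => {f}) fun i _ h => G.not_big_sub ?_ h).mono ?_
  · exact subsingleton_singleton.anti inter_subset_right
  · rintro x ⟨h1, h2⟩
    exact ⟨h1, fun h => h2 x h rfl⟩

theorem big_univ (G : CG C) : Big C (univ : Set L) := by
  have := G.inf
  obtain ⟨x, y, hxy⟩ := exists_pair_ne L
  exact (G.big_cone (G.isCone hxy)).mono (subset_univ _)

/-- near sets at an arbitrary point -/
theorem near_set (G : CG C) (p : L) (F : Set L) (hF : F.Finite) (hp : p ∉ F) : ∃ X, Big C X ∧ p ∉ X ∧ ∀ x ∈ X, ∀ f ∈ F, C f x p := by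
  have := G.inf
  obtain ⟨q, hq⟩ := exists_ne p
  obtain ⟨f, hf, h3, h4⟩ := G.small_cone p q hq.symm F hF hp
  exact ⟨Cone C p f \ {p}, G.big_diff_fin (G.big_cone (G.isCone hf)) (finite_singleton p), by simp, fun x hx f' hf' => h4 f' hf' hx.1⟩

end CG
end DC

namespace DC
open Set Filter

variable {L : Type} {C : L → L → L → Prop} {α : Type}

inductive BT (α : Type) : Type
  | leaf (a : α) : BT α
  | node (s t : BT α) : BT α

def BT.word : BT α → List α
  | .leaf a => [a]
  | .node s t => s.word ++ t.word

def BT.lab (t : BT α) : Set α := {a | a ∈ t.word}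

theorem BT.lab_leaf (a : α) : (BT.leaf a).lab = {a} := by ext; simp [BT.lab, BT.word]
theorem BT.lab_node (s t : BT α) : (BT.node s t).lab = s.lab ∪ t.lab := by ext; simp [BT.lab, BT.word]
theorem BT.lab_fin (t : BT α) : t.lab.Finite := List.finite_toSet t.word
theorem BT.lab_ne (t : BT α) : t.lab.Nonempty := by
  induction t with
  | leaf a => simp [BT.lab_leaf]
  | node s t h1 h2 => rw [BT.lab_node]; exact h1.inl

def Copy (C : L → L → L → Prop) : BT α → (α → L) → Prop
  | .leaf _, _ => True
  | .node s t, x => Copy C s x ∧ Copy C t x ∧ Sep C (x '' s.lab) (x '' t.lab)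

theorem Copy.congr {t : BT α} {x y : α → L} (h : Copy C t x) (hxy : EqOn x y t.lab) : Copy C t y := by
  induction t with
  | leaf a => trivial
  | node s t h1 h2 =>
    rw [BT.lab_node] at hxy
    have e1 : EqOn x y s.lab := hxy.mono subset_union_left
    have e2 : EqOn x y t.lab := hxy.mono subset_union_right
    refine ⟨h1 h.1 e1, h2 h.2.1 e2, ?_⟩
    rw [← e1.image_eq, ← e2.image_eq]; exact h.2.2

theorem Copy.inj (G : CG C) {t : BT α} {x : α → L} (h : Copy C t x) : InjOn x t.lab := by
  induction t with
  | leaf a => simp [BT.lab_leaf]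
  | node s t h1 h2 =>
    rw [BT.lab_node]
    rintro a (ha | ha) b (hb | hb) hab
    · exact h1 h.1 ha hb hab
    · exact absurd hab (G.Sep_ne h.2.2 (mem_image_of_mem _ ha) (mem_image_of_mem _ hb))
    · exact absurd hab.symm (G.Sep_ne h.2.2 (mem_image_of_mem _ hb) (mem_image_of_mem _ ha))
    · exact h2 h.2.1 ha hb hab

theorem Copy.nodup (G : CG C) {t : BT α} {x : α → L} (h : Copy C t x) : t.word.Nodup := by
  induction t with
  | leaf a => simp [BT.word]
  | node s t h1 h2 =>
    refine (h1 h.1).append (h2 h.2.1) ?_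
    intro a ha hb
    exact G.Sep_ne h.2.2 (mem_image_of_mem _ ha) (mem_image_of_mem _ hb) rfl

theorem Copy.isoC (G : CG C) {t : BT α} {x y : α → L} (h : Copy C t x) (h' : Copy C t y) :
    ∀ a ∈ t.lab, ∀ b ∈ t.lab, ∀ c ∈ t.lab, C (x a) (x b) (x c) → C (y a) (y b) (y c) := by
  induction t with
  | leaf a =>
    rw [BT.lab_leaf]
    rintro a rfl b rfl c rfl h
    exact absurd rfl (G.ne h).1
  | node s t h1 h2 =>
    obtain ⟨p1, p2, p3⟩ := h
    obtain ⟨q1, q2, q3⟩ := h'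
    have m : ∀ {z : α → L} {r : BT α} {a : α}, a ∈ r.lab → z a ∈ z '' r.lab := fun h => mem_image_of_mem _ h
    rw [BT.lab_node]
    rintro a (ha | ha) b (hb | hb) c (hc | hc) hC
    · exact h1 p1 q1 a ha b hb c hc hC
    · exact absurd (p3.1 _ (m ha) _ (m hb) _ (m hc)) (fun k => G.asym hC (G.symm k))
    · exact absurd (p3.1 _ (m ha) _ (m hc) _ (m hb)) (fun k => G.asym (G.symm hC) (G.symm k))
    · exact q3.2 _ (m ha) _ (m hb) _ (m hc)
    · exact q3.1 _ (m hb) _ (m hc) _ (m ha)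
    · exact absurd (p3.2 _ (m hb) _ (m hc) _ (m ha)) (fun k => G.asym (G.symm hC) k)
    · exact absurd (p3.2 _ (m hc) _ (m hb) _ (m ha)) (fun k => G.asym hC k)
    · exact h2 p2 q2 a ha b hb c hc hC

theorem Copy.iso (G : CG C) {t : BT α} {x y : α → L} (h : Copy C t x) (h' : Copy C t y) :
    CIso C (fun a : t.lab => x a) (fun a : t.lab => y a) :=
  ⟨fun i j => ⟨fun e => by rw [Subtype.ext (h.inj G i.2 j.2 e)], fun e => by rw [Subtype.ext (h'.inj G i.2 j.2 e)]⟩,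
   fun i j k => ⟨h.isoC G h' _ i.2 _ j.2 _ k.2, h'.isoC G h _ i.2 _ j.2 _ k.2⟩⟩

theorem exists_copy (G : CG C) (x : α → L) (A : Set α) (hA : A.Finite) (hne : A.Nonempty) (hi : InjOn x A) :
    ∃ t, Copy C t x ∧ t.lab = A := by
  induction h : A.ncard using Nat.strong_induction_on generalizing A with
  | _ n ih =>
    by_cases hs : A.Nontrivial
    · obtain ⟨F1, F2, h1, h2, h3, h4⟩ := G.split_set (x '' A) (hA.image x) (hs.image_of_injOn hi)
      have hd : Disjoint F1 F2 := Set.disjoint_left.2 fun a ha hb => G.Sep_ne h4 ha hb rfl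
      have key : ∀ F F', F ∪ F' = x '' A → F'.Nonempty → Disjoint F F' → F.Nonempty → ∃ t, Copy C t x ∧ t.lab = A ∩ x ⁻¹' F := by
        intro F F' hF hF' hFF hn
        refine ih (A ∩ x ⁻¹' F).ncard ?_ _ (hA.subset inter_subset_left) ?_ (hi.mono inter_subset_left) rfl
        · rw [← h]
          apply Set.ncard_lt_ncard _ hA
          obtain ⟨z, hz⟩ := hF'
          obtain ⟨a, ha, rfl⟩ : z ∈ x '' A := hF ▸ Or.inr hz
          exact ⟨inter_subset_left, fun hh => Set.disjoint_left.1 hFF (hh ha).2 hz⟩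
        · obtain ⟨z, hz⟩ := hn
          obtain ⟨a, ha, rfl⟩ : z ∈ x '' A := hF ▸ Or.inl hz
          exact ⟨a, ha, hz⟩
      obtain ⟨t1, c1, l1⟩ := key F1 F2 h1 h3 hd h2
      obtain ⟨t2, c2, l2⟩ := key F2 F1 (by rw [union_comm, h1]) h2 hd.symm h3
      refine ⟨.node t1 t2, ⟨c1, c2, ?_⟩, ?_⟩
      · rw [l1, l2]
        refine h4.mono ?_ ?_
        · rintro _ ⟨a, ⟨-, ha⟩, rfl⟩; exact ha
        · rintro _ ⟨a, ⟨-, ha⟩, rfl⟩; exact ha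
      · rw [BT.lab_node, l1, l2, ← inter_union_distrib_left, ← preimage_union, h1]
        exact inter_eq_left.2 (subset_preimage_image _ _)
    · rw [not_nontrivial_iff] at hs
      obtain ⟨a, ha⟩ := hne
      exact ⟨.leaf a, trivial, by rw [BT.lab_leaf]; exact (hs.eq_singleton_of_mem ha).symm⟩

theorem exists_merge (A B : Set α) (h : Disjoint A B) (x y : α → L) : ∃ z, EqOn z x A ∧ EqOn z y B := by
  classical
  refine ⟨fun a => if a ∈ A then x a else y a, fun a ha => by simp [ha], fun a ha => by simp [Set.disjoint_right.1 h ha]⟩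

def CombTo (C : L → L → L → Prop) (x : α → L) : List α → Set L → Prop
  | [], _ => True
  | a :: l, W => (∀ u ∈ x '' {b | b ∈ l} ∪ W, ∀ v ∈ x '' {b | b ∈ l} ∪ W, C (x a) u v) ∧ CombTo C x l W

theorem CombTo.mono {x : α → L} {l : List α} {W W' : Set L} (h : CombTo C x l W) (hW : W' ⊆ W) : CombTo C x l W' := by
  induction l with
  | nil => trivial
  | cons a l ih => exact ⟨fun u hu v hv => h.1 u (union_subset_union_right _ hW hu) v (union_subset_union_right _ hW hv), ih h.2⟩

theorem CombTo.congr {x y : α → L} {l : List α} {W : Set L} (h : CombTo C x l W) (hxy : ∀ a ∈ l, x a = y a) : CombTo C y l W := by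
  induction l with
  | nil => trivial
  | cons a l ih =>
    have e : y '' {b | b ∈ l} = x '' {b | b ∈ l} := by
      apply EqOn.image_eq
      intro b hb; exact (hxy b (List.mem_cons_of_mem _ hb)).symm
    refine ⟨?_, ih h.2 fun b hb => hxy b (List.mem_cons_of_mem _ hb)⟩
    rw [e, ← hxy a (by simp)]; exact h.1

theorem CombTo.append {x : α → L} {l l' : List α} {W : Set L} (h : CombTo C x l (x '' {b | b ∈ l'} ∪ W)) (h' : CombTo C x l' W) :
    CombTo C x (l ++ l') W := by
  induction l with
  | nil => exact h'
  | cons a l ih =>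
    refine ⟨?_, ih h.2⟩
    have e : x '' {b | b ∈ l ++ l'} ∪ W = x '' {b | b ∈ l} ∪ (x '' {b | b ∈ l'} ∪ W) := by
      rw [← union_assoc, ← image_union]; congr 2; ext; simp
    have h1 := h.1
    rw [← e] at h1; exact h1

theorem comb_tree0 (G : CG C) (l : List α) (hl : l ≠ []) : ∃ t : BT α, t.word = l ∧ ∀ x : α → L, CombTo C x l ∅ → Copy C t x := by
  induction l with
  | nil => exact absurd rfl hl
  | cons a l ih =>
    by_cases hl : l = []
    · subst hl; exact ⟨.leaf a, rfl, fun _ _ => trivial⟩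
    · obtain ⟨t, h1, h2⟩ := ih hl
      refine ⟨.node (.leaf a) t, by simp [BT.word, h1], fun x h => ⟨trivial, h2 x h.2, ?_⟩⟩
      have h3 := h.1
      rw [union_empty] at h3
      have : t.lab = {b | b ∈ l} := by rw [BT.lab, h1]
      rw [BT.lab_leaf, image_singleton, this]
      refine ⟨?_, ?_⟩
      · rintro _ rfl _ rfl u hu
        exact G.rfl' (G.ne (h3 u hu u hu)).1.symm
      · rintro _ rfl u hu v hv
        exact h3 u hu v hv

theorem comb_tree (G : CG C) {x : α → L} (l : List α) (hl : l ≠ []) (h : CombTo C x l ∅) : ∃ t : BT α, t.word = l ∧ Copy C t x := by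
  obtain ⟨t, h1, h2⟩ := comb_tree0 G l hl
  exact ⟨t, h1, h2 x h⟩

theorem comb_tree' (G : CG C) {x : α → L} (l l' : List α) (a : α) (hl : l' ≠ []) (h : CombTo C x (l ++ a :: l') ∅) :
    ∃ t : BT α, t.word = l ++ (l' ++ [a]) ∧ Copy C t x := by
  induction l with
  | nil =>
    obtain ⟨t, h1, h2⟩ := comb_tree G l' hl h.2
    refine ⟨.node t (.leaf a), by simp [BT.word, h1], h2, trivial, Sep.symm ?_⟩
    have h3 := h.1
    rw [union_empty] at h3
    have : t.lab = {b | b ∈ l'} := by rw [BT.lab, h1]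
    rw [BT.lab_leaf, image_singleton, this]
    refine ⟨?_, ?_⟩
    · rintro _ rfl _ rfl u hu
      exact G.rfl' (G.ne (h3 u hu u hu)).1.symm
    · rintro _ rfl u hu v hv
      exact h3 u hu v hv
  | cons b l ih =>
    obtain ⟨t, h1, h2⟩ := ih h.2
    refine ⟨.node (.leaf b) t, by simp [BT.word, h1], trivial, h2, ?_⟩
    have h3 := h.1
    rw [union_empty] at h3
    have : t.lab = {b | b ∈ l ++ a :: l'} := by rw [BT.lab, h1]; ext; simp; tauto
    rw [BT.lab_leaf, image_singleton, this]
    refine ⟨?_, ?_⟩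
    · rintro _ rfl _ rfl u hu
      exact G.rfl' (G.ne (h3 u hu u hu)).1.symm
    · rintro _ rfl u hu v hv
      exact h3 u hu v hv

/-- node step for placing trees -/
theorem place_node {s t : BT α} (hn : (BT.node s t).word.Nodup) {x0 x1 : α → L} {X0 X1 W : Set L} {e : L → L}
    (hsep : Sep C X0 X1) (h0 : Copy C s x0) (h1 : Copy C t x1) (m0 : ∀ a ∈ s.lab, x0 a ∈ X0) (m1 : ∀ a ∈ t.lab, x1 a ∈ X1)
    (c0 : CombTo C (fun a => e (x0 a)) s.word ((fun a => e (x1 a)) '' t.lab ∪ W)) (c1 : CombTo C (fun a => e (x1 a)) t.word W) :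
    ∃ x, Copy C (.node s t) x ∧ (∀ a ∈ (BT.node s t).lab, x a ∈ X0 ∪ X1) ∧ CombTo C (fun a => e (x a)) (BT.node s t).word W ∧
      EqOn x x0 s.lab ∧ EqOn x x1 t.lab := by
  have hd : Disjoint s.lab t.lab := Set.disjoint_left.2 fun a ha hb => (List.nodup_append.1 hn).2.2 a ha a hb rfl
  obtain ⟨x, e0, e1⟩ := exists_merge s.lab t.lab hd x0 x1
  have i1 : (fun a => e (x a)) '' {b | b ∈ t.word} = (fun a => e (x1 a)) '' t.lab :=
    EqOn.image_eq (s := t.lab) fun a ha => by simp only [e1 ha]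
  refine ⟨x, ⟨h0.congr e0.symm, h1.congr e1.symm, hsep.mono ?_ ?_⟩, ?_, CombTo.append ?_ ?_, e0, e1⟩
  · rintro _ ⟨a, ha, rfl⟩; rw [e0 ha]; exact m0 a ha
  · rintro _ ⟨a, ha, rfl⟩; rw [e1 ha]; exact m1 a ha
  · rw [BT.lab_node]
    rintro a (ha | ha)
    · rw [e0 ha]; exact .inl (m0 a ha)
    · rw [e1 ha]; exact .inr (m1 a ha)
  · rw [i1]
    exact c0.congr fun a ha => by rw [e0 ha]
  · exact c1.congr fun a ha => by rw [e1 ha]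

def Tight (C : L → L → L → Prop) (e : L → L) (X : Set L) : Prop :=
  ∀ J J', IsCone C J → IsCone C J' → Big C (X ∩ e ⁻¹' J) → Big C (X ∩ e ⁻¹' J') → ¬ Disjoint J J'

theorem tight_comb (G : CG C) (e : L → L) (he : Function.Injective e) (X : Set L) (hX : Big C X) (ht : Tight C e X)
    (T : BT α) (hT : T.word.Nodup) : ∃ x, Copy C T x ∧ CombTo C (fun a => e (x a)) T.word ∅ := by
  by_cases hO : ∀ Y Y', Y ⊆ X → Y' ⊆ X → Big C Y → Big C Y' → ∃ Z Z' J, Big C Z ∧ Big C Z' ∧ IsCone C J ∧ (∀ z ∈ Z, e z ∈ J) ∧ (∀ z ∈ Z', e z ∉ J) ∧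
      ((Z ⊆ Y ∧ Z' ⊆ Y') ∨ (Z ⊆ Y' ∧ Z' ⊆ Y))
  · have claim : ∀ T : BT α, T.word.Nodup → ∀ Y ⊆ X, Big C Y → ∀ J0, IsCone C J0 → Big C (X ∩ e ⁻¹' J0) → (∀ y ∈ Y, e y ∉ J0) →
        ∃ x, Copy C T x ∧ (∀ a ∈ T.lab, x a ∈ Y) ∧ CombTo C (fun a => e (x a)) T.word J0 := by
      intro T
      induction T with
      | leaf a =>
        intro hT Y hY hYb J0 hJ hJb hd
        obtain ⟨y, hy⟩ := G.big_nonempty hYb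
        refine ⟨fun _ => y, trivial, fun _ _ => hy, ?_, trivial⟩
        intro u hu v hv
        simp at hu hv
        exact G.cone_out hJ hu hv (hd y hy)
      | node s t ih0 ih1 =>
        intro hn Y hY hYb J0 hJ hJb hd
        have hn' := List.nodup_append.1 hn
        obtain ⟨Y0, Y1, s0, s1, b0, b1, hs⟩ := G.big_split hYb
        obtain ⟨Z, Z', J, z1, z2, z3, z4, z5, z6⟩ := hO Y0 Y1 (s0.trans hY) (s1.trans hY) b0 b1
        have hZ : Z ⊆ Y ∧ Z' ⊆ Y ∧ Sep C Z' Z := by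
          rcases z6 with ⟨h1, h2⟩ | ⟨h1, h2⟩
          · exact ⟨h1.trans s0, h2.trans s1, (hs.mono h1 h2).symm⟩
          · exact ⟨h1.trans s1, h2.trans s0, hs.mono h2 h1⟩
        have hJB : Big C (X ∩ e ⁻¹' J) := z1.mono fun z hz => ⟨hY (hZ.1 hz), z4 z hz⟩
        have hsub : J0 ⊆ J := by
          have := ht J0 J hJ z3 hJb hJB
          obtain ⟨w, hw, hw'⟩ := Set.not_disjoint_iff.1 this
          rcases G.nested hJ z3 hw hw' with h | h
          · exact h
          · obtain ⟨z, hz⟩ := G.big_nonempty z1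
            exact absurd (h (z4 z hz)) (hd z (hZ.1 hz))
        obtain ⟨x1, p1, p2, p3⟩ := ih1 hn'.2.1 Z (hZ.1.trans hY) z1 J0 hJ hJb fun z hz => hd z (hZ.1 hz)
        obtain ⟨x0, q1, q2, q3⟩ := ih0 hn'.1 Z' (hZ.2.1.trans hY) z2 J z3 hJB z5
        obtain ⟨x, r1, r2, r3, -⟩ := place_node hn hZ.2.2 q1 p1 q2 p2 (q3.mono (by
          rintro _ (⟨a, ha, rfl⟩ | h)
          · exact z4 _ (p2 a ha)
          · exact hsub h)) p3
        exact ⟨x, r1, fun a ha => (r2 a ha).elim (fun h => hZ.2.1 h) (fun h => hZ.1 h), r3⟩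
    obtain ⟨Z, Z', J, z1, z2, z3, z4, z5, z6⟩ := hO X X subset_rfl subset_rfl hX hX
    have hZ : Z ⊆ X ∧ Z' ⊆ X := by rcases z6 with h | h <;> exact h
    obtain ⟨x, p1, p2, p3⟩ := claim T hT Z' hZ.2 z2 J z3 (z1.mono fun z hz => ⟨hZ.1 hz, z4 z hz⟩) z5
    exact ⟨x, p1, p3.mono (empty_subset _)⟩
  · push Not at hO
    obtain ⟨Y, Y', hY, hY', bY, bY', hn⟩ := hO
    have ns : ∀ J, IsCone C J → Big C (Y ∩ e ⁻¹' J) → ¬ Big C (Y \ e ⁻¹' J) := by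
      intro J hJ h1 h2
      rcases bY'.part (e ⁻¹' J) with h3 | h3
      · exact (hn (Y' ∩ e ⁻¹' J) (Y \ e ⁻¹' J) J h3 h2 hJ (fun z hz => hz.2) (fun z hz => hz.2)).2 inter_subset_left diff_subset
      · exact (hn (Y ∩ e ⁻¹' J) (Y' \ e ⁻¹' J) J h1 h3 hJ (fun z hz => hz.2) (fun z hz => hz.2)).1 inter_subset_left diff_subset
    have full : ∀ J, IsCone C J → Big C (Y ∩ e ⁻¹' J) → ∀ Z ⊆ Y, Big C Z → Big C (Z ∩ e ⁻¹' J) := fun J hJ hb Z hZ hZb =>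
      (hZb.part (e ⁻¹' J)).resolve_right fun h => ns J hJ hb (h.mono (diff_subset_diff_left hZ))
    rcases bY.part {y | ∃ J, IsCone C J ∧ Big C (Y ∩ e ⁻¹' J) ∧ e y ∉ J} with hA | hU
    · have claim : ∀ T : BT α, T.word.Nodup → ∀ Z ⊆ Y ∩ {y | ∃ J, IsCone C J ∧ Big C (Y ∩ e ⁻¹' J) ∧ e y ∉ J}, Big C Z →
          ∃ x J, IsCone C J ∧ Big C (Y ∩ e ⁻¹' J) ∧ Copy C T x ∧ (∀ a ∈ T.lab, x a ∈ Z) ∧ CombTo C (fun a => e (x a)) T.word J := by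
        intro T
        induction T with
        | leaf a =>
          intro hT Z hZ hZb
          obtain ⟨y, hy⟩ := G.big_nonempty hZb
          obtain ⟨J, hJ, hJb, hyJ⟩ := (hZ hy).2
          refine ⟨fun _ => y, J, hJ, hJb, trivial, fun _ _ => hy, ?_, trivial⟩
          intro u hu v hv
          simp at hu hv
          exact G.cone_out hJ hu hv hyJ
        | node s t ih0 ih1 =>
          intro hn Z hZ hZb
          have hn' := List.nodup_append.1 hn
          obtain ⟨Y0, Y1, s0, s1, b0, b1, hs⟩ := G.big_split hZb
          obtain ⟨x0, J, p1, p2, p3, p4, p5⟩ := ih0 hn'.1 Y0 (s0.trans hZ) b0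
          obtain ⟨x1, J', q1, q2, q3, q4, q5⟩ := ih1 hn'.2.1 (Y1 ∩ e ⁻¹' J) ((inter_subset_left.trans s1).trans hZ)
            (full J p1 p2 Y1 ((s1.trans hZ).trans inter_subset_left) b1)
          have : ∃ J2, IsCone C J2 ∧ Big C (Y ∩ e ⁻¹' J2) ∧ J2 ⊆ J ∧ J2 ⊆ J' := by
            obtain ⟨y, ⟨hy1, hy2⟩, hy3⟩ := G.big_nonempty (full J p1 p2 _ inter_subset_left q2)
            rcases G.nested p1 q1 hy3 hy2 with h | h
            · exact ⟨J, p1, p2, subset_rfl, h⟩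
            · exact ⟨J', q1, q2, h, subset_rfl⟩
          obtain ⟨J2, j1, j2, j3, j4⟩ := this
          obtain ⟨x, r1, r2, r3, -⟩ := place_node hn (hs.mono subset_rfl inter_subset_left) p3 q3 p4 q4 (p5.mono (by
            rintro _ (⟨a, ha, rfl⟩ | h)
            · exact (q4 a ha).2
            · exact j3 h)) (q5.mono j4)
          exact ⟨x, J2, j1, j2, r1, fun a ha => (r2 a ha).elim (fun h => s0 h) (fun h => s1 h.1), r3⟩
      obtain ⟨x, J, -, -, p1, p2, p3⟩ := claim T hT _ subset_rfl hA
      exact ⟨x, p1, p3.mono (empty_subset _)⟩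
    · set U := Y \ {y | ∃ J, IsCone C J ∧ Big C (Y ∩ e ⁻¹' J) ∧ e y ∉ J} with hUd
      have sm : ∀ q ∈ e '' U, ∀ q' ∈ e '' U, q ≠ q' → ¬ Big C (Y ∩ e ⁻¹' (Cone C q q')) := by
        rintro q - _ ⟨y, hy, rfl⟩ hne hb
        exact hy.2 ⟨_, G.isCone hne, hb, fun h => (G.ne h).1 rfl⟩
      have claim : ∀ T : BT α, T.word.Nodup → ∀ Z ⊆ U, Big C Z → ∀ F ⊆ e '' U, F.Finite →
          ∃ x, Copy C T x ∧ (∀ a ∈ T.lab, x a ∈ Z) ∧ CombTo C (fun a => e (x a)) T.word F := by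
        intro T
        induction T with
        | leaf a =>
          intro hT Z hZ hZb F hF hFf
          have h1 := G.big_diff_iUnion (X := Z) hZb ({p : L × L | p.1 ∈ F ∧ p.2 ∈ F ∧ p.1 ≠ p.2})
            ((hFf.prod hFf).subset fun p hp => ⟨hp.1, hp.2.1⟩) (fun p => e ⁻¹' (Cone C p.1 p.2)) (by
              rintro ⟨q, q'⟩ ⟨h1, h2, h3⟩ hb
              exact sm q (hF h1) q' (hF h2) h3 (hb.mono (inter_subset_inter_left _ (hZ.trans diff_subset))))
          have h2 := G.big_diff_fin h1 (hFf.preimage (f := e) (fun _ _ _ _ h => he h))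
          obtain ⟨y, ⟨⟨hy1, hy2⟩, hy3⟩⟩ := G.big_nonempty h2
          refine ⟨fun _ => y, trivial, fun _ _ => hy1, ?_, trivial⟩
          intro u hu v hv
          simp at hu hv
          have nu : e y ≠ u := fun h => hy3 (show e y ∈ F by rw [h]; exact hu)
          have nv : e y ≠ v := fun h => hy3 (show e y ∈ F by rw [h]; exact hv)
          by_cases huv : u = v
          · subst huv; exact G.rfl' nu.symm
          · rcases G.bin nu nv huv with h | h | h
            · exact absurd h (hy2 (u, v) ⟨hu, hv, huv⟩)
            · exact absurd h (hy2 (v, u) ⟨hv, hu, Ne.symm huv⟩)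
            · exact h
        | node s t ih0 ih1 =>
          intro hn Z hZ hZb F hF hFf
          have hn' := List.nodup_append.1 hn
          obtain ⟨Y0, Y1, s0, s1, b0, b1, hs⟩ := G.big_split hZb
          obtain ⟨x1, p1, p2, p3⟩ := ih1 hn'.2.1 Y1 (s1.trans hZ) b1 F hF hFf
          obtain ⟨x0, q1, q2, q3⟩ := ih0 hn'.1 Y0 (s0.trans hZ) b0 ((fun a => e (x1 a)) '' t.lab ∪ F) (by
            rintro _ (⟨a, ha, rfl⟩ | h)
            · exact ⟨_, hZ (s1 (p2 a ha)), rfl⟩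
            · exact hF h) ((t.lab_fin.image _).union hFf)
          obtain ⟨x, r1, r2, r3, -⟩ := place_node hn hs q1 p1 q2 p2 q3 p3
          exact ⟨x, r1, fun a ha => (r2 a ha).elim (fun h => s0 h) (fun h => s1 h), r3⟩
      obtain ⟨x, p1, p2, p3⟩ := claim T hT _ subset_rfl hU ∅ (empty_subset _) finite_empty
      exact ⟨x, p1, p3⟩

end DC

namespace DC
open Set Filter

variable {σ : Type} {ar : σ → ℕ} {L E : Type} {C : L → L → L → Prop} {Γ : RelStruct σ ar L} {Δ : RelStruct σ ar E} {I J : Type} {h : L → E} {g : E → L}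

def HT (Δ : RelStruct σ ar E) : Prop := ∀ (I : Type) [Finite I] (s t : I → E), Function.Injective s → Function.Injective t → Orb Δ s t

theorem OC.inj (oc : OC Δ) {e : E → E} (he : IsHom Δ Δ e) : Function.Injective e := by
  intro x y hxy
  exact ((oc.endoI he ![x, y]).eq_iff 0 1).2 hxy

theorem CIso.of_inj (G : CG C) {s t : I → L} (hs : Function.Injective s) (ht : Function.Injective t)
    (H : ∀ i j k, i ≠ j → i ≠ k → j ≠ k → C (s i) (s j) (s k) → C (t i) (t j) (t k))
    (H' : ∀ i j k, i ≠ j → i ≠ k → j ≠ k → C (t i) (t j) (t k) → C (s i) (s j) (s k)) : CIso C s t := by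
  have key : ∀ {s t : I → L} (hs : Function.Injective s) (ht : Function.Injective t)
    (H : ∀ i j k, i ≠ j → i ≠ k → j ≠ k → C (s i) (s j) (s k) → C (t i) (t j) (t k)), ∀ i j k, C (s i) (s j) (s k) → C (t i) (t j) (t k) := by
    intro s t hs ht H i j k hC
    have h1 : i ≠ j := fun e => (G.ne hC).1 (by rw [e])
    have h2 : i ≠ k := fun e => (G.ne hC).2 (by rw [e])
    by_cases h3 : j = k
    · subst h3; exact G.rfl' (fun e => h1 (ht e).symm)
    · exact H i j k h1 h2 h3 hC
  exact ⟨fun i j => by rw [hs.eq_iff, ht.eq_iff], fun i j k => ⟨key hs ht H i j k, key ht hs H' i j k⟩⟩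

theorem CIso.pair (G : CG C) {x y u v : L} (h : x ≠ y) (h' : u ≠ v) : CIso C ![x, y] ![u, v] := by
  have key : ∀ {x y : L}, x ≠ y → Function.Injective ![x, y] := by
    intro x y h i j hij
    fin_cases i <;> fin_cases j <;> simp_all
  refine CIso.of_inj G (key h) (key h') ?_ ?_ <;>
  · intro i j k; omega

theorem Setup.endo_inj (S : Setup C Γ Δ h g) [Nontrivial E] {e : L → L} (he : IsHom Γ Γ e) : Function.Injective e := by
  intro x y hxy
  by_contra hne
  obtain ⟨u, v, huv⟩ := exists_pair_ne E
  have hgi : g u ≠ g v := fun e => huv (S.oc.inj (hcomp S.hg S.hh) (congrArg h e))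
  obtain ⟨α, h1, h2⟩ := (CIso.pair (CG.of S.hL) hgi hne).aut S.hL
  refine huv (S.oc.inj (hcomp (hcomp (hcomp S.hg (S.aut α h1)) he) S.hh) ?_)
  have e1 := h2 0
  have e2 := h2 1
  simp at e1 e2
  simp [e1, e2, hxy]

theorem Setup.h_inj (S : Setup C Γ Δ h g) [Nontrivial E] : Function.Injective h :=
  fun x y e => S.endo_inj (hcomp S.hh S.hg) (congrArg g e)
theorem Setup.g_inj (S : Setup C Γ Δ h g) : Function.Injective g :=
  fun x y e => S.oc.inj (hcomp S.hg S.hh) (congrArg h e)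
theorem Setup.hom_inj (S : Setup C Γ Δ h g) {k : E → L} (hk : IsHom Δ Γ k) : Function.Injective k :=
  fun x y e => S.oc.inj (hcomp hk S.hh) (congrArg h e)

def Reach (C : L → L → L → Prop) (Γ : RelStruct σ ar L) (Δ : RelStruct σ ar E) (z : I → E) (l : List I) : Prop :=
  ∃ k, IsHom Δ Γ k ∧ CombTo C (fun i => k (z i)) l ∅

theorem Setup.reach_start (S : Setup C Γ Δ h g) [Nontrivial E] {e : L → L} (he : IsHom Γ Γ e) {X : Set L} (hX : Big C X) (ht : Tight C e X) [Finite I]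
    {z : I → E} {k : E → L} (hk : IsHom Δ Γ k) {T : BT I} (hT : Copy C T (fun i => k (z i))) (hw : ∀ i, i ∈ T.word) : Reach C Γ Δ z T.word := by
  have G := CG.of S.hL
  obtain ⟨y, h1, h2⟩ := tight_comb G e (S.endo_inj he) X hX ht T (hT.nodup G)
  obtain ⟨α, h3, h4⟩ := (hT.iso G h1).aut S.hL
  refine ⟨fun x => e (α (k x)), hcomp (hcomp hk (S.aut α h3)) he, h2.congr ?_⟩
  intro a ha
  simp only
  rw [h4 ⟨a, ha⟩]

theorem Setup.reach_perm (S : Setup C Γ Δ h g) [Nontrivial E] {e : L → L} (he : IsHom Γ Γ e) {X : Set L} (hX : Big C X) (ht : Tight C e X) [Finite I]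
    {z : I → E} (todo : List I) : ∀ (rest don : List I), rest.Perm todo → (∀ i, i ∈ rest ++ don) → Reach C Γ Δ z (rest ++ don) → Reach C Γ Δ z (don ++ todo) := by
  have G := CG.of S.hL
  induction todo with
  | nil =>
    intro rest don hp hw hr
    rw [List.perm_nil] at hp
    subst hp; simpa using hr
  | cons a todo ih =>
    intro rest don hp hw hr
    obtain ⟨r1, r2, rfl⟩ := List.append_of_mem (hp.mem_iff.2 (List.mem_cons_self))
    have hp' : (r1 ++ r2).Perm todo := by
      have := (List.perm_middle (a := a) (l₁ := r1) (l₂ := r2)).symm.trans hp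
      exact List.Perm.cons_inv this
    have := ih (r1 ++ r2) (don ++ [a]) hp' (by
      intro i; have := hw i; simp at this ⊢; tauto) (by
      by_cases hn : r2 ++ don = []
      · simp at hn
        obtain ⟨rfl, rfl⟩ := hn
        simpa using hr
      · obtain ⟨k, hk, hc⟩ := hr
        have hc' : CombTo C (fun i => k (z i)) (r1 ++ a :: (r2 ++ don)) ∅ := by simpa using hc
        obtain ⟨t, h1, h2⟩ := comb_tree' G r1 (r2 ++ don) a hn hc'
        have := S.reach_start he hX ht hk h2 (by intro i; rw [h1]; have := hw i; simp at this ⊢; tauto)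
        rw [h1] at this
        simpa using this)
    simpa using this

theorem Setup.tight_ht (S : Setup C Γ Δ h g) [Nontrivial E] {e : L → L} (he : IsHom Γ Γ e) {X : Set L} (hX : Big C X) (ht : Tight C e X) : HT Δ := by
  have G := CG.of S.hL
  intro I _ z z' hz hz'
  rcases isEmpty_or_nonempty I with hI | hI
  · rw [Subsingleton.elim z z']; exact Orb.refl _
  have start : ∀ z : I → E, Function.Injective z → ∃ l : List I, l.Nodup ∧ (∀ i, i ∈ l) ∧ Reach C Γ Δ z l := by
    intro z hz
    obtain ⟨T, h1, h2⟩ := exists_copy G (fun i => g (z i)) univ (toFinite _) univ_nonempty (S.g_inj.comp hz).injOn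
    have hw : ∀ i, i ∈ T.word := fun i => by
      have : i ∈ T.lab := h2 ▸ mem_univ i
      exact this
    exact ⟨T.word, h1.nodup G, hw, S.reach_start he hX ht S.hg h1 hw⟩
  obtain ⟨l, a1, a2, a3⟩ := start z hz
  obtain ⟨l', b1, b2, b3⟩ := start z' hz'
  have hp : l.Perm l' := (List.perm_ext_iff_of_nodup a1 b1).2 fun i => by simp [a2, b2]
  have a4 := S.reach_perm he hX ht l' l [] hp (by simpa using a2) (by simpa using a3)
  obtain ⟨k, hk, hc⟩ := a4
  obtain ⟨k', hk', hc'⟩ := b3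
  obtain ⟨t, h1, h2⟩ := comb_tree0 (C := C) G l' (by rintro rfl; exact absurd (b2 hI.some) (by simp))
  obtain ⟨α, h3, h4⟩ := ((h2 _ hc).iso G (h2 _ hc')).aut S.hL
  have o1 := S.oc.endoI (hcomp (hcomp hk (S.aut α h3)) S.hh) z
  have o2 := S.oc.endoI (hcomp hk' S.hh) z'
  refine o1.trans (Orb.trans ?_ o2.symm)
  have : (fun i => h (α (k (z i)))) = fun i => h (k' (z' i)) := by
    funext i
    rw [h4 ⟨i, by rw [BT.lab, h1]; exact b2 i⟩]
  simp only [this]; exact Orb.refl _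

end DC

namespace DC
open Set Filter

variable {σ : Type} {ar : σ → ℕ} {L E : Type} {C : L → L → L → Prop} {Γ : RelStruct σ ar L} {Δ : RelStruct σ ar E} {I J : Type} {h : L → E} {g : E → L}

structure NS (C : L → L → L → Prop) (Γ : RelStruct σ ar L) (Δ : RelStruct σ ar E) (h : L → E) (g : E → L) : Prop where
  S : Setup C Γ Δ h g
  nt : Nontrivial E
  notight : ∀ e, IsHom Γ Γ e → ∀ X, Big C X → ¬ Tight C e X

theorem idHom : IsHom Γ Γ (fun x => x) := fun _ _ h => h

theorem NS.G (N : NS C Γ Δ h g) : CG C := CG.of N.S.hL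

theorem NS.inj (N : NS C Γ Δ h g) {e : L → L} (he : IsHom Γ Γ e) : Function.Injective e := by
  have := N.nt
  exact N.S.endo_inj he

theorem NS.two (N : NS C Γ Δ h g) {e : L → L} (he : IsHom Γ Γ e) {X : Set L} (hX : Big C X) :
    ∃ J J', IsCone C J ∧ IsCone C J' ∧ Big C (X ∩ e ⁻¹' J) ∧ Big C (X ∩ e ⁻¹' J') ∧ Disjoint J J' := by
  have := N.notight e he X hX
  unfold Tight at this
  push Not at this
  exact this

theorem NS.sep (N : NS C Γ Δ h g) {e : L → L} (he : IsHom Γ Γ e) {X0 X1 : Set L} (h0 : Big C X0) (h1 : Big C X1) :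
    ∃ Z0 Z1, Z0 ⊆ X0 ∧ Z1 ⊆ X1 ∧ Big C Z0 ∧ Big C Z1 ∧ Sep C (e '' Z0) (e '' Z1) := by
  have G := N.G
  have fin : ∀ J J', IsCone C J → IsCone C J' → Disjoint J J' → Big C (X0 ∩ e ⁻¹' J) → Big C (X1 ∩ e ⁻¹' J') →
      ∃ Z0 Z1, Z0 ⊆ X0 ∧ Z1 ⊆ X1 ∧ Big C Z0 ∧ Big C Z1 ∧ Sep C (e '' Z0) (e '' Z1) := by
    intro J J' hJ hJ' hd b b'
    refine ⟨_, _, inter_subset_left, inter_subset_left, b, b', (G.sep_cone hJ hJ' hd).mono ?_ ?_⟩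
    · rintro _ ⟨z, hz, rfl⟩; exact hz.2
    · rintro _ ⟨z, hz, rfl⟩; exact hz.2
  obtain ⟨J, J', c, c', b, b', hd⟩ := N.two he h0
  rcases h1.part (e ⁻¹' J) with h2 | h2
  · exact fin J' J c' c hd.symm b' h2
  · obtain ⟨K, K', d, d', f, f', hd'⟩ := N.two he h2
    obtain ⟨x, hx⟩ := G.big_nonempty b
    have key : ∀ K, IsCone C K → Big C ((X1 \ e ⁻¹' J) ∩ e ⁻¹' K) → ¬ Disjoint J K → J ⊆ K := by
      intro K hK hb hn
      obtain ⟨z, hz, hz'⟩ := Set.not_disjoint_iff.1 hn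
      rcases G.nested c hK hz hz' with h | h
      · exact h
      · obtain ⟨y, hy⟩ := G.big_nonempty hb
        exact absurd (h hy.2) hy.1.2
    by_cases n1 : Disjoint J K
    · exact fin J K c d n1 b (f.mono (inter_subset_inter_left _ diff_subset))
    · by_cases n2 : Disjoint J K'
      · exact fin J K' c d' n2 b (f'.mono (inter_subset_inter_left _ diff_subset))
      · exact absurd (key K' d' f' n2 hx.2) (Set.disjoint_left.1 hd' (key K d f n1 hx.2))

theorem NS.sep2 (N : NS C Γ Δ h g) {e : L → L} (he : IsHom Γ Γ e) {X0 X1 : Set L} (h0 : Big C X0) (h1 : Big C X1) :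
    ∃ Z0 Z1, Z0 ⊆ X0 ∧ Z1 ⊆ X1 ∧ Big C Z0 ∧ Big C Z1 ∧ Sep C Z0 Z1 ∧ Sep C (e '' Z0) (e '' Z1) := by
  obtain ⟨Y0, Y1, a, b, c, d, f⟩ := N.sep he h0 h1
  obtain ⟨Z0, Z1, a', b', c', d', f'⟩ := N.sep idHom c d
  refine ⟨Z0, Z1, a'.trans a, b'.trans b, c', d', ?_, f.mono (image_mono a') (image_mono b')⟩
  simpa using f'

theorem NS.sepPt (N : NS C Γ Δ h g) {e : L → L} (he : IsHom Γ Γ e) (a : L) {X : Set L} (hX : Big C X) :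
    ∃ Z, Z ⊆ X ∧ Big C Z ∧ Sep C {e a} (e '' Z) := by
  have G := N.G
  obtain ⟨J, J', c, c', b, b', hd⟩ := N.two he hX
  have fin : ∀ J, IsCone C J → Big C (X ∩ e ⁻¹' J) → e a ∉ J → ∃ Z, Z ⊆ X ∧ Big C Z ∧ Sep C {e a} (e '' Z) := by
    intro J hJ hb hn
    refine ⟨_, inter_subset_left, hb, ?_, ?_⟩
    · rintro _ rfl _ rfl _ ⟨z, hz, rfl⟩
      exact G.rfl' (fun k => hn (k ▸ hz.2))
    · rintro _ rfl _ ⟨z, hz, rfl⟩ _ ⟨z', hz', rfl⟩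
      exact G.cone_out hJ hz.2 hz'.2 hn
  by_cases hn : e a ∈ J
  · exact fin J' c' b' (Set.disjoint_left.1 hd hn)
  · exact fin J c b hn

theorem NS.sepPt2 (N : NS C Γ Δ h g) {e : L → L} (he : IsHom Γ Γ e) (a : L) {X : Set L} (hX : Big C X) :
    ∃ Z, Z ⊆ X ∧ Big C Z ∧ Sep C {a} Z ∧ Sep C {e a} (e '' Z) := by
  obtain ⟨Y, a1, b1, c1⟩ := N.sepPt he a hX
  obtain ⟨Z, a2, b2, c2⟩ := N.sepPt idHom a b1
  refine ⟨Z, a2.trans a1, b2, ?_, c1.mono subset_rfl (image_mono a2)⟩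
  simpa using c2

theorem shrink_fin {ι κ : Type} (P : κ → (ι → Set L) → Prop) (K : Set κ) (hK : K.Finite)
    (anti : ∀ k (X X' : ι → Set L), (∀ i, X' i ⊆ X i) → P k X → P k X')
    (ach : ∀ k ∈ K, ∀ X : ι → Set L, (∀ i, Big C (X i)) → ∃ X' : ι → Set L, (∀ i, X' i ⊆ X i) ∧ (∀ i, Big C (X' i)) ∧ P k X') :
    ∀ X : ι → Set L, (∀ i, Big C (X i)) → ∃ X' : ι → Set L, (∀ i, X' i ⊆ X i) ∧ (∀ i, Big C (X' i)) ∧ ∀ k ∈ K, P k X' := by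
  induction K, hK using Set.Finite.induction_on with
  | empty => exact fun X hX => ⟨X, fun _ => subset_rfl, hX, by simp⟩
  | @insert a s _ _ ih =>
    intro X hX
    obtain ⟨Y, h1, h2, h3⟩ := ih (fun k hk => ach k (mem_insert_of_mem _ hk)) X hX
    obtain ⟨Z, h4, h5, h6⟩ := ach a (mem_insert _ _) Y h2
    refine ⟨Z, fun i => (h4 i).trans (h1 i), h5, ?_⟩
    rintro k (rfl | hk)
    · exact h6
    · exact anti k Y Z h4 (h3 k hk)

theorem NS.shrink (N : NS C Γ Δ h g) {e : L → L} (he : IsHom Γ Γ e) {ι : Type} [Finite ι] (A : Set L) (hA : A.Finite)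
    (X : ι → Set L) (hX : ∀ i, Big C (X i)) : ∃ X' : ι → Set L, (∀ i, X' i ⊆ X i) ∧ (∀ i, Big C (X' i)) ∧
      (∀ i j, i ≠ j → Sep C (X' i) (X' j) ∧ Sep C (e '' X' i) (e '' X' j)) ∧
      ∀ a ∈ A, ∀ i, Sep C {a} (X' i) ∧ Sep C {e a} (e '' X' i) := by
  classical
  obtain ⟨Y, h1, h2, h3⟩ := shrink_fin (C := C) (fun (k : ι × ι) (X : ι → Set L) => k.1 ≠ k.2 → Sep C (X k.1) (X k.2) ∧ Sep C (e '' X k.1) (e '' X k.2)) univ (toFinite _)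
    (fun k X X' hs hP hk => ⟨(hP hk).1.mono (hs _) (hs _), (hP hk).2.mono (image_mono (hs _)) (image_mono (hs _))⟩)
    (by
      rintro ⟨i, j⟩ - X hX
      by_cases hij : i = j
      · exact ⟨X, fun _ => subset_rfl, hX, fun h => absurd hij h⟩
      obtain ⟨Z0, Z1, a, b, c, d, f, f'⟩ := N.sep2 he (hX i) (hX j)
      refine ⟨Function.update (Function.update X i Z0) j Z1, ?_, ?_, ?_⟩
      · intro k
        by_cases hkj : k = j
        · subst hkj; simpa using b
        · by_cases hki : k = i
          · subst hki; simpa [hkj] using a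
          · simp [hkj, hki]
      · intro k
        by_cases hkj : k = j
        · subst hkj; simpa using d
        · by_cases hki : k = i
          · subst hki; simpa [hkj] using c
          · simpa [hkj, hki] using hX k
      · intro _
        simpa [hij] using ⟨f, f'⟩) X hX
  obtain ⟨Z, h4, h5, h6⟩ := shrink_fin (C := C) (fun (k : L × ι) (X : ι → Set L) => Sep C {k.1} (X k.2) ∧ Sep C {e k.1} (e '' X k.2)) (A ×ˢ univ) (hA.prod (toFinite _))
    (fun k X X' hs hP => ⟨hP.1.mono subset_rfl (hs _), hP.2.mono subset_rfl (image_mono (hs _))⟩)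
    (by
      rintro ⟨a, i⟩ - X hX
      obtain ⟨Z0, a1, b, c, d⟩ := N.sepPt2 he a (hX i)
      refine ⟨Function.update X i Z0, ?_, ?_, by simpa using ⟨c, d⟩⟩
      · intro k
        by_cases hki : k = i
        · subst hki; simpa using a1
        · simp [hki]
      · intro k
        by_cases hki : k = i
        · subst hki; simpa using b
        · simpa [hki] using hX k) Y h2
  refine ⟨Z, fun i => (h4 i).trans (h1 i), h5, fun i j hij => ?_, fun a ha i => h6 (a, i) ⟨ha, mem_univ _⟩⟩
  have := h3 (i, j) (mem_univ _) hij
  exact ⟨this.1.mono (h4 _) (h4 _), this.2.mono (image_mono (h4 _)) (image_mono (h4 _))⟩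

theorem NS.sepCopy (N : NS C Γ Δ h g) {e : L → L} (he : IsHom Γ Γ e) {α : Type} (T : BT α) : T.word.Nodup → ∀ {X : Set L}, Big C X →
    ∃ x, Copy C T x ∧ Copy C T (fun a => e (x a)) ∧ ∀ a ∈ T.lab, x a ∈ X := by
  induction T with
  | leaf a =>
    intro _ X hX
    obtain ⟨z, hz⟩ := N.G.big_nonempty hX
    exact ⟨fun _ => z, trivial, trivial, fun _ _ => hz⟩
  | node s t h1 h2 =>
    intro hn X hX
    have hn' := List.nodup_append.1 hn
    obtain ⟨Z0, Z1, a, b, c, d, f, f'⟩ := N.sep2 he hX hX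
    obtain ⟨x0, p1, p2, p3⟩ := h1 hn'.1 c
    obtain ⟨x1, q1, q2, q3⟩ := h2 hn'.2.1 d
    obtain ⟨z, z0, z1⟩ := exists_merge s.lab t.lab (Set.disjoint_left.2 fun a ha hb => hn'.2.2 a ha a hb rfl) x0 x1
    have m0 : ∀ a ∈ s.lab, z a ∈ Z0 := fun a ha => by rw [z0 ha]; exact p3 a ha
    have m1 : ∀ a ∈ t.lab, z a ∈ Z1 := fun a ha => by rw [z1 ha]; exact q3 a ha
    refine ⟨z, ⟨p1.congr z0.symm, q1.congr z1.symm, f.mono ?_ ?_⟩, ⟨p2.congr ?_, q2.congr ?_, f'.mono ?_ ?_⟩, ?_⟩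
    · rintro _ ⟨a, ha, rfl⟩; exact m0 a ha
    · rintro _ ⟨a, ha, rfl⟩; exact m1 a ha
    · intro a ha; simp only [z0 ha]
    · intro a ha; simp only [z1 ha]
    · rintro _ ⟨a, ha, rfl⟩; exact mem_image_of_mem _ (m0 a ha)
    · rintro _ ⟨a, ha, rfl⟩; exact mem_image_of_mem _ (m1 a ha)
    · rw [BT.lab_node]
      rintro r (hr | hr)
      · exact a (m0 r hr)
      · exact b (m1 r hr)

def Eqv (Δ : RelStruct σ ar E) (h : L → E) (s t : I → L) : Prop := Orb Δ (fun i => h (s i)) (fun i => h (t i))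

theorem Eqv.refl (s : I → L) : Eqv Δ h s s := Orb.refl _
theorem Eqv.symm {s t : I → L} (H : Eqv Δ h s t) : Eqv Δ h t s := Orb.symm H
theorem Eqv.trans {s t u : I → L} (H : Eqv Δ h s t) (H' : Eqv Δ h t u) : Eqv Δ h s u := Orb.trans H H'
theorem Eqv.comap {s t : I → L} (H : Eqv Δ h s t) (f : J → I) : Eqv Δ h (fun j => s (f j)) (fun j => t (f j)) := Orb.comap H f

theorem NS.settled (N : NS C Γ Δ h g) [Finite I] (s : I → L) : ∃ y : I → E, ∀ k, IsHom Γ Δ k → Orb Δ (fun i => k (s i)) y := by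
  have inj : ∀ {J : Type} [Finite J] (s : J → L), Function.Injective s → ∃ y : J → E, ∀ k, IsHom Γ Δ k → Orb Δ (fun i => k (s i)) y := by
    intro J _ s hs
    rcases isEmpty_or_nonempty J with hJ | hJ
    · exact ⟨fun i => h (s i), fun k hk => by rw [Subsingleton.elim (fun i => k (s i)) (fun i => h (s i))]; exact Orb.refl _⟩
    obtain ⟨T, h1, h2⟩ := exists_copy N.G s univ (toFinite _) univ_nonempty hs.injOn
    obtain ⟨x, a, b, -⟩ := N.sepCopy (hcomp N.S.hh N.S.hg) T (h1.nodup N.G) N.G.big_univ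
    obtain ⟨β, h3, h4⟩ := (b.iso N.G h1).aut N.S.hL
    refine ⟨fun i => h (x i), fun k hk => ?_⟩
    have o := N.S.oc.endoI (hcomp (hcomp N.S.hg (N.S.aut β h3)) hk) (fun i => h (x i))
    have : (fun i => k (β (g (h (x i))))) = fun i => k (s i) := by
      funext i
      have := h4 ⟨i, h2 ▸ mem_univ i⟩
      simp only at this
      rw [this]
    rw [this] at o
    exact o.symm
  obtain ⟨y, hy⟩ := inj (fun a : range s => (a : L)) Subtype.val_injective
  exact ⟨fun i => y ⟨s i, i, rfl⟩, fun k hk => (hy k hk).comap fun i => ⟨s i, i, rfl⟩⟩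

theorem NS.eqv_hom (N : NS C Γ Δ h g) [Finite I] {e : L → L} (he : IsHom Γ Γ e) (s : I → L) : Eqv Δ h s (fun i => e (s i)) := by
  obtain ⟨y, hy⟩ := N.settled s
  exact (hy h N.S.hh).trans (hy _ (hcomp he N.S.hh)).symm

theorem NS.eqv_iso (N : NS C Γ Δ h g) [Finite I] {s t : I → L} (H : CIso C s t) : Eqv Δ h s t := by
  obtain ⟨α, h1, h2⟩ := H.aut N.S.hL
  have := N.eqv_hom (N.S.aut α h1) s
  simp only [h2] at this
  exact this

theorem NS.ht (N : NS C Γ Δ h g) (H : ∀ (I : Type) [Finite I] (s t : I → L), Function.Injective s → Function.Injective t → Eqv Δ h s t) : HT Δ := by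
  intro I _ s t hs ht
  have o1 := N.S.oc.endoI (hcomp N.S.hg N.S.hh) s
  have o2 := N.S.oc.endoI (hcomp N.S.hg N.S.hh) t
  exact o1.trans (Orb.trans (H I (fun i => g (s i)) (fun i => g (t i)) (N.S.g_inj.comp hs) (N.S.g_inj.comp ht)) o2.symm)

theorem NS.ht_one (N : NS C Γ Δ h g) (H : ∀ (I : Type) [Finite I] (s t : I → L) (a : I), Function.Injective s → Function.Injective t →
    (∀ i, i ≠ a → s i = t i) → Eqv Δ h s t) : HT Δ := by
  classical
  have := N.G.inf
  have step : ∀ (I : Type) [Finite I] (s t : I → L), Function.Injective s → Function.Injective t → (∀ i j, s i ≠ t j) → Eqv Δ h s t := by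
    intro I _ s t hs ht hd
    have : ∀ A : Set I, A.Finite → Eqv Δ h s (A.piecewise t s) := by
      intro A hA
      have inj : ∀ A : Set I, Function.Injective (A.piecewise t s) := by
        intro A i j hij
        by_cases hi : i ∈ A <;> by_cases hj : j ∈ A <;> simp [hi, hj] at hij
        · exact ht hij
        · exact absurd hij.symm (hd _ _)
        · exact absurd hij (hd _ _)
        · exact hs hij
      induction A, hA using Set.Finite.induction_on with
      | empty => simp; exact Eqv.refl _
      | @insert a A _ _ ih =>
        refine ih.trans (H I _ _ a (inj _) (inj _) fun i hi => ?_)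
        by_cases hA : i ∈ A <;> simp [hA, hi]
    have := this univ (toFinite _)
    simpa using this
  refine N.ht fun I _ s t hs ht => ?_
  obtain ⟨f, hf⟩ : ∃ f : I → L, Function.Injective f ∧ ∀ i, f i ∉ range s ∪ range t := by
    have hi : Infinite ((range s ∪ range t)ᶜ : Set L) := (((toFinite (range s)).union (toFinite (range t))).infinite_compl).to_subtype
    obtain ⟨n, ⟨e⟩⟩ := Finite.exists_equiv_fin I
    let f := Infinite.natEmbedding ((range s ∪ range t)ᶜ : Set L)
    exact ⟨fun i => f (e i : ℕ), fun i j hij => by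
      have := f.injective (Subtype.ext hij)
      exact e.injective (Fin.ext this), fun i => (f (e i : ℕ)).2⟩
  refine (step I s f hs hf.1 fun i j hij => hf.2 j (.inl ⟨i, hij⟩)).trans (step I t f ht hf.1 fun i j hij => hf.2 j (.inr ⟨i, hij⟩)).symm

theorem near_iso (G : CG C) {x w : I → L} (hn : ∀ i j, i ≠ j → C (x j) (w i) (x i)) : CIso C x w := by
  have hx : Function.Injective x := by
    intro i j hij
    by_contra hne
    exact (G.ne (hn i j hne)).2 hij
  have hw : Function.Injective w := by
    intro i j hij
    by_contra hne
    have := hn j i (Ne.symm hne)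
    rw [← hij] at this
    exact G.asym (hn i j hne) this
  have key : ∀ i j k, i ≠ j → i ≠ k → j ≠ k → C (x i) (x j) (x k) → C (w i) (w j) (w k) := by
    intro i j k h1 h2 h3 hC
    have a1 : C (x i) (w j) (w k) := G.join (hn j i h1.symm) (G.join hC (G.symm (hn k i h2.symm)))
    rcases G.tr a1 (w i) with h | h
    · exact h
    · have := G.join (G.join h (hn k i h2.symm)) (G.symm hC)
      exact absurd this (G.asym (hn i j h1))
  refine CIso.of_inj G hx hw key fun i j k h1 h2 h3 hC => ?_
  rcases G.bin (hx.ne h1) (hx.ne h2) (hx.ne h3) with h | h | h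
  · exact absurd (key k i j h2.symm h3.symm h1 h) (fun h => G.asym hC (G.symm h))
  · exact absurd (key j i k h1.symm h3 h2 h) (fun h => G.asym (G.symm hC) (G.symm h))
  · exact h

end DC

namespace DC
open Set Filter

variable {σ : Type} {ar : σ → ℕ} {L E : Type} {C : L → L → L → Prop} {Γ : RelStruct σ ar L} {Δ : RelStruct σ ar E} {I J : Type} {h : L → E} {g : E → L}

theorem CIso.of_inj1 (G : CG C) {x w : I → L} (hx : Function.Injective x) (hw : Function.Injective w)
    (key : ∀ i j k, i ≠ j → i ≠ k → j ≠ k → C (x i) (x j) (x k) → C (w i) (w j) (w k)) : CIso C x w := by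
  refine CIso.of_inj G hx hw key fun i j k h1 h2 h3 hC => ?_
  rcases G.bin (hx.ne h1) (hx.ne h2) (hx.ne h3) with h | h | h
  · exact absurd (key k i j h2.symm h3.symm h1 h) (fun h => G.asym hC (G.symm h))
  · exact absurd (key j i k h1.symm h3 h2 h) (fun h => G.asym (G.symm hC) (G.symm h))
  · exact h

theorem CIso.triple (G : CG C) {q c p q' c' p' : L} (h1 : C q c p) (h2 : c ≠ p) (h3 : C q' c' p') (h4 : c' ≠ p') :
    CIso C ![q, c, p] ![q', c', p'] := by
  have key : ∀ {q c p : L}, C q c p → c ≠ p → Function.Injective ![q, c, p] := by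
    intro q c p h1 h2 i j hij
    have := (G.ne h1).1
    have := (G.ne h1).2
    fin_cases i <;> fin_cases j <;> simp_all
  refine CIso.of_inj1 G (key h1 h2) (key h3 h4) ?_
  intro i j k d1 d2 d3 hC
  have n1 := G.asym h1
  have n2 := G.asym (G.symm h1)
  have n3 : ¬ C c q p := fun h => G.asym (G.symm h1) (G.symm h)
  have n4 : ¬ C p q c := fun h => n1 (G.symm h)
  have h3' := G.symm h3
  fin_cases i <;> fin_cases j <;> fin_cases k <;> simp_all

def ext (c : L) (s : I → L) : Option I → L := fun o => o.elim c s

theorem ext_none (c : L) (s : I → L) : ext c s none = c := rfl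
theorem ext_some (c : L) (s : I → L) (i : I) : ext c s (some i) = s i := rfl

theorem ext_inj {c : L} {s : I → L} (hs : Function.Injective s) (hc : ∀ i, s i ≠ c) : Function.Injective (ext c s) := by
  rintro (_ | i) (_ | j) hij
  · rfl
  · exact absurd hij.symm (hc j)
  · exact absurd hij (hc i)
  · rw [hs hij]

theorem ext_top (G : CG C) {s t : I → L} (H : CIso C s t) {r r' : L} (hr : ∀ i j, C r (s i) (s j)) (hr' : ∀ i j, C r' (t i) (t j)) :
    CIso C (ext r s) (ext r' t) := by
  constructor
  · rintro (_ | i) (_ | j)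
    · simp [ext]
    · simp only [ext_none, ext_some]; exact ⟨fun e => absurd e.symm (G.ne (hr j j)).1, fun e => absurd e.symm (G.ne (hr' j j)).1⟩
    · simp only [ext_none, ext_some]; exact ⟨fun e => absurd e (G.ne (hr i i)).1, fun e => absurd e (G.ne (hr' i i)).1⟩
    · exact H.1 i j
  · have key : ∀ {s t : I → L} (H : CIso C s t) {r r' : L} (hr : ∀ i j, C r (s i) (s j)) (hr' : ∀ i j, C r' (t i) (t j)),
      ∀ i j k, C (ext r s i) (ext r s j) (ext r s k) → C (ext r' t i) (ext r' t j) (ext r' t k) := by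
      intro s t H r r' hr hr'
      rintro (_ | i) (_ | j) (_ | k) hC <;> simp only [ext_none, ext_some] at hC ⊢
      · exact absurd rfl (G.ne hC).1
      · exact absurd rfl (G.ne hC).1
      · exact absurd rfl (G.ne hC).2
      · exact hr' j k
      · exact G.rfl' (G.ne (hr' i i)).1.symm
      · exact absurd (G.symm hC) (G.asym (hr i k) ∘ fun h => by
          exact absurd (G.symm hC) (G.asym (hr i k |> G.symm)))
      · exact absurd hC (G.asym (hr i j |> G.symm))
      · exact (H.2 i j k).1 hC
    exact fun i j k => ⟨key H hr hr' i j k, key H.symm hr' hr i j k⟩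

theorem Sep3 (G : CG C) {X0 X1 X2 : Set L} (h01 : Sep C X0 X1) (h02 : Sep C X0 X2) (h12 : Sep C X1 X2)
    {x0 x1 x2 y0 y1 y2 : L} (a0 : x0 ∈ X0) (a1 : x1 ∈ X1) (a2 : x2 ∈ X2) (b0 : y0 ∈ X0) (b1 : y1 ∈ X1) (b2 : y2 ∈ X2)
    (hC : C x2 x0 x1) : C y2 y0 y1 := by
  have h1 : C x2 y0 y1 := G.join (h02.1 y0 b0 x0 a0 x2 a2) (G.join hC (h12.1 x1 a1 y1 b1 x2 a2))
  rcases G.tr h1 y2 with h | h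
  · exact h
  · exact absurd (h12.2 y1 b1 y2 b2 x2 a2) (G.asym h)

def NonRR (C : L → L → L → Prop) (Γ : RelStruct σ ar L) : Prop :=
  ∀ e, IsHom Γ Γ e → ∀ X0 X1 X2, Big C X0 → Big C X1 → Big C X2 → Sep C X0 X1 → Sep C X0 X2 → Sep C X1 X2 →
    Sep C (e '' X0) (e '' X1) → Sep C (e '' X0) (e '' X2) → Sep C (e '' X1) (e '' X2) →
    ∀ x0 ∈ X0, ∀ x1 ∈ X1, ∀ x2 ∈ X2, C x2 x0 x1 → C (e x2) (e x0) (e x1)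

theorem NS.perturb (N : NS C Γ Δ h g) (hR : NonRR C Γ) {e : L → L} (he : IsHom Γ Γ e) {ι : Type} [Finite ι] (z : ι → L) (a : L)
    (hz : Function.Injective (ext a z)) (B : ι → Set L)
    (hB : ∀ i, ∀ F : Set L, F.Finite → z i ∉ F → ∃ X' ⊆ B i, Big C X' ∧ ∀ x ∈ X', ∀ f ∈ F, C f x (z i)) :
    ∃ w : ι → L, (∀ i, w i ∈ B i) ∧ CIso C (ext a z) (ext a w) ∧ CIso C w (fun i => e (w i)) := by
  have G := N.G
  have hf : (range (ext a z)).Finite := toFinite _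
  choose Y y1 y2 y3 using fun i => hB i (range (ext a z) \ {z i}) hf.diff (by simp)
  obtain ⟨X, x1, x2, x3, -⟩ := N.shrink he ∅ finite_empty Y y2
  choose w hw using fun i => G.big_nonempty (x2 i)
  refine ⟨w, fun i => y1 i (x1 i (hw i)), near_iso G ?_, ?_⟩
  · rintro (_ | i) j hij
    · exact G.rfl' (hz.ne hij)
    · exact y3 i (w i) (x1 i (hw i)) _ ⟨⟨j, rfl⟩, fun k => hij (hz (show ext a z j = ext a z (some i) from k)).symm⟩
  · have hwi : Function.Injective w := by
      intro i j hij
      by_contra hne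
      exact G.Sep_ne (x3 i j hne).1 (hw i) (hw j) hij
    refine CIso.of_inj1 G hwi ((N.inj he).comp hwi) ?_
    intro i j k h1 h2 h3 hC
    exact hR e he (X j) (X k) (X i) (x2 _) (x2 _) (x2 _) (x3 _ _ h3).1 (x3 _ _ h1.symm).1 (x3 _ _ h2.symm).1
      (x3 _ _ h3).2 (x3 _ _ h1.symm).2 (x3 _ _ h2.symm).2 _ (hw _) _ (hw _) _ (hw _) hC

def TopFree (C : L → L → L → Prop) (Δ : RelStruct σ ar E) (h : L → E) : Prop :=
  ∀ (I : Type) [Finite I] (s : I → L) (c r : L), Function.Injective s → (∀ i, s i ≠ c) → (∀ i j, C r (s i) (s j)) → Eqv Δ h (ext c s) (ext r s)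

theorem NS.ht_top (N : NS C Γ Δ h g) (H : TopFree C Δ h) : HT Δ := by
  classical
  refine N.ht_one fun I _ s t a hs ht hst => ?_
  let s' : {i // i ≠ a} → L := fun i => s i
  obtain ⟨r, hr⟩ := N.G.top_point (range s') (toFinite _)
  have hs' : Function.Injective s' := fun i j hij => Subtype.ext (hs hij)
  have k1 := H _ s' (s a) r hs' (fun i hi => i.2 (hs hi)) (fun i j => hr _ ⟨i, rfl⟩ _ ⟨j, rfl⟩)
  have k2 := H _ s' (t a) r hs' (fun i hi => i.2 (ht ((hst i i.2).symm.trans hi))) (fun i j => hr _ ⟨i, rfl⟩ _ ⟨j, rfl⟩)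
  have k3 := (k1.trans k2.symm).comap (fun i => if hi : i = a then none else some ⟨i, hi⟩)
  have e1 : (fun i => ext (s a) s' (if hi : i = a then none else some ⟨i, hi⟩)) = s := by
    funext i
    by_cases hi : i = a
    · subst hi; simp [ext]
    · simp [hi, ext, s']
  have e2 : (fun i => ext (t a) s' (if hi : i = a then none else some ⟨i, hi⟩)) = t := by
    funext i
    by_cases hi : i = a
    · subst hi; simp [ext]
    · simp [hi, ext, s', hst i hi]
  rw [e1, e2] at k3
  exact k3

/-- common set up for both violation types -/
theorem NS.viol (N : NS C Γ Δ h g) (hR : NonRR C Γ) {e : L → L} (he : IsHom Γ Γ e) {a : L} {X1 X2 : Set L} (b1 : Big C X1) (b2 : Big C X2)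
    [Finite I] (s : I → L) (p0 q0 c0 : L) (hi : Function.Injective (ext c0 (ext p0 (ext q0 s))))
    (hp : ∀ p ∈ X1, ∀ q ∈ X2, CIso C ![c0, p0, q0] ![a, p, q]) :
    ∃ (w : I → L) (p q : L), p ∈ X1 ∧ q ∈ X2 ∧ CIso C (ext c0 (ext p0 (ext q0 s))) (ext a (ext p (ext q w))) ∧
      CIso C (ext p (ext q w)) (ext (e p) (ext (e q) (fun i => e (w i)))) := by
  have G := N.G
  obtain ⟨p1, p1m, hp1⟩ := G.big_near b1
  obtain ⟨q1, q1m, hq1⟩ := G.big_near b2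
  obtain ⟨α, h1, h2⟩ := (hp p1 p1m q1 q1m).aut N.S.hL
  have e0 := h2 0
  have e1 := h2 1
  have e2 := h2 2
  simp at e0 e1 e2
  have hα : (fun i => α (ext c0 (ext p0 (ext q0 s)) i)) = ext a (ext p1 (ext q1 fun i => α (s i))) := by
    funext i
    rcases i with _ | _ | _ | i <;> simp [ext, e0, e1, e2]
  have hc := CIso.of_aut h1 (ext c0 (ext p0 (ext q0 s)))
  rw [hα] at hc
  have hz : Function.Injective (ext a (ext p1 (ext q1 fun i => α (s i)))) := by
    rw [← hα]; exact h1.1.1.comp hi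
  obtain ⟨w, w1, w2, w3⟩ := N.perturb hR he _ a hz (fun o => match o with | none => X1 | some none => X2 | some (some _) => univ) (by
    rintro (_ | _ | i) F hF hn
    · exact hp1 F hF hn
    · exact hq1 F hF hn
    · obtain ⟨X, hX, -, hX'⟩ := G.near_set _ F hF hn
      exact ⟨X, subset_univ _, hX, hX'⟩)
  have hw : w = ext (w none) (ext (w (some none)) fun i => w (some (some i))) := by
    funext i
    rcases i with _ | _ | i <;> rfl
  refine ⟨fun i => w (some (some i)), w none, w (some none), w1 none, w1 (some none), ?_, ?_⟩
  · rw [← hw]; exact hc.trans w2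
  · rw [← hw]
    have : ext (e (w none)) (ext (e (w (some none))) fun i => e (w (some (some i)))) = fun i => e (w i) := by
      funext i
      rcases i with _ | _ | i <;> rfl
    rw [this]; exact w3

def o3 : Option I → Option (Option (Option I)) := fun o => o.elim none fun i => some (some (some i))
def o2 : Option I → Option (Option I) := fun o => o.elim none fun i => some (some i)
theorem ext_o3 (a p q : L) (w : I → L) : (fun o => ext a (ext p (ext q w)) (o3 o)) = ext a w := by
  funext o; rcases o with _ | i <;> rfl
theorem ext_o2 (p q : L) (w : I → L) : (fun o => ext p (ext q w) (o2 o)) = ext p w := by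
  funext o; rcases o with _ | i <;> rfl

theorem NS.violA (N : NS C Γ Δ h g) (hR : NonRR C Γ) {e : L → L} (he : IsHom Γ Γ e) {a : L} {X1 X2 : Set L} (b1 : Big C X1) (b2 : Big C X2)
    (hv : ∀ p ∈ X1, ∀ q ∈ X2, C q a p ∧ ¬ C (e q) (e p) (e a)) : TopFree C Δ h := by
  intro I _ s c r hs hc hr
  have G := N.G
  obtain ⟨P, P1, P2, P3⟩ := G.near_set c (range s) (toFinite _) (by rintro ⟨i, hi⟩; exact hc i hi)
  obtain ⟨p0, hp0⟩ := G.big_nonempty P1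
  have hpc : p0 ≠ c := fun k => P2 (k ▸ hp0)
  obtain ⟨q0, hq0⟩ := G.top_point (range s ∪ {c, p0}) (toFinite _)
  have hq : ∀ x ∈ range s ∪ {c, p0}, x ≠ q0 := fun x hx => (G.ne (hq0 x hx x hx)).1
  have hps : ∀ i, s i ≠ p0 := fun i k => (G.ne (P3 p0 hp0 (s i) ⟨i, rfl⟩)).1 k.symm
  have hi : Function.Injective (ext c (ext p0 (ext q0 s))) := by
    refine ext_inj (ext_inj (ext_inj hs fun i => hq _ (.inl ⟨i, rfl⟩)) ?_) ?_
    · rintro (_ | i)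
      · exact (hq p0 (by simp)).symm
      · exact hps i
    · rintro (_ | _ | i)
      · exact hpc
      · exact (hq c (by simp)).symm
      · exact hc i
  obtain ⟨w, p, q, hp, hq', k1, k2⟩ := N.viol hR he b1 b2 s p0 q0 c hi (by
    intro p hp q hq'
    have hC := hv p hp q hq'
    have hap : a ≠ p := by
      rintro rfl
      exact hC.2 (G.rfl' fun k => (G.ne hC.1).1 (N.inj he k))
    have := CIso.triple G (hq0 c (by simp) p0 (by simp)) hpc.symm hC.1 hap
    have := this.comap ![1, 2, 0]
    convert this using 1 <;> · funext i; fin_cases i <;> rfl)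
  have k3 := k1.comap o3
  rw [ext_o3, ext_o3] at k3
  refine (N.eqv_iso k3).trans ((N.eqv_hom he _).trans (N.eqv_iso ?_))
  have e1 : (fun i => e (ext a w i)) = ext (e a) fun i => e (w i) := by
    funext o; rcases o with _ | i <;> rfl
  rw [e1]
  have k4 : CIso C (fun i => e (w i)) s := by
    have a1 := k1.comap (fun i => some (some (some i)))
    have a2 := k2.comap (fun i => some (some i))
    exact (a1.trans a2).symm
  refine ext_top G k4 ?_ hr
  have hin : ∀ i, C (e q) (e (w i)) (e p) := by
    intro i
    have a1 := (k1.2 (some (some none)) (some (some (some i))) (some none)).1 (hq0 (s i) (by simp) p0 (by simp))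
    exact (k2.2 (some none) (some (some i)) none).1 a1
  intro i j
  exact G.out (hin i) (hin j) (fun k => (hv p hp q hq').2 (G.symm k))

theorem NS.violB (N : NS C Γ Δ h g) (hR : NonRR C Γ) {e : L → L} (he : IsHom Γ Γ e) {a : L} {X1 X2 : Set L} (b1 : Big C X1) (b2 : Big C X2)
    (hv : ∀ p ∈ X1, ∀ q ∈ X2, C a p q ∧ p ≠ q ∧ C (e q) (e p) (e a)) : TopFree C Δ h := by
  intro I _ s c r hs hc hr
  have G := N.G
  obtain ⟨P, P1, P2, P3⟩ := G.near_set c (range s) (toFinite _) (by rintro ⟨i, hi⟩; exact hc i hi)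
  obtain ⟨q0, hq0⟩ := G.big_nonempty P1
  have hpc : q0 ≠ c := fun k => P2 (k ▸ hq0)
  obtain ⟨r0, hr0⟩ := G.top_point (range s ∪ {c, q0}) (toFinite _)
  have hq : ∀ x ∈ range s ∪ {c, q0}, x ≠ r0 := fun x hx => (G.ne (hr0 x hx x hx)).1
  have hps : ∀ i, s i ≠ q0 := fun i k => (G.ne (P3 q0 hq0 (s i) ⟨i, rfl⟩)).1 k.symm
  have hi : Function.Injective (ext r0 (ext c (ext q0 s))) := by
    refine ext_inj (ext_inj (ext_inj hs hps) ?_) ?_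
    · rintro (_ | i)
      · exact hpc
      · exact hc i
    · rintro (_ | _ | i)
      · exact hq c (by simp)
      · exact hq q0 (by simp)
      · exact hq _ (.inl ⟨i, rfl⟩)
  obtain ⟨w, p, q, hp, hq', k1, k2⟩ := N.viol hR he b1 b2 s c q0 r0 hi (by
    intro p hp q hq'
    have hC := hv p hp q hq'
    exact CIso.triple G (hr0 c (by simp) q0 (by simp)) hpc.symm hC.1 hC.2.1)
  have k3 := k1.comap o3
  rw [ext_o3, ext_o3] at k3
  have k0 : CIso C (ext r s) (ext r0 s) := ext_top G (CIso.refl s) hr fun i j => hr0 _ (by simp) _ (by simp)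
  refine Eqv.symm (((N.eqv_iso (k0.trans k3)).trans (N.eqv_hom he _)).trans (N.eqv_iso ?_))
  have e1 : (fun i => e (ext a w i)) = ext (e a) fun i => e (w i) := by
    funext o; rcases o with _ | i <;> rfl
  rw [e1]
  have k4 : CIso C (ext (e p) (fun i => e (w i))) (ext c s) := by
    have a1 := k1.comap (fun o : Option I => some (o2 o))
    have a2 := k2.comap o2
    have e1 : (fun o : Option I => ext r0 (ext c (ext q0 s)) (some (o2 o))) = ext c s := ext_o2 c q0 s
    have e2 : (fun o : Option I => ext a (ext p (ext q w)) (some (o2 o))) = ext p w := ext_o2 p q w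
    rw [e1, e2] at a1
    rw [ext_o2, ext_o2] at a2
    exact (a1.trans a2).symm
  refine CIso.trans (CIso.symm (near_iso G ?_)) k4
  have hinj : Function.Injective (ext (e p) (fun i => e (w i))) := by
    have := ext_inj hs hc
    intro i j hij
    exact this ((k4.1 i j).1 hij)
  rintro (_ | i) (_ | j) hij
  · exact absurd rfl hij
  · have a1 := (k1.2 (some (some (some j))) (some none) (some (some none))).1 (G.symm (P3 q0 hq0 (s j) ⟨j, rfl⟩))
    have a2 : C (e (w j)) (e p) (e q) := (k2.2 (some (some j)) none (some none)).1 a1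
    show C (e (w j)) (e a) (e p)
    rcases G.tr (G.symm a2) (e a) with k | k
    · exact absurd (G.symm k) (G.asym (hv p hp q hq').2.2)
    · exact k
  · exact G.rfl' (hinj.ne hij)
  · exact G.rfl' (hinj.ne hij)

theorem NS.nonRR (N : NS C Γ Δ h g) (hR : NonRR C Γ) : HT Δ ∨ ∀ e, IsHom Γ Γ e → ∀ x y z, C z x y → C (e z) (e x) (e y) := by
  have G := N.G
  by_cases hT : TopFree C Δ h
  · exact .inl (N.ht_top hT)
  right
  have ims : ∀ {e : L → L} {a : L}, e '' {a} = {e a} := fun {e a} => image_singleton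
  have vA : ∀ e, IsHom Γ Γ e → ∀ a X1 X2, Big C X1 → Big C X2 → Sep C {a} X1 → Sep C {a} X2 → Sep C X1 X2 →
      Sep C {e a} (e '' X1) → Sep C {e a} (e '' X2) → Sep C (e '' X1) (e '' X2) → ∀ p ∈ X1, ∀ q ∈ X2, C q a p → C (e q) (e a) (e p) := by
    intro e he a X1 X2 b1 b2 s1 s2 s3 t1 t2 t3 p hp q hq hC
    by_contra hn
    refine hT (N.violA hR he b1 b2 (a := a) fun p' hp' q' hq' => ⟨?_, fun k => ?_⟩)
    · exact Sep3 G s1 s2 s3 rfl hp hq rfl hp' hq' hC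
    · exact hn (Sep3 G t1 t2 t3 rfl (mem_image_of_mem e hp') (mem_image_of_mem e hq') rfl (mem_image_of_mem e hp) (mem_image_of_mem e hq) (G.symm k))
  have vB : ∀ e, IsHom Γ Γ e → ∀ a X1 X2, Big C X1 → Big C X2 → Sep C {a} X1 → Sep C {a} X2 → Sep C X1 X2 →
      Sep C {e a} (e '' X1) → Sep C {e a} (e '' X2) → Sep C (e '' X1) (e '' X2) → ∀ p ∈ X1, ∀ q ∈ X2, C a p q → C (e a) (e p) (e q) := by
    intro e he a X1 X2 b1 b2 s1 s2 s3 t1 t2 t3 p hp q hq hC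
    by_contra hn
    have n1 := G.ne (t1.1 _ rfl _ rfl _ (mem_image_of_mem e hp))
    have n2 := G.ne (t2.1 _ rfl _ rfl _ (mem_image_of_mem e hq))
    have n3 := G.ne (t3.1 _ (mem_image_of_mem e hp) _ (mem_image_of_mem e hp) _ (mem_image_of_mem e hq))
    rcases G.bin n3.1 n1.1.symm n2.1.symm with k | k | k
    · exact hn k
    · refine hT (N.violB hR he b1 b2 (a := a) fun p' hp' q' hq' => ⟨?_, G.Sep_ne s3 hp' hq', ?_⟩)
      · exact Sep3 G s3 s1.symm s2.symm hp hq rfl hp' hq' rfl hC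
      · exact Sep3 G t1.symm t3 t2 (mem_image_of_mem e hp) rfl (mem_image_of_mem e hq) (mem_image_of_mem e hp') rfl (mem_image_of_mem e hq') k
    · refine hT (N.violB hR he b2 b1 (a := a) fun q' hq' p' hp' => ⟨?_, (G.Sep_ne s3 hp' hq').symm, ?_⟩)
      · exact G.symm (Sep3 G s3 s1.symm s2.symm hp hq rfl hp' hq' rfl hC)
      · exact Sep3 G t2.symm t3.symm t1 (mem_image_of_mem e hq) rfl (mem_image_of_mem e hp) (mem_image_of_mem e hq') rfl (mem_image_of_mem e hp') k
  intro e he a b c hC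
  by_cases hab : a = b
  · subst hab; exact G.rfl' ((N.inj he).ne (G.ne hC).1)
  have hne := G.ne hC
  obtain ⟨Xa, a1, -, a3⟩ := G.near_set a {b, c} (toFinite _) (by simp [hab, hne.1])
  obtain ⟨Xb, b1, -, b3⟩ := G.near_set b {a, c} (toFinite _) (by simp [Ne.symm hab, hne.2])
  obtain ⟨Xc, c1, -, c3⟩ := G.near_set c {a, b} (toFinite _) (by simp [hne.1.symm, hne.2.symm])
  obtain ⟨X, x1, x2, x3, x4⟩ := N.shrink he {a, b, c} (toFinite _) ![Xa, Xb, Xc] (by intro i; fin_cases i <;> assumption)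
  choose x hx using fun i => G.big_nonempty (x2 i)
  have na : C b (x 0) a ∧ C c (x 0) a := ⟨a3 _ (x1 0 (hx 0)) b (by simp), a3 _ (x1 0 (hx 0)) c (by simp)⟩
  have nb : C a (x 1) b ∧ C c (x 1) b := ⟨b3 _ (x1 1 (hx 1)) a (by simp), b3 _ (x1 1 (hx 1)) c (by simp)⟩
  have nc : C a (x 2) c ∧ C b (x 2) c := ⟨c3 _ (x1 2 (hx 2)) a (by simp), c3 _ (x1 2 (hx 2)) b (by simp)⟩
  have A : ∀ p i j, p ∈ ({a, b, c} : Set L) → i ≠ j → C (x j) p (x i) → C (e (x j)) (e p) (e (x i)) := fun p i j hp hij hC =>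
    vA e he p (X i) (X j) (x2 i) (x2 j) (x4 p hp i).1 (x4 p hp j).1 (x3 i j hij).1 (x4 p hp i).2 (x4 p hp j).2 (x3 i j hij).2 _ (hx i) _ (hx j) hC
  have B : C (e c) (e (x 0)) (e (x 1)) := vB e he c (X 0) (X 1) (x2 0) (x2 1) (x4 c (by simp) 0).1 (x4 c (by simp) 1).1 (x3 0 1 (by simp)).1
    (x4 c (by simp) 0).2 (x4 c (by simp) 1).2 (x3 0 1 (by simp)).2 _ (hx 0) _ (hx 1) (G.join na.2 (G.join hC (G.symm nb.2)))
  have p1 := A a 0 2 (by simp) (by simp) (G.cross (G.symm na.2) (G.symm nc.1))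
  have p2 := A b 1 2 (by simp) (by simp) (G.cross (G.symm nb.2) (G.symm nc.2))
  have p3 := A c 2 0 (by simp) (by simp) (G.cross (G.symm nc.1) (G.symm na.2))
  have p4 := A c 2 1 (by simp) (by simp) (G.cross (G.symm nc.2) (G.symm nb.2))
  have q1 : C (e c) (e (x 0)) (e a) := G.cross (G.symm p1) (G.symm p3)
  have q2 : C (e c) (e (x 1)) (e b) := G.cross (G.symm p2) (G.symm p4)
  exact G.join (G.symm q1) (G.join B q2)

end DC

namespace DC
open Set Filter

variable {σ : Type} {ar : σ → ℕ} {L E : Type} {C : L → L → L → Prop} {Γ : RelStruct σ ar L} {Δ : RelStruct σ ar E} {I J α : Type} {h : L → E} {g : E → L}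

/-! quartets -/
theorem Q_swap (G : CG C) {a b c d : L} (H : QRel C a b c d) : QRel C b a c d := by
  rcases H with ⟨h1, h2⟩ | ⟨h1, h2⟩
  · exact .inl ⟨G.symm h1, G.symm h2⟩
  · exact .inr ⟨h2, h1⟩
theorem Q_flip {a b c d : L} (H : QRel C a b c d) : QRel C c d a b := by
  rcases H with ⟨h1, h2⟩ | ⟨h1, h2⟩
  · exact .inr ⟨h1, h2⟩
  · exact .inl ⟨h1, h2⟩
theorem Q_swap2 (G : CG C) {a b c d : L} (H : QRel C a b c d) : QRel C a b d c := Q_flip (Q_swap G (Q_flip H))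
theorem Q_ne (G : CG C) {a b c d : L} (H : QRel C a b c d) : a ≠ c ∧ a ≠ d ∧ b ≠ c ∧ b ≠ d := by
  rcases H with ⟨h1, h2⟩ | ⟨h1, h2⟩
  · exact ⟨(G.ne h1).1, (G.ne h2).1, (G.ne h1).2, (G.ne h2).2⟩
  · exact ⟨(G.ne h1).1.symm, (G.ne h1).2.symm, (G.ne h2).1.symm, (G.ne h2).2.symm⟩
theorem Q_not (G : CG C) {a b c d : L} (H : QRel C a b c d) : ¬ QRel C a c b d := by
  rintro (⟨h1, h2⟩ | ⟨h1, h2⟩) <;> rcases H with ⟨h3, h4⟩ | ⟨h3, h4⟩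
  · exact G.asym h3 h1
  · exact G.asym (G.symm h2) h3
  · exact G.asym (G.symm h4) h1
  · exact G.asym (G.symm h4) (G.symm h2)
theorem Q_bin (G : CG C) {a b c d : L} (h1 : a ≠ b) (h2 : a ≠ c) (h3 : a ≠ d) (h4 : b ≠ c) (h5 : b ≠ d) (h6 : c ≠ d) :
    QRel C a b c d ∨ QRel C a c b d ∨ QRel C a d b c := by
  unfold QRel
  have t := @CG.tr _ _ G
  have s := @CG.symm _ _ G
  have as := @CG.asym _ _ G
  rcases G.bin h1 h2 h4 with k | k | k
  · rcases t k d with k' | k'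
    · exact .inl (.inl ⟨k, k'⟩)
    · rcases t (s k) d with k2 | k2
      · exact .inl (.inl ⟨k, s k2⟩)
      rcases G.bin h1 h3 h5 with k3 | k3 | k3
      · exact .inl (.inl ⟨k, k3⟩)
      · exact .inr (.inr (.inl ⟨k3, s k2 |> fun h => s h |> s⟩))
      · exact .inr (.inl (.inr ⟨k3, s k'⟩))
  · rcases G.bin h2 h3 h6 with k3 | k3 | k3
    · exact .inr (.inl (.inl ⟨k, k3⟩))
    · refine .inr (.inr (.inl ⟨?_, k3⟩))
      exact G.join (G.rfl' h1) (by rcases t (s k) d with k4 | k4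
                                   · exact absurd (s k4) (fun k => as k3 k |> False.elim)
                                   · exact s k4)
    · refine .inl (.inr ⟨k3, ?_⟩)
      rcases t k d with k4 | k4
      · exact absurd k4 (fun k4 => as (s k4) k3 |> False.elim)
      · exact s k4
  · rcases G.bin h4 h5 h6 with k3 | k3 | k3
    · exact .inr (.inr (.inr ⟨k, k3⟩))
    · refine .inr (.inl (.inr ⟨?_, k3⟩))
      rcases t (s k) d with k4 | k4
      · exact absurd k4 (fun k4 => as k3 (s k4) |> False.elim)
      · exact s k4
    · refine .inl (.inr ⟨?_, k3⟩)
      rcases t k d with k4 | k4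
      · exact absurd k4 (fun k4 => as (s k4) (k3) |> False.elim)
      · exact s k4

def QI (C : L → L → L → Prop) (A : Set α) (x y : α → L) : Prop :=
  ∀ a ∈ A, ∀ b ∈ A, ∀ c ∈ A, ∀ d ∈ A, QRel C (x a) (x b) (x c) (x d) ↔ QRel C (y a) (y b) (y c) (y d)

theorem QI.symm {A : Set α} {x y : α → L} (H : QI C A x y) : QI C A y x := fun a ha b hb c hc d hd => (H a ha b hb c hc d hd).symm
theorem QI.trans {A : Set α} {x y z : α → L} (H : QI C A x y) (H' : QI C A y z) : QI C A x z :=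
  fun a ha b hb c hc d hd => (H a ha b hb c hc d hd).trans (H' a ha b hb c hc d hd)
theorem QI.of_iso {A : Set α} {x y : α → L} (H : CIso C (fun a : A => x a) (fun a : A => y a)) : QI C A x y := by
  intro a ha b hb c hc d hd
  have := fun (a b c : A) => H.2 a b c
  have k1 := this ⟨c, hc⟩ ⟨a, ha⟩ ⟨b, hb⟩
  have k2 := this ⟨d, hd⟩ ⟨a, ha⟩ ⟨b, hb⟩
  have k3 := this ⟨a, ha⟩ ⟨c, hc⟩ ⟨d, hd⟩
  have k4 := this ⟨b, hb⟩ ⟨c, hc⟩ ⟨d, hd⟩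
  simp only [QRel]
  simp only at k1 k2 k3 k4
  rw [k1, k2, k3, k4]

theorem QBlock (G : CG C) {κ : Type} (β : α → κ) {A : Set α} {x y : α → L}
    (hx : ∀ a ∈ A, ∀ b ∈ A, ∀ c ∈ A, β a = β b → β a ≠ β c → C (x c) (x a) (x b))
    (hy : ∀ a ∈ A, ∀ b ∈ A, ∀ c ∈ A, β a = β b → β a ≠ β c → C (y c) (y a) (y b))
    (hin : ∀ a ∈ A, ∀ b ∈ A, ∀ c ∈ A, β a = β b → β a = β c → (C (x c) (x a) (x b) ↔ C (y c) (y a) (y b)))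
    (h4 : ∀ a ∈ A, ∀ b ∈ A, ∀ c ∈ A, ∀ d ∈ A, β a ≠ β b → β a ≠ β c → β a ≠ β d → β b ≠ β c → β b ≠ β d → β c ≠ β d →
      (QRel C (x a) (x b) (x c) (x d) ↔ QRel C (y a) (y b) (y c) (y d))) : QI C A x y := by
  intro a ha b hb c hc d hd
  have F : ∀ (x : α → L), (∀ a ∈ A, ∀ b ∈ A, ∀ c ∈ A, β a = β b → β a ≠ β c → C (x c) (x a) (x b)) →
      ∀ a ∈ A, ∀ b ∈ A, ∀ c ∈ A, β a = β c → β a ≠ β b → ¬ C (x c) (x a) (x b) ∧ ¬ C (x c) (x b) (x a) := by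
    intro x hx a ha b hb c hc h1 h2
    have k := hx a ha c hc b hb h1 h2
    exact ⟨fun k' => G.asym k k', fun k' => G.asym k (G.symm k')⟩
  have K : ∀ a ∈ A, ∀ b ∈ A, ∀ c ∈ A, (β a = β b ∨ β a = β c ∨ β b = β c) → (C (x c) (x a) (x b) ↔ C (y c) (y a) (y b)) := by
    intro a ha b hb c hc H
    by_cases h1 : β a = β b
    · by_cases h2 : β a = β c
      · exact hin a ha b hb c hc h1 h2
      · exact iff_of_true (hx a ha b hb c hc h1 h2) (hy a ha b hb c hc h1 h2)
    · by_cases h2 : β a = β c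
      · exact iff_of_false (F x hx a ha b hb c hc h2 h1).1 (F y hy a ha b hb c hc h2 h1).1
      · have h3 : β b = β c := by rcases H with h | h | h <;> [exact absurd h h1; exact absurd h h2; exact h]
        exact iff_of_false (F x hx b hb a ha c hc h3 (Ne.symm h1)).2 (F y hy b hb a ha c hc h3 (Ne.symm h1)).2
  have K1 := K a ha b hb c hc
  have K2 := K a ha b hb d hd
  have K3 := K c hc d hd a ha
  have K4 := K c hc d hd b hb
  by_cases hab : β a = β b
  · by_cases hac : β a = β c
    · simp only [QRel]; rw [K1 (by simp [hab]), K2 (by simp [hab]), K3 (by simp [hac]), K4 (by simp [← hac, hab])]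
    by_cases had : β a = β d
    · simp only [QRel]; rw [K1 (by simp [hab]), K2 (by simp [hab]), K3 (by simp [had]), K4 (by simp [← had, hab])]
    exact iff_of_true (.inl ⟨hx _ ha _ hb _ hc hab hac, hx _ ha _ hb _ hd hab had⟩) (.inl ⟨hy _ ha _ hb _ hc hab hac, hy _ ha _ hb _ hd hab had⟩)
  by_cases hcd : β c = β d
  · by_cases hac : β a = β c
    · simp only [QRel]; rw [K1 (by simp [hac]), K2 (by simp [hac, hcd]), K3 (by simp [hcd]), K4 (by simp [hcd])]
    by_cases hbc : β b = β c
    · simp only [QRel]; rw [K1 (by simp [hbc]), K2 (by simp [hbc, hcd]), K3 (by simp [hcd]), K4 (by simp [hcd])]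
    exact iff_of_true (.inr ⟨hx _ hc _ hd _ ha hcd (Ne.symm hac), hx _ hc _ hd _ hb hcd (Ne.symm hbc)⟩) (.inr ⟨hy _ hc _ hd _ ha hcd (Ne.symm hac), hy _ hc _ hd _ hb hcd (Ne.symm hbc)⟩)
  have FF : ∀ (x : α → L), (∀ a ∈ A, ∀ b ∈ A, ∀ c ∈ A, β a = β b → β a ≠ β c → C (x c) (x a) (x b)) →
      ∀ a ∈ A, ∀ b ∈ A, ∀ c ∈ A, ∀ d ∈ A, β a ≠ β b → β c ≠ β d → β a = β c → ¬ QRel C (x a) (x b) (x c) (x d) := by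
    rintro x hx a ha b hb c hc d hd h1 h2 h3 (⟨k, -⟩ | ⟨k, -⟩)
    · exact (F x hx a ha b hb c hc h3 h1).1 k
    · exact (F x hx c hc d hd a ha h3.symm h2).1 k
  by_cases hac : β a = β c
  · exact iff_of_false (FF x hx a ha b hb c hc d hd hab hcd hac) (FF y hy a ha b hb c hc d hd hab hcd hac)
  by_cases had : β a = β d
  · exact iff_of_false (fun H => FF x hx a ha b hb d hd c hc hab (Ne.symm hcd) had (Q_swap2 G H)) (fun H => FF y hy a ha b hb d hd c hc hab (Ne.symm hcd) had (Q_swap2 G H))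
  by_cases hbc : β b = β c
  · exact iff_of_false (fun H => FF x hx b hb a ha c hc d hd (Ne.symm hab) hcd hbc (Q_swap G H)) (fun H => FF y hy b hb a ha c hc d hd (Ne.symm hab) hcd hbc (Q_swap G H))
  by_cases hbd : β b = β d
  · exact iff_of_false (fun H => FF x hx b hb a ha d hd c hc (Ne.symm hab) (Ne.symm hcd) hbd (Q_swap G (Q_swap2 G H))) (fun H => FF y hy b hb a ha d hd c hc (Ne.symm hab) (Ne.symm hcd) hbd (Q_swap G (Q_swap2 G H)))
  exact h4 a ha b hb c hc d hd hab hac had hbc hbd hcd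

/-! tree moves -/
structure GoodP (C : L → L → L → Prop) (P : Set α → (α → L) → (α → L) → Prop) : Prop where
  iso : ∀ (A : Set α) x y, A.Finite → CIso C (fun a : A => x a) (fun a : A => y a) → P A x y
  trans : ∀ A x y z, P A x y → P A y z → P A x z

def EqA (Δ : RelStruct σ ar E) (h : L → E) (A : Set α) (x y : α → L) : Prop := Eqv Δ h (fun a : A => x a) (fun a : A => y a)

theorem goodE (N : NS C Γ Δ h g) : GoodP (α := α) C (EqA Δ h) :=
  ⟨fun A x y hA H => by have := hA.to_subtype; exact N.eqv_iso H, fun A x y z => Eqv.trans⟩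
theorem goodQ : GoodP (α := α) C (QI C) := ⟨fun A x y _ H => QI.of_iso H, fun A x y z => QI.trans⟩
theorem goodEQ (N : NS C Γ Δ h g) : GoodP (α := α) C (fun A x y => EqA Δ h A x y ∧ QI C A x y) :=
  ⟨fun A x y hA H => ⟨(goodE N).iso A x y hA H, goodQ.iso A x y hA H⟩, fun A x y z H H' => ⟨(goodE N).trans _ _ _ _ H.1 H'.1, H.2.trans H'.2⟩⟩

def TR (C : L → L → L → Prop) (P : Set α → (α → L) → (α → L) → Prop) (t t' : BT α) : Prop :=
  t.word.Perm t'.word ∧ ∀ x y, Copy C t x → Copy C t' y → P t.lab x y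

theorem lab_perm {t t' : BT α} (H : t.word.Perm t'.word) : t.lab = t'.lab := by
  ext a; exact H.mem_iff

theorem NS.cp (N : NS C Γ Δ h g) {t : BT α} (H : t.word.Nodup) : ∃ x, Copy C t x := by
  obtain ⟨x, h1, -⟩ := N.sepCopy idHom t H N.G.big_univ
  exact ⟨x, h1⟩

theorem TR.trans (N : NS C Γ Δ h g) {P : Set α → (α → L) → (α → L) → Prop} (hP : GoodP C P) {t t' t'' : BT α} (H : TR C P t t') (H' : TR C P t' t'') : TR C P t t'' := by
  refine ⟨H.1.trans H'.1, fun x y hx hy => ?_⟩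
  obtain ⟨z, hz⟩ := N.cp (H.1.nodup_iff.1 (hx.nodup N.G))
  refine hP.trans _ _ _ _ (H.2 x z hx hz) ?_
  rw [lab_perm H.1]
  exact H'.2 z y hz hy

theorem TR.of_copy (N : NS C Γ Δ h g) {P : Set α → (α → L) → (α → L) → Prop} (hP : GoodP C P) {t t' : BT α} (H : t.word.Perm t'.word)
    (H' : ∀ x, Copy C t x → Copy C t' x) : TR C P t t' := by
  refine ⟨H, fun x y hx hy => hP.iso _ _ _ t.lab_fin ?_⟩
  rw [lab_perm H]
  exact (H' x hx).iso N.G hy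

theorem copy_comm {s t : BT α} {x : α → L} (H : Copy C (.node s t) x) : Copy C (.node t s) x := ⟨H.2.1, H.1, H.2.2.symm⟩

theorem TR.comm (N : NS C Γ Δ h g) {P : Set α → (α → L) → (α → L) → Prop} (hP : GoodP C P) (s t : BT α) : TR C P (.node s t) (.node t s) :=
  TR.of_copy N hP List.perm_append_comm fun _ => copy_comm
theorem TR.commL (N : NS C Γ Δ h g) {P : Set α → (α → L) → (α → L) → Prop} (hP : GoodP C P) (s t u : BT α) : TR C P (.node (.node s t) u) (.node (.node t s) u) :=
  TR.of_copy N hP (List.perm_append_comm.append_right _) fun x hx => ⟨copy_comm hx.1, hx.2.1, by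
    have := hx.2.2
    rwa [BT.lab_node, union_comm, ← BT.lab_node] at this⟩

def RRP (C : L → L → L → Prop) (P : Set α → (α → L) → (α → L) → Prop) : Prop :=
  ∀ t1 t2 t3 : BT α, TR C P (.node (.node t1 t2) t3) (.node t1 (.node t2 t3))

theorem reroot0 (N : NS C Γ Δ h g) {P : Set α → (α → L) → (α → L) → Prop} (hP : GoodP C P) (hR : RRP C P) {a : α} (t : BT α) (ha : a ∈ t.lab) :
    ∀ u, ∃ v, TR C P (.node t u) (.node (.leaf a) v) := by
  induction t with
  | leaf b =>
    rw [BT.lab_leaf] at ha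
    obtain rfl : a = b := ha
    exact fun u => ⟨u, TR.of_copy N hP (.refl _) fun _ h => h⟩
  | node s t h1 h2 =>
    intro u
    rw [BT.lab_node] at ha
    rcases ha with ha | ha
    · obtain ⟨v, hv⟩ := h1 ha (.node t u)
      exact ⟨v, (hR s t u).trans N hP hv⟩
    · obtain ⟨v, hv⟩ := h2 ha (.node s u)
      exact ⟨v, (TR.commL N hP s t u).trans N hP ((hR t s u).trans N hP hv)⟩

theorem reroot1 (N : NS C Γ Δ h g) {P : Set α → (α → L) → (α → L) → Prop} (hP : GoodP C P) (hR : RRP C P) {a : α} (t : BT α) (ha : a ∈ t.lab) :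
    t = .leaf a ∨ ∃ v, TR C P t (.node (.leaf a) v) := by
  cases t with
  | leaf b =>
    rw [BT.lab_leaf] at ha
    obtain rfl : a = b := ha
    exact .inl rfl
  | node s t =>
    right
    rw [BT.lab_node] at ha
    rcases ha with ha | ha
    · exact reroot0 N hP hR s ha t
    · obtain ⟨v, hv⟩ := reroot0 N hP hR t ha s
      exact ⟨v, (TR.comm N hP s t).trans N hP hv⟩

theorem reroot (N : NS C Γ Δ h g) {P : Set α → (α → L) → (α → L) → Prop} (hP : GoodP C P) (hR : RRP C P) {A : Set α} (hA : A.Finite) {q : α} (hq : q ∈ A)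
    (x : α → L) (hx : InjOn x A) : ∃ y, P A x y ∧ InjOn y A ∧ ∀ i ∈ A, ∀ j ∈ A, i ≠ q → j ≠ q → C (y q) (y i) (y j) := by
  obtain ⟨t, h1, rfl⟩ := exists_copy N.G x A hA ⟨q, hq⟩ hx
  rcases reroot1 N hP hR t hq with rfl | ⟨v, hv⟩
  · refine ⟨x, hP.iso _ _ _ hA (CIso.refl _), hx, fun i hi j hj h1 => ?_⟩
    rw [BT.lab_leaf] at hi
    exact absurd hi h1
  · obtain ⟨y, hy⟩ := N.cp (hv.1.nodup_iff.1 (h1.nodup N.G))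
    refine ⟨y, hv.2 x y h1 hy, ?_, ?_⟩
    · rw [lab_perm hv.1]; exact hy.inj N.G
    · rw [lab_perm hv.1, BT.lab_node, BT.lab_leaf]
      intro i hi j hj h1 h2
      exact hy.2.2.2 _ ⟨q, by rw [BT.lab_leaf]; rfl, rfl⟩ _ ⟨i, hi.resolve_left h1, rfl⟩ _ ⟨j, hj.resolve_left h2, rfl⟩

end DC

namespace DC
open Set Filter

variable {σ : Type} {ar : σ → ℕ} {L E : Type} {C : L → L → L → Prop} {Γ : RelStruct σ ar L} {Δ : RelStruct σ ar E} {I J α : Type} {h : L → E} {g : E → L}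

theorem QBlockT (G : CG C) {κ : Type} [Inhabited κ] (T : κ → BT α) {x y : α → L}
    (cx : ∀ k, Copy C (T k) x) (cy : ∀ k, Copy C (T k) y)
    (sx : ∀ k l, k ≠ l → Sep C (x '' (T k).lab) (x '' (T l).lab)) (sy : ∀ k l, k ≠ l → Sep C (y '' (T k).lab) (y '' (T l).lab))
    (h4 : ∀ k1 k2 k3 k4, k1 ≠ k2 → k1 ≠ k3 → k1 ≠ k4 → k2 ≠ k3 → k2 ≠ k4 → k3 ≠ k4 →
      ∀ a ∈ (T k1).lab, ∀ b ∈ (T k2).lab, ∀ c ∈ (T k3).lab, ∀ d ∈ (T k4).lab,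
      (QRel C (x a) (x b) (x c) (x d) ↔ QRel C (y a) (y b) (y c) (y d))) : QI C (⋃ k, (T k).lab) x y := by
  classical
  have : ∃ β : α → κ, ∀ a ∈ (⋃ k, (T k).lab), a ∈ (T (β a)).lab := by
    refine ⟨fun a => if h : ∃ k, a ∈ (T k).lab then h.choose else default, fun a ha => ?_⟩
    have h : ∃ k, a ∈ (T k).lab := by simpa using ha
    simp only [h, dif_pos]
    exact h.choose_spec
  obtain ⟨β, hβ⟩ := this
  refine QBlock G β ?_ ?_ ?_ ?_
  · intro a ha b hb c hc h1 h2
    exact (sx _ _ h2).1 _ ⟨a, hβ a ha, rfl⟩ _ ⟨b, h1 ▸ hβ b hb, rfl⟩ _ ⟨c, hβ c hc, rfl⟩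
  · intro a ha b hb c hc h1 h2
    exact (sy _ _ h2).1 _ ⟨a, hβ a ha, rfl⟩ _ ⟨b, h1 ▸ hβ b hb, rfl⟩ _ ⟨c, hβ c hc, rfl⟩
  · intro a ha b hb c hc h1 h2
    exact ⟨(cx (β a)).isoC G (cy (β a)) _ (h2 ▸ hβ c hc) _ (hβ a ha) _ (h1 ▸ hβ b hb), (cy (β a)).isoC G (cx (β a)) _ (h2 ▸ hβ c hc) _ (hβ a ha) _ (h1 ▸ hβ b hb)⟩
  · intro a ha b hb c hc d hd h1 h2 h3 h4' h5 h6
    exact h4 _ _ _ _ h1 h2 h3 h4' h5 h6 a (hβ a ha) b (hβ b hb) c (hβ c hc) d (hβ d hd)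

set_option synthInstance.maxSize 1000 in
set_option synthInstance.maxHeartbeats 200000 in
theorem f4 : ∀ k2 k3 k4 : Fin 4, (0 ≠ k2 ∧ 0 ≠ k3 ∧ 0 ≠ k4 ∧ k2 ≠ k3 ∧ k2 ≠ k4 ∧ k3 ≠ k4) → (k2 = 1 ∧ k3 = 2 ∧ k4 = 3) ∨ (k2 = 1 ∧ k3 = 3 ∧ k4 = 2) ∨ (k2 = 2 ∧ k3 = 1 ∧ k4 = 3) ∨ (k2 = 2 ∧ k3 = 3 ∧ k4 = 1) ∨
        (k2 = 3 ∧ k3 = 1 ∧ k4 = 2) ∨ (k2 = 3 ∧ k3 = 2 ∧ k4 = 1) := by decide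

theorem QBlock4 (G : CG C) (T : Fin 4 → BT α) {x y : α → L}
    (cx : ∀ k, Copy C (T k) x) (cy : ∀ k, Copy C (T k) y)
    (sx : ∀ k l, k ≠ l → Sep C (x '' (T k).lab) (x '' (T l).lab)) (sy : ∀ k l, k ≠ l → Sep C (y '' (T k).lab) (y '' (T l).lab))
    (hx : ∀ a ∈ (T 0).lab, ∀ b ∈ (T 1).lab, ∀ c ∈ (T 2).lab, ∀ d ∈ (T 3).lab, QRel C (x a) (x b) (x c) (x d))
    (hy : ∀ a ∈ (T 0).lab, ∀ b ∈ (T 1).lab, ∀ c ∈ (T 2).lab, ∀ d ∈ (T 3).lab, QRel C (y a) (y b) (y c) (y d)) :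
    QI C (⋃ k, (T k).lab) x y := by
  have key : ∀ k2 k3 k4 : Fin 4, 0 ≠ k2 → 0 ≠ k3 → 0 ≠ k4 → k2 ≠ k3 → k2 ≠ k4 → k3 ≠ k4 →
      ∀ a ∈ (T 0).lab, ∀ b ∈ (T k2).lab, ∀ c ∈ (T k3).lab, ∀ d ∈ (T k4).lab,
      (QRel C (x a) (x b) (x c) (x d) ↔ QRel C (y a) (y b) (y c) (y d)) := by
    intro k2 k3 k4 h1 h2 h3 h4 h5 h6 a ha b hb c hc d hd
    have : (k2 = 1 ∧ k3 = 2 ∧ k4 = 3) ∨ (k2 = 1 ∧ k3 = 3 ∧ k4 = 2) ∨ (k2 = 2 ∧ k3 = 1 ∧ k4 = 3) ∨ (k2 = 2 ∧ k3 = 3 ∧ k4 = 1) ∨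
        (k2 = 3 ∧ k3 = 1 ∧ k4 = 2) ∨ (k2 = 3 ∧ k3 = 2 ∧ k4 = 1) := f4 _ _ _ ⟨h1, h2, h3, h4, h5, h6⟩
    rcases this with ⟨rfl, rfl, rfl⟩ | ⟨rfl, rfl, rfl⟩ | ⟨rfl, rfl, rfl⟩ | ⟨rfl, rfl, rfl⟩ | ⟨rfl, rfl, rfl⟩ | ⟨rfl, rfl, rfl⟩
    · exact iff_of_true (hx a ha b hb c hc d hd) (hy a ha b hb c hc d hd)
    · exact iff_of_true (Q_swap2 G (hx a ha b hb d hd c hc)) (Q_swap2 G (hy a ha b hb d hd c hc))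
    · exact iff_of_false (Q_not G (hx a ha c hc b hb d hd)) (Q_not G (hy a ha c hc b hb d hd))
    · exact iff_of_false (fun k => Q_not G (hx a ha d hd b hb c hc) (Q_swap2 G k)) (fun k => Q_not G (hy a ha d hd b hb c hc) (Q_swap2 G k))
    · exact iff_of_false (Q_not G (Q_swap2 G (hx a ha c hc d hd b hb))) (Q_not G (Q_swap2 G (hy a ha c hc d hd b hb)))
    · exact iff_of_false (fun k => Q_not G (Q_swap2 G (hx a ha d hd c hc b hb)) (Q_swap2 G k)) (fun k => Q_not G (Q_swap2 G (hy a ha d hd c hc b hb)) (Q_swap2 G k))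
  have sw : ∀ a b c d : L, QRel C a b c d ↔ QRel C b a c d := fun a b c d => ⟨Q_swap G, Q_swap G⟩
  have fl : ∀ a b c d : L, QRel C a b c d ↔ QRel C c d a b := fun a b c d => ⟨Q_flip, Q_flip⟩
  refine QBlockT G T cx cy sx sy ?_
  intro k1 k2 k3 k4 h1 h2 h3 h4 h5 h6 a ha b hb c hc d hd
  have : k1 = 0 ∨ k2 = 0 ∨ k3 = 0 ∨ k4 = 0 := by
    clear * - h1 h2 h3 h4 h5 h6; decide +revert
  rcases this with rfl | rfl | rfl | rfl
  · exact key _ _ _ h1 h2 h3 h4 h5 h6 a ha b hb c hc d hd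
  · rw [sw, sw (y a)]
    exact key _ _ _ h1.symm h4 h5 h2 h3 h6 b hb a ha c hc d hd
  · rw [fl, fl (y a)]
    exact key _ _ _ h6 h2.symm h4.symm h3.symm h5.symm h1 c hc d hd a ha b hb
  · rw [fl, fl (y a), sw, sw (y c)]
    exact key _ _ _ h6.symm h3.symm h5.symm h2.symm h4.symm h1 d hd c hc a ha b hb

theorem Sep.of_union1 {X Y Z : Set L} (H : Sep C (X ∪ Y) Z) : Sep C X Z ∧ Sep C Y Z := ⟨H.mono subset_union_left subset_rfl, H.mono subset_union_right subset_rfl⟩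
theorem Sep.of_union2 {X Y Z : Set L} (H : Sep C X (Y ∪ Z)) : Sep C X Y ∧ Sep C X Z := ⟨H.mono subset_rfl subset_union_left, H.mono subset_rfl subset_union_right⟩

theorem copy_sepL {t1 t2 t3 : BT α} {x : α → L} (H : Copy C (.node (.node t1 t2) t3) x) :
    Sep C (x '' t1.lab) (x '' t3.lab) ∧ Sep C (x '' t2.lab) (x '' t3.lab) := by
  have := H.2.2
  rw [BT.lab_node, image_union] at this
  exact this.of_union1
theorem copy_sepR {t1 t2 t3 : BT α} {x : α → L} (H : Copy C (.node t1 (.node t2 t3)) x) :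
    Sep C (x '' t1.lab) (x '' t2.lab) ∧ Sep C (x '' t1.lab) (x '' t3.lab) := by
  have := H.2.2
  rw [BT.lab_node, image_union] at this
  exact this.of_union2

theorem RRQ (G : CG C) : RRP (α := α) C (QI C) := by
  intro t1 t2 t3
  refine ⟨by simp [BT.word], fun x y hx hy => ?_⟩
  have e : (BT.node (.node t1 t2) t3).lab = ⋃ k, (![t1, t2, t3] k).lab := by
    ext a
    simp [BT.lab_node, Fin.exists_fin_succ, or_assoc]
  rw [e]
  have sx := copy_sepL hx
  have sy := copy_sepR hy
  have sx' := hx.1.2.2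
  have sy' := hy.2.1.2.2
  refine QBlockT G _ ?_ ?_ ?_ ?_ ?_
  · intro k; fin_cases k <;> [exact hx.1.1; exact hx.1.2.1; exact hx.2.1]
  · intro k; fin_cases k <;> [exact hy.1; exact hy.2.1.1; exact hy.2.1.2.1]
  · intro k l hkl
    fin_cases k <;> fin_cases l <;> first | exact absurd rfl hkl | exact sx' | exact sx'.symm | exact sx.1 | exact sx.1.symm | exact sx.2 | exact sx.2.symm
  · intro k l hkl
    fin_cases k <;> fin_cases l <;> first | exact absurd rfl hkl | exact sy' | exact sy'.symm | exact sy.1 | exact sy.1.symm | exact sy.2 | exact sy.2.symm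
  · intro k1 k2 k3 k4 h1 h2 h3 h4 h5 h6
    exact absurd h6 (by clear h6; clear * - h1 h2 h3 h4 h5; decide +revert)

theorem SepU (G : CG C) {X0 X1 X2 : Set L} (h01 : Sep C X0 X1) (h02 : Sep C X0 X2) (h12 : Sep C X1 X2)
    {x0 x1 x2 : L} (a0 : x0 ∈ X0) (a1 : x1 ∈ X1) (a2 : x2 ∈ X2) (hC : C x2 x0 x1) : Sep C (X0 ∪ X1) X2 := by
  constructor
  · rintro u (hu | hu) v (hv | hv) w hw
    · exact h02.1 u hu v hv w hw
    · exact Sep3 G h01 h02 h12 a0 a1 a2 hu hv hw hC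
    · exact G.symm (Sep3 G h01 h02 h12 a0 a1 a2 hv hu hw hC)
    · exact h12.1 u hu v hv w hw
  · rintro u (hu | hu) v hv w hw
    · exact h02.2 u hu v hv w hw
    · exact h12.2 u hu v hv w hw

theorem exists_merge3 {A1 A2 A3 : Set α} (h1 : Disjoint A1 A2) (h2 : Disjoint A1 A3) (h3 : Disjoint A2 A3) (x y z : α → L) :
    ∃ w, EqOn w x A1 ∧ EqOn w y A2 ∧ EqOn w z A3 := by
  obtain ⟨u, u1, u2⟩ := exists_merge A1 A2 h1 x y
  obtain ⟨w, w1, w2⟩ := exists_merge (A1 ∪ A2) A3 (disjoint_union_left.2 ⟨h2, h3⟩) u z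
  exact ⟨w, fun a ha => (w1 (.inl ha)).trans (u1 ha), fun a ha => (w1 (.inr ha)).trans (u2 ha), w2⟩

theorem nodup_disj {s t : BT α} (H : (BT.node s t).word.Nodup) : Disjoint s.lab t.lab := by
  rw [Set.disjoint_left]
  intro a h1 h2
  exact (List.nodup_append.1 H).2.2 a h1 a h2 rfl

theorem RRE1 (N : NS C Γ Δ h g) {e : L → L} (he : IsHom Γ Γ e) {X0 X1 X2 : Set L} (b0 : Big C X0) (b1 : Big C X1) (b2 : Big C X2)
    (s01 : Sep C X0 X1) (s02 : Sep C X0 X2) (s12 : Sep C X1 X2)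
    (r01 : Sep C (e '' X0) (e '' X1)) (r02 : Sep C (e '' X0) (e '' X2)) (r12 : Sep C (e '' X1) (e '' X2))
    {x0 x1 x2 : L} (a0 : x0 ∈ X0) (a1 : x1 ∈ X1) (a2 : x2 ∈ X2) (hC : C x2 x0 x1) (hC' : C (e x0) (e x1) (e x2)) : RRP (α := α) C (EqA Δ h) := by
  have G := N.G
  intro t1 t2 t3
  refine ⟨by simp [BT.word], fun x y hx hy => ?_⟩
  have n := hx.nodup G
  have n12 := (List.nodup_append.1 n).1
  have d12 := nodup_disj n12
  have d3 := nodup_disj n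
  rw [BT.lab_node, disjoint_union_left] at d3
  obtain ⟨u1, p1, q1, m1⟩ := N.sepCopy he t1 (List.nodup_append.1 n12).1 b0
  obtain ⟨u2, p2, q2, m2⟩ := N.sepCopy he t2 (List.nodup_append.1 n12).2.1 b1
  obtain ⟨u3, p3, q3, m3⟩ := N.sepCopy he t3 (List.nodup_append.1 n).2.1 b2
  obtain ⟨z, z1, z2, z3⟩ := exists_merge3 d12 d3.1 d3.2 u1 u2 u3
  have i1 : z '' t1.lab ⊆ X0 := by rintro _ ⟨a, ha, rfl⟩; rw [z1 ha]; exact m1 a ha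
  have i2 : z '' t2.lab ⊆ X1 := by rintro _ ⟨a, ha, rfl⟩; rw [z2 ha]; exact m2 a ha
  have i3 : z '' t3.lab ⊆ X2 := by rintro _ ⟨a, ha, rfl⟩; rw [z3 ha]; exact m3 a ha
  have ei : ∀ s : Set α, (fun a => e (z a)) '' s = e '' (z '' s) := fun s => by rw [image_image]
  have c1 : Copy C (.node (.node t1 t2) t3) z := by
    refine ⟨⟨p1.congr z1.symm, p2.congr z2.symm, s01.mono i1 i2⟩, p3.congr z3.symm, ?_⟩
    rw [BT.lab_node, image_union]
    exact (SepU G s01 s02 s12 a0 a1 a2 hC).mono (union_subset_union i1 i2) i3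
  have c2 : Copy C (.node t1 (.node t2 t3)) (fun a => e (z a)) := by
    refine ⟨q1.congr fun a ha => by simp [z1 ha], ⟨q2.congr fun a ha => by simp [z2 ha], q3.congr fun a ha => by simp [z3 ha], ?_⟩, ?_⟩
    · rw [ei, ei]; exact r12.mono (image_mono i2) (image_mono i3)
    · rw [BT.lab_node, image_union, ei, ei, ei]
      exact (SepU G r12 r01.symm r02.symm (mem_image_of_mem e a1) (mem_image_of_mem e a2) (mem_image_of_mem e a0) hC').symm.mono (image_mono i1) (union_subset_union (image_mono i2) (image_mono i3))
  have hf := (BT.node (.node t1 t2) t3).lab_fin.to_subtype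
  have l : (BT.node (.node t1 t2) t3).lab = (BT.node t1 (.node t2 t3)).lab := lab_perm (by simp [BT.word])
  refine (N.eqv_iso (hx.iso G c1)).trans ((N.eqv_hom he _).trans ?_)
  have := c2.iso G hy
  rw [← l] at this
  exact N.eqv_iso this

theorem RRE (N : NS C Γ Δ h g) (hR : ¬ NonRR C Γ) : RRP (α := α) C (EqA Δ h) := by
  have G := N.G
  unfold NonRR at hR
  push Not at hR
  obtain ⟨e, he, X0, X1, X2, b0, b1, b2, s01, s02, s12, r01, r02, r12, x0, a0, x1, a1, x2, a2, hC, hn⟩ := hR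
  have i := N.inj he
  rcases G.bin (i.ne (G.Sep_ne s01 a0 a1)) (i.ne (G.Sep_ne s02 a0 a2)) (i.ne (G.Sep_ne s12 a1 a2)) with k | k | k
  · exact absurd k hn
  · exact RRE1 N he b1 b0 b2 s01.symm s12 s02 r01.symm r12 r02 a1 a0 a2 (G.symm hC) k
  · exact RRE1 N he b0 b1 b2 s01 s02 s12 r01 r02 r12 a0 a1 a2 hC k

/-- the RR situation -/
structure RS (C : L → L → L → Prop) (Γ : RelStruct σ ar L) (Δ : RelStruct σ ar E) (h : L → E) (g : E → L) : Prop where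
  N : NS C Γ Δ h g
  R : ¬ NonRR C Γ

theorem RS.re (R : RS C Γ Δ h g) {A : Set α} (hA : A.Finite) {q : α} (hq : q ∈ A) (x : α → L) (hx : InjOn x A) :
    ∃ y, EqA Δ h A x y ∧ QI C A x y ∧ InjOn y A ∧ (∀ i ∈ A, ∀ j ∈ A, i ≠ q → j ≠ q → C (y q) (y i) (y j)) ∧
      ∀ a ∈ A, ∀ b ∈ A, ∀ c ∈ A, a ≠ q → b ≠ q → c ≠ q → (QRel C (x a) (x b) (x c) (x q) ↔ C (y c) (y a) (y b)) := by
  have RR : RRP (α := α) C (fun A x y => EqA Δ h A x y ∧ QI C A x y) := fun t1 t2 t3 =>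
    ⟨(RRQ R.N.G t1 t2 t3).1, fun x y hx hy => ⟨(RRE R.N R.R t1 t2 t3).2 x y hx hy, (RRQ R.N.G t1 t2 t3).2 x y hx hy⟩⟩
  obtain ⟨y, ⟨h1, h2⟩, h3, h4⟩ := reroot R.N (goodEQ R.N) RR hA hq x hx
  refine ⟨y, h1, h2, h3, h4, fun a ha b hb c hc na nb nc => ?_⟩
  rw [h2 a ha b hb c hc q hq]
  constructor
  · rintro (k | k)
    · exact k.1
    · exact absurd (h4 c hc a ha nc na) (R.N.G.asym k.1)
  · exact fun k => .inl ⟨k, h4 a ha b hb na nb⟩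

end DC

namespace DC
open Set Filter

variable {σ : Type} {ar : σ → ℕ} {L E : Type} {C : L → L → L → Prop} {Γ : RelStruct σ ar L} {Δ : RelStruct σ ar E} {I J α : Type} {h : L → E} {g : E → L}

theorem top_iso (G : CG C) {A : Set α} {q : α} {x y : α → L} (hx : InjOn x A) (hy : InjOn y A)
    (tx : ∀ i ∈ A, ∀ j ∈ A, i ≠ q → j ≠ q → C (x q) (x i) (x j)) (ty : ∀ i ∈ A, ∀ j ∈ A, i ≠ q → j ≠ q → C (y q) (y i) (y j))
    (H : ∀ a ∈ A, ∀ b ∈ A, ∀ c ∈ A, a ≠ q → b ≠ q → c ≠ q → C (x c) (x a) (x b) → C (y c) (y a) (y b)) :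
    CIso C (fun a : A => x a) (fun a : A => y a) := by
  refine CIso.of_inj1 G (fun i j hij => Subtype.ext (hx i.2 j.2 hij)) (fun i j hij => Subtype.ext (hy i.2 j.2 hij)) ?_
  rintro ⟨i, hi⟩ ⟨j, hj⟩ ⟨k, hk⟩ n1 n2 n3 hC
  simp only [ne_eq, Subtype.mk.injEq] at n1 n2 n3
  simp only at hC ⊢
  by_cases h1 : i = q
  · subst h1
    exact ty j hj k hk (Ne.symm n1) (Ne.symm n2)
  by_cases h2 : j = q
  · subst h2
    exact absurd (tx k hk i hi (Ne.symm n3) n1) (G.asym (G.symm hC))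
  by_cases h3 : k = q
  · subst h3
    exact absurd (tx j hj i hi n3 n2) (G.asym hC)
  exact H j hj k hk i hi h2 h3 h1 hC

theorem RS.qe (R : RS C Γ Δ h g) {A : Set α} (hA : A.Finite) {x y : α → L} (hx : InjOn x A) (hy : InjOn y A) (H : QI C A x y) : EqA Δ h A x y := by
  rcases A.eq_empty_or_nonempty with rfl | ⟨q, hq⟩
  · exact (goodE R.N).iso _ _ _ hA ⟨fun i => i.2.elim, fun i => i.2.elim⟩
  obtain ⟨x', x1, x2, x3, x4, x5⟩ := R.re hA hq x hx
  obtain ⟨y', y1, y2, y3, y4, y5⟩ := R.re hA hq y hy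
  refine x1.trans (Eqv.trans ?_ y1.symm)
  have := hA.to_subtype
  refine R.N.eqv_iso (top_iso R.N.G x3 y3 x4 y4 fun a ha b hb c hc na nb nc hC => ?_)
  exact (y5 a ha b hb c hc na nb nc).1 ((H a ha b hb c hc q hq).1 ((x5 a ha b hb c hc na nb nc).2 hC))

theorem sep_disj (G : CG C) {A B : Set α} {x : α → L} (H : Sep C (x '' A) (x '' B)) : Disjoint A B := by
  rw [Set.disjoint_left]
  intro a h1 h2
  exact G.Sep_ne H ⟨a, h1, rfl⟩ ⟨a, h2, rfl⟩ rfl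

theorem mergeF {κ : Type} [Inhabited κ] (A : κ → Set α) (hA : ∀ k l, k ≠ l → Disjoint (A k) (A l)) (u : κ → α → L) :
    ∃ z : α → L, ∀ k, EqOn z (u k) (A k) := by
  classical
  refine ⟨fun a => if h : ∃ k, a ∈ A k then u h.choose a else u default a, fun k a ha => ?_⟩
  have h : ∃ k, a ∈ A k := ⟨k, ha⟩
  simp only [h, dif_pos]
  congr 1
  by_contra hne
  exact Set.disjoint_left.1 (hA _ _ hne) h.choose_spec ha

theorem injU (G : CG C) {κ : Type} (T : κ → BT α) {x : α → L} (cx : ∀ k, Copy C (T k) x)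
    (sx : ∀ k l, k ≠ l → Sep C (x '' (T k).lab) (x '' (T l).lab)) : InjOn x (⋃ k, (T k).lab) := by
  intro a ha b hb hab
  rw [mem_iUnion] at ha hb
  obtain ⟨k, hk⟩ := ha
  obtain ⟨l, hl⟩ := hb
  by_cases hkl : k = l
  · subst hkl; exact (cx k).inj G hk hl hab
  · exact absurd hab (G.Sep_ne (sx k l hkl) ⟨a, hk, rfl⟩ ⟨b, hl, rfl⟩)

theorem Q_sep (G : CG C) (X : Fin 4 → Set L) (hX : ∀ k l, k ≠ l → Sep C (X k) (X l)) {p p' : Fin 4 → L} (hp : ∀ k, p k ∈ X k) (hp' : ∀ k, p' k ∈ X k)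
    (H : QRel C (p 0) (p 1) (p 2) (p 3)) : QRel C (p' 0) (p' 1) (p' 2) (p' 3) := by
  have key : ∀ i j k : Fin 4, i ≠ j → i ≠ k → j ≠ k → C (p k) (p i) (p j) → C (p' k) (p' i) (p' j) := fun i j k h1 h2 h3 hC =>
    Sep3 G (hX i j h1) (hX i k h2) (hX j k h3) (hp _) (hp _) (hp _) (hp' _) (hp' _) (hp' _) hC
  rcases H with ⟨h1, h2⟩ | ⟨h1, h2⟩
  · exact .inl ⟨key 0 1 2 (by decide) (by decide) (by decide) h1, key 0 1 3 (by decide) (by decide) (by decide) h2⟩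
  · exact .inr ⟨key 2 3 0 (by decide) (by decide) (by decide) h1, key 2 3 1 (by decide) (by decide) (by decide) h2⟩

theorem copy4 (T : Fin 4 → BT α) {x : α → L} (H : Copy C (.node (.node (T 0) (T 1)) (.node (T 2) (T 3))) x) :
    (∀ k, Copy C (T k) x) ∧ (∀ k l, k ≠ l → Sep C (x '' (T k).lab) (x '' (T l).lab)) ∧
    ∀ a ∈ (T 0).lab, ∀ b ∈ (T 1).lab, ∀ c ∈ (T 2).lab, ∀ d ∈ (T 3).lab, QRel C (x a) (x b) (x c) (x d) := by
  have s := H.2.2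
  rw [BT.lab_node, BT.lab_node, image_union, image_union] at s
  have s1 := s.of_union1
  have s2 := s1.1.of_union2
  have s3 := s1.2.of_union2
  have s4 := H.1.2.2
  have s5 := H.2.1.2.2
  refine ⟨?_, ?_, ?_⟩
  · intro k; fin_cases k <;> [exact H.1.1; exact H.1.2.1; exact H.2.1.1; exact H.2.1.2.1]
  · intro k l hkl
    fin_cases k <;> fin_cases l <;> first | exact absurd rfl hkl | exact s2.1 | exact s2.2 | exact s3.1 | exact s3.2 | exact s4 | exact s5 | exact s2.1.symm | exact s2.2.symm | exact s3.1.symm | exact s3.2.symm | exact s4.symm | exact s5.symm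
  · intro a ha b hb c hc d hd
    exact .inl ⟨s.1 _ (.inl ⟨a, ha, rfl⟩) _ (.inr ⟨b, hb, rfl⟩) _ (.inl ⟨c, hc, rfl⟩), s.1 _ (.inl ⟨a, ha, rfl⟩) _ (.inr ⟨b, hb, rfl⟩) _ (.inr ⟨d, hd, rfl⟩)⟩

theorem lab4 (T : Fin 4 → BT α) : (BT.node (.node (T 0) (T 1)) (.node (T 2) (T 3))).lab = ⋃ k, (T k).lab := by
  ext a
  simp [BT.lab_node, Fin.exists_fin_succ, or_assoc]

/-- an NNI-type violation -/
def QV (C : L → L → L → Prop) (Γ : RelStruct σ ar L) : Prop :=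
  ∃ e, IsHom Γ Γ e ∧ ∃ (X : Fin 4 → Set L) (a : L), X 0 = {a} ∧ (∀ k, k ≠ 0 → Big C (X k)) ∧ (∀ k l, k ≠ l → Sep C (X k) (X l) ∧ Sep C (e '' X k) (e '' X l)) ∧
    ∃ p : Fin 4 → L, (∀ k, p k ∈ X k) ∧ QRel C (p 0) (p 1) (p 2) (p 3) ∧ ¬ QRel C (e (p 0)) (e (p 1)) (e (p 2)) (e (p 3))

theorem NNI1 (R : RS C Γ Δ h g) {e : L → L} (he : IsHom Γ Γ e) (X : Fin 4 → Set L) {a : L} (hX0 : X 0 = {a}) (hX : ∀ k, k ≠ 0 → Big C (X k))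
    (hs : ∀ k l, k ≠ l → Sep C (X k) (X l) ∧ Sep C (e '' X k) (e '' X l)) {p : Fin 4 → L} (hp : ∀ k, p k ∈ X k)
    (h1 : QRel C (p 0) (p 1) (p 2) (p 3)) (h2 : QRel C (e (p 0)) (e (p 2)) (e (p 1)) (e (p 3)))
    (T : Fin 4 → BT α) {a' : α} (hT : T 0 = .leaf a') :
    TR C (EqA Δ h) (.node (.node (T 0) (T 1)) (.node (T 2) (T 3))) (.node (.node (T 0) (T 2)) (.node (T 1) (T 3))) := by
  have G := R.N.G
  refine ⟨?_, fun x y hx hy => ?_⟩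
  · simp only [BT.word, List.append_assoc]
    exact (List.perm_append_left_iff _).2 (by
      rw [← List.append_assoc, ← List.append_assoc]; exact List.perm_append_comm.append_right _)
  let π : Fin 4 → Fin 4 := ![0, 2, 1, 3]
  have hπ : ∀ k l, k ≠ l → π k ≠ π l := by decide
  have hππ : ∀ k, π (π k) = k := by decide
  have hU : (⋃ k, (T (π k)).lab) = ⋃ k, (T k).lab := by
    ext a
    simp only [mem_iUnion]
    exact ⟨fun ⟨k, hk⟩ => ⟨π k, hk⟩, fun ⟨k, hk⟩ => ⟨π k, by rw [hππ]; exact hk⟩⟩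
  obtain ⟨x1, x2, x3⟩ := copy4 T hx
  obtain ⟨y1, y2, y3⟩ := copy4 (fun k => T (π k)) hy
  have d : ∀ k l, k ≠ l → Disjoint (T k).lab (T l).lab := fun k l hkl => sep_disj G (x2 k l hkl)
  have : ∀ k, ∃ u, Copy C (T k) u ∧ Copy C (T k) (fun a => e (u a)) ∧ ∀ b ∈ (T k).lab, u b ∈ X k := by
    intro k
    by_cases hk : k = 0
    · subst hk
      rw [hT, hX0]
      exact ⟨fun _ => a, trivial, trivial, fun _ _ => rfl⟩
    · exact R.N.sepCopy he (T k) ((x1 k).nodup G) (hX k hk)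
  choose u u1 u2 u3 using this
  obtain ⟨z, hz⟩ := mergeF (fun k => (T k).lab) d u
  have z1 : ∀ k, Copy C (T k) z := fun k => (u1 k).congr (hz k).symm
  have z2 : ∀ k, Copy C (T k) (fun a => e (z a)) := fun k => (u2 k).congr fun a ha => by simp [hz k ha]
  have z3 : ∀ k, ∀ b ∈ (T k).lab, z b ∈ X k := fun k b hb => by rw [hz k hb]; exact u3 k b hb
  have z4 : ∀ k, z '' (T k).lab ⊆ X k := by rintro k _ ⟨b, hb, rfl⟩; exact z3 k b hb
  have z5 : ∀ k, (fun a => e (z a)) '' (T k).lab ⊆ e '' X k := by rintro k _ ⟨b, hb, rfl⟩; exact ⟨_, z3 k b hb, rfl⟩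
  have s1 : ∀ k l, k ≠ l → Sep C (z '' (T k).lab) (z '' (T l).lab) := fun k l hkl => (hs k l hkl).1.mono (z4 k) (z4 l)
  have s2 : ∀ k l, k ≠ l → Sep C ((fun a => e (z a)) '' (T k).lab) ((fun a => e (z a)) '' (T l).lab) := fun k l hkl => (hs k l hkl).2.mono (z5 k) (z5 l)
  have q1 : QI C (⋃ k, (T k).lab) x z := by
    refine QBlock4 G T x1 z1 x2 s1 x3 fun a ha b hb c hc d hd => ?_
    exact Q_sep G X (fun k l hkl => (hs k l hkl).1) hp (p' := ![z a, z b, z c, z d]) (by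
      intro k; fin_cases k <;> [exact z3 0 a ha; exact z3 1 b hb; exact z3 2 c hc; exact z3 3 d hd]) h1
  have q2 : QI C (⋃ k, (T (π k)).lab) (fun a => e (z a)) y := by
    refine QBlock4 G (fun k => T (π k)) (fun k => z2 _) y1 (fun k l hkl => s2 _ _ (hπ k l hkl)) y2 (fun a ha b hb c hc d hd => ?_) y3
    exact Q_sep G (fun k => e '' X (π k)) (fun k l hkl => (hs _ _ (hπ k l hkl)).2) (p := fun k => e (p (π k))) (fun k => ⟨_, hp _, rfl⟩)
      (p' := ![e (z a), e (z b), e (z c), e (z d)]) (by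
      intro k; fin_cases k <;> [exact ⟨_, z3 0 a ha, rfl⟩; exact ⟨_, z3 2 b hb, rfl⟩; exact ⟨_, z3 1 c hc, rfl⟩; exact ⟨_, z3 3 d hd, rfl⟩]) h2
  rw [hU] at q2
  rw [lab4]
  have hf : (⋃ k, (T k).lab).Finite := finite_iUnion fun k => (T k).lab_fin
  have ix := injU G T x1 x2
  have iz := injU G T z1 s1
  have iy := injU G (fun k => T (π k)) y1 y2
  rw [hU] at iy
  have hfs := hf.to_subtype
  exact (R.qe hf ix iz q1).trans ((R.N.eqv_hom he _).trans (R.qe hf ((R.N.inj he).comp_injOn iz) iy q2))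

theorem NNI (R : RS C Γ Δ h g) (hV : QV C Γ) (a : α) (t1 t2 t3 : BT α) :
    TR C (EqA Δ h) (.node (.node (.leaf a) t1) (.node t2 t3)) (.node (.node (.leaf a) t2) (.node t1 t3)) := by
  have G := R.N.G
  obtain ⟨e, he, X, a0, hX0, hX, hs, p, hp, h1, h2⟩ := hV
  have ne : ∀ k l, k ≠ l → e (p k) ≠ e (p l) := fun k l hkl => G.Sep_ne (hs k l hkl).2 ⟨_, hp k, rfl⟩ ⟨_, hp l, rfl⟩
  rcases Q_bin G (ne 0 1 (by decide)) (ne 0 2 (by decide)) (ne 0 3 (by decide)) (ne 1 2 (by decide)) (ne 1 3 (by decide)) (ne 2 3 (by decide)) with h | h | h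
  · exact absurd h h2
  · exact NNI1 R he X hX0 hX hs hp h1 h ![.leaf a, t1, t2, t3] rfl
  · let π : Fin 4 → Fin 4 := ![0, 1, 3, 2]
    have hπ : ∀ k l, k ≠ l → π k ≠ π l := by decide
    exact NNI1 R he (fun k => X (π k)) hX0 (fun k hk => hX _ (hπ k 0 hk)) (fun k l hkl => hs _ _ (hπ k l hkl)) (p := fun k => p (π k)) (fun k => hp _)
      (Q_swap2 G h1) h ![.leaf a, t1, t2, t3] rfl
end DC

namespace DC
open Set Filter

variable {σ : Type} {ar : σ → ℕ} {L E : Type} {C : L → L → L → Prop} {Γ : RelStruct σ ar L} {Δ : RelStruct σ ar E} {I J α : Type} {h : L → E} {g : E → L}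

theorem TR.symm {t t' : BT α} (H : TR C (EqA Δ h) t t') : TR C (EqA Δ h) t' t :=
  ⟨H.1.symm, fun x y hx hy => by rw [← lab_perm H.1]; exact (H.2 y x hy hx).symm⟩

def Rem (C : L → L → L → Prop) (Δ : RelStruct σ ar E) (h : L → E) (a : α) (T : BT α) : Prop :=
  T = .leaf a ∨ ∃ t, T.word.Perm (a :: t.word) ∧ (∀ x : α → L, Copy C T x → Copy C t x) ∧
    ∀ U, TR C (EqA Δ h) (.node U T) (.node (.node (.leaf a) U) t)

theorem Rem.left (R : RS C Γ Δ h g) (hV : QV C Γ) {a : α} {s : BT α} (t : BT α) (H : Rem C Δ h a s) : Rem C Δ h a (.node s t) := by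
  have N := R.N
  have gE := goodE (α := α) N
  have RR := RRE (α := α) N R.R
  right
  rcases H with rfl | ⟨u, h1, h2, h3⟩
  · exact ⟨t, List.Perm.refl _, fun x hx => hx.2.1, fun U => (RR U (.leaf a) t).symm.trans N gE (.commL N gE _ _ _)⟩
  · have hl : u.lab ⊆ s.lab := fun b hb => (h1.mem_iff).2 (List.mem_cons_of_mem _ hb)
    refine ⟨.node u t, h1.append_right _, fun x hx => ⟨h2 x hx.1, hx.2.1, hx.2.2.mono (image_mono hl) le_rfl⟩, fun U => ?_⟩
    refine (TR.comm N gE _ _).trans N gE ((TR.commL N gE _ _ _).trans N gE ((TR.comm N gE _ _).trans N gE ((RR U t s).symm.trans N gE ((h3 _).trans N gE ?_))))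
    refine (TR.commL N gE _ _ _).trans N gE ((RR _ _ _).trans N gE ((TR.comm N gE _ _).trans N gE ?_))
    refine TR.trans N gE ?_ (NNI R hV a u U t)
    exact (TR.comm N gE _ _).trans N gE (TR.comm N gE _ _)

theorem Rem.ex (R : RS C Γ Δ h g) (hV : QV C Γ) {a : α} (T : BT α) (ha : a ∈ T.lab) : Rem C Δ h a T := by
  have N := R.N
  have gE := goodE (α := α) N
  induction T with
  | leaf b => rw [BT.lab_leaf] at ha; exact .inl (by rw [mem_singleton_iff.1 ha])
  | node s t h1 h2 =>
    rw [BT.lab_node] at ha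
    rcases ha with ha | ha
    · exact (h1 ha).left R hV t
    · rcases (h2 ha).left R hV s with h | ⟨u, k1, k2, k3⟩
      · cases h
      · exact .inr ⟨u, List.perm_append_comm.trans k1, fun x hx => k2 x (copy_comm hx), fun U =>
          (TR.comm N gE _ _).trans N gE ((TR.commL N gE _ _ _).trans N gE ((TR.comm N gE _ _).trans N gE (k3 U)))⟩

/-- any placement of `a` is equivalent to the placement at the root -/
theorem Rem.root (R : RS C Γ Δ h g) (hV : QV C Γ) {a : α} {A : Set α} (hA : A.Finite) (ha : a ∈ A) (x : α → L) (hx : InjOn x A) :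
    ∃ y, EqA Δ h A x y ∧ InjOn y A ∧ (∀ i ∈ A, ∀ j ∈ A, i ≠ a → j ≠ a → C (y a) (y i) (y j)) ∧
      ∀ i ∈ A, ∀ j ∈ A, ∀ k ∈ A, i ≠ a → j ≠ a → k ≠ a → (C (x i) (x j) (x k) ↔ C (y i) (y j) (y k)) := by
  have N := R.N
  have gE := goodE (α := α) N
  have RR := RRE (α := α) N R.R
  obtain ⟨T, cT, rfl⟩ := exists_copy N.G x A hA ⟨a, ha⟩ hx
  have key : ∀ u : BT α, T.word.Perm (a :: u.word) → (∀ x : α → L, Copy C T x → Copy C u x) → TR C (EqA Δ h) T (.node (.leaf a) u) → 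
    ∃ y, EqA Δ h T.lab x y ∧ InjOn y T.lab ∧ (∀ i ∈ T.lab, ∀ j ∈ T.lab, i ≠ a → j ≠ a → C (y a) (y i) (y j)) ∧
      ∀ i ∈ T.lab, ∀ j ∈ T.lab, ∀ k ∈ T.lab, i ≠ a → j ≠ a → k ≠ a → (C (x i) (x j) (x k) ↔ C (y i) (y j) (y k)) := by
    intro u h1 h2 h3
    obtain ⟨y, hy⟩ := N.cp (h3.1.nodup_iff.1 (cT.nodup N.G))
    have hm : ∀ i ∈ T.lab, i ≠ a → i ∈ u.lab := fun i hi hne => (List.mem_cons.1 (h1.mem_iff.1 hi)).resolve_left hne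
    refine ⟨y, h3.2 x y cT hy, ?_, fun i hi j hj ni nj => ?_, fun i hi j hj k hk ni nj nk => ?_⟩
    · rw [lab_perm h3.1]; exact hy.inj N.G
    · exact hy.2.2.symm.1 _ ⟨i, hm i hi ni, rfl⟩ _ ⟨j, hm j hj nj, rfl⟩ _ ⟨a, by simp [BT.lab_leaf], rfl⟩
    · exact ⟨(h2 x cT).isoC N.G hy.2.1 _ (hm i hi ni) _ (hm j hj nj) _ (hm k hk nk), hy.2.1.isoC N.G (h2 x cT) _ (hm i hi ni) _ (hm j hj nj) _ (hm k hk nk)⟩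
  have lf : ∀ i ∈ (BT.leaf a).lab, i = a := fun i hi => by rwa [BT.lab_leaf] at hi
  cases T with
  | leaf b =>
    rw [BT.lab_leaf] at ha
    obtain rfl : a = b := ha
    refine ⟨x, Eqv.refl _, hx, fun i hi j hj ni => absurd (lf i hi) ni, fun _ _ _ _ _ _ _ _ _ => Iff.rfl⟩
  | node s t =>
    rw [BT.lab_node] at ha
    have L1 : ∀ s t : BT α, Rem C Δ h a s → ∃ u, (BT.node s t).word.Perm (a :: u.word) ∧ (∀ x : α → L, Copy C (.node s t) x → Copy C u x) ∧ TR C (EqA Δ h) (.node s t) (.node (.leaf a) u) := by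
      intro s t H
      have H' := H
      rcases H with rfl | ⟨u, h1, h2, h3⟩
      · exact ⟨t, List.Perm.refl _, fun x hx => hx.2.1, TR.of_copy N gE (List.Perm.refl _) fun _ => id⟩
      · have hl : u.lab ⊆ s.lab := fun b hb => (h1.mem_iff).2 (List.mem_cons_of_mem _ hb)
        refine ⟨.node t u, (h1.append_right _).trans ?_, fun x hx => copy_comm ⟨h2 x hx.1, hx.2.1, hx.2.2.mono (image_mono hl) le_rfl⟩, ?_⟩
        · exact (List.perm_append_comm (l₁ := u.word) (l₂ := t.word)).cons a
        · exact (TR.comm N gE _ _).trans N gE ((h3 t).trans N gE (RR _ _ _))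
    rcases ha with ha | ha
    · obtain ⟨u, k1, k2, k3⟩ := L1 s t (Rem.ex R hV s ha)
      exact key u k1 k2 k3
    · obtain ⟨u, k1, k2, k3⟩ := L1 t s (Rem.ex R hV t ha)
      exact key u (List.perm_append_comm.trans k1) (fun x hx => k2 x (copy_comm hx)) ((TR.comm N gE _ _).trans N gE k3)

theorem QV_ht (R : RS C Γ Δ h g) (hV : QV C Γ) : HT Δ := by
  refine R.N.ht_one ?_
  intro I _ s t a hs ht hst
  obtain ⟨y, y1, y2, y3, y4⟩ := Rem.root R hV (A := univ) finite_univ (mem_univ a) s hs.injOn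
  obtain ⟨z, z1, z2, z3, z4⟩ := Rem.root R hV (A := univ) finite_univ (mem_univ a) t ht.injOn
  have : EqA Δ h univ y z := by
    refine R.N.eqv_iso (top_iso R.N.G y2 z2 y3 z3 fun i hi j hj k hk ni nj nk hC => ?_)
    rw [← z4 _ trivial _ trivial _ trivial nk ni nj, ← hst k nk, ← hst i ni, ← hst j nj]
    exact (y4 _ trivial _ trivial _ trivial nk ni nj).2 hC
  have e := y1.trans (this.trans z1.symm)
  exact e.comap (fun i : I => (⟨i, trivial⟩ : (univ : Set I)))
end DC

namespace DC
open Set Filter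

variable {σ : Type} {ar : σ → ℕ} {L E : Type} {C : L → L → L → Prop} {Γ : RelStruct σ ar L} {Δ : RelStruct σ ar E} {I J α : Type} {h : L → E} {g : E → L}

theorem RS.cax (R : RS C Γ Δ h g) (q : L) : CAx (fun x => x ≠ q) (fun z x y => QRel C x y z q) := by
  have G := R.N.G
  have key : ∀ x y z w : L, x ≠ q → y ≠ q → z ≠ q → w ≠ q → ∃ f : L → L, InjOn f {x, y, z, w} ∧
      ∀ a ∈ ({x, y, z, w} : Set L), ∀ b ∈ ({x, y, z, w} : Set L), ∀ c ∈ ({x, y, z, w} : Set L), (QRel C a b c q ↔ C (f c) (f a) (f b)) := by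
    intro x y z w hx hy hz hw
    obtain ⟨f, -, -, f3, -, f5⟩ := R.re (A := {x, y, z, w} ∪ {q}) (toFinite _) (q := q) (by simp) id (injOn_id _)
    have nq : ∀ a ∈ ({x, y, z, w} : Set L), a ≠ q := by rintro a (rfl | rfl | rfl | rfl) <;> assumption
    exact ⟨f, f3.mono subset_union_left, fun a ha b hb c hc => f5 a (.inl ha) b (.inl hb) c (.inl hc) (nq a ha) (nq b hb) (nq c hc)⟩
  refine ⟨fun z x y hx hy hz H => Q_swap G H, fun z x y hx hy hz H => ?_, fun z x y hx hy hz H w hw => ?_, fun x y z hx hy hz n1 n2 n3 => ?_⟩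
  · obtain ⟨f, -, f2⟩ := key x y z z hx hy hz hz
    rw [f2 _ (by simp) _ (by simp) _ (by simp)] at H ⊢
    exact G.asym H
  · obtain ⟨f, -, f2⟩ := key x y z w hx hy hz hw
    rw [f2 _ (by simp) _ (by simp) _ (by simp)] at H ⊢
    rw [f2 _ (by simp) _ (by simp) _ (by simp)]
    exact G.tr H _
  · obtain ⟨f, f1, f2⟩ := key x y z z hx hy hz hz
    rw [f2 _ (by simp) _ (by simp) _ (by simp), f2 _ (by simp) _ (by simp) _ (by simp), f2 _ (by simp) _ (by simp) _ (by simp)]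
    exact G.bin (f1.ne (by simp) (by simp) n1) (f1.ne (by simp) (by simp) n2) (f1.ne (by simp) (by simp) n3)

theorem RS.qjoin (R : RS C Γ Δ h g) {x y w z q : L} (hz : z ≠ q) (h1 : QRel C x y z q) (h2 : QRel C y w z q) : QRel C x w z q := by
  have G := R.N.G
  have n1 := Q_ne G h1
  have n2 := Q_ne G h2
  exact (R.cax q).join n1.2.2.2 hz n1.2.1 n2.2.2.2 (Q_swap G h1) h2

theorem RS.qhalf (R : RS C Γ Δ h g) {a a' b b' c c' d' : L} (hc : c ≠ d') (hc' : c' ≠ d') (h1 : QRel C a a' c' d') (h2 : QRel C c c' a' d') (h3 : QRel C b b' c' d')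
    (h4 : QRel C c c' b' d') (h5 : QRel C c d' a' b') (h6 : QRel C a' b' c' d') : QRel C a b c d' ∧ QRel C a b c' d' := by
  have G := R.N.G
  have n1 := Q_ne G h1
  have n3 := Q_ne G h3
  have c1 : QRel C a' a c d' := (R.cax d').cross n1.2.2.2 hc' n1.2.1 hc (Q_swap G h1) (Q_swap G h2)
  have c2 : QRel C b' b c d' := (R.cax d').cross n3.2.2.2 hc' n3.2.1 hc (Q_swap G h3) (Q_swap G h4)
  exact ⟨R.qjoin hc (Q_swap G c1) (R.qjoin hc (Q_flip h5) c2), R.qjoin hc' h1 (R.qjoin hc' h6 (Q_swap G h3))⟩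

theorem RS.qpres (R : RS C Γ Δ h g) (hV : ¬ QV C Γ) {e : L → L} (he : IsHom Γ Γ e) {a b c d : L} (H : QRel C a b c d) :
    QRel C (e a) (e b) (e c) (e d) := by
  have G := R.N.G
  have N := R.N
  have ei := N.inj he
  have hne := Q_ne G H
  by_cases hab : a = b
  · subst hab
    exact .inl ⟨G.rfl' (ei.ne hne.1), G.rfl' (ei.ne hne.2.1)⟩
  by_cases hcd : c = d
  · subst hcd
    exact .inr ⟨G.rfl' (ei.ne hne.1.symm), G.rfl' (ei.ne hne.2.2.1.symm)⟩
  obtain ⟨p, hp⟩ : ∃ p : Fin 4 → L, p = ![a, b, c, d] := ⟨_, rfl⟩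
  have Hp : QRel C (p 0) (p 1) (p 2) (p 3) := by rw [hp]; exact H
  have pi : ∀ i j, i ≠ j → p i ≠ p j := by
    rw [hp]
    intro i j hij
    obtain ⟨q1, q2, q3, q4⟩ := hne
    fin_cases i <;> fin_cases j <;> first | exact absurd rfl hij | assumption | (apply Ne.symm; assumption)
  suffices hs : QRel C (e (p 0)) (e (p 1)) (e (p 2)) (e (p 3)) by rw [hp] at hs; exact hs
  clear hp
  choose Y y1 _ y3 using fun i => G.near_set (p i) {x | ∃ j, j ≠ i ∧ p j = x} ((finite_range p).subset fun _ ⟨j, _, hj⟩ => ⟨j, hj⟩) (by rintro ⟨j, hj, hh⟩; exact pi j i hj hh)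
  obtain ⟨X, x1, x2, x3, x4⟩ := N.shrink he (range p) (toFinite _) Y y1
  choose x hx using fun i => G.big_nonempty (x2 i)
  have near : ∀ i j, i ≠ j → C (p j) (x i) (p i) := fun i j hij => y3 i _ (x1 i (hx i)) _ ⟨j, hij.symm, rfl⟩
  have F : ∀ w i j k, i ≠ j → i ≠ k → j ≠ k → (∀ l, l = i ∨ l = j ∨ l = k → Sep C {w} (X l) ∧ Sep C {e w} (e '' X l)) → QRel C w (x i) (x j) (x k) →
      QRel C (e w) (e (x i)) (e (x j)) (e (x k)) := by
    intro w i j k hij hik hjk hw hQ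
    by_contra hn
    refine hV ⟨e, he, ![{w}, X i, X j, X k], w, rfl, ?_, ?_, ![w, x i, x j, x k], ?_, hQ, hn⟩
    · intro l hl; fin_cases l <;> first | exact absurd rfl hl | exact x2 _
    · have w1 := hw i (.inl rfl)
      have w2 := hw j (.inr (.inl rfl))
      have w3 := hw k (.inr (.inr rfl))
      rw [← image_singleton] at w1 w2 w3
      intro l m hlm
      fin_cases l <;> fin_cases m <;> first | exact absurd rfl hlm | exact w1 | exact w2 | exact w3 | exact x3 _ _ (by assumption) | exact ⟨w1.1.symm, w1.2.symm⟩ | exact ⟨w2.1.symm, w2.2.symm⟩ | exact ⟨w3.1.symm, w3.2.symm⟩ | exact x3 _ _ (Ne.symm (by assumption))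
    · intro l; fin_cases l <;> first | exact rfl | exact hx _
  have Fp : ∀ m i j k, i ≠ j → i ≠ k → j ≠ k → QRel C (p m) (x i) (x j) (x k) → QRel C (e (p m)) (e (x i)) (e (x j)) (e (x k)) :=
    fun m i j k h1 h2 h3 => F _ i j k h1 h2 h3 fun l _ => x4 _ ⟨m, rfl⟩ l
  have near2 : ∀ i j, i ≠ j → C (x j) (p i) (x i) := fun i j hij => G.cross (G.symm (near i j hij)) (G.symm (near j i hij.symm))
  have F1 : ∀ i j k, i ≠ j → i ≠ k → j ≠ k → QRel C (e (p i)) (e (x i)) (e (x j)) (e (x k)) := fun i j k h1 h2 h3 =>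
    Fp i i j k h1 h2 h3 (.inl ⟨near2 i j h1, near2 i k h2⟩)
  have M : ∀ w : Fin 4 → L, (∀ i, w i = p i ∨ w i = x i) → QRel C (w 0) (w 1) (w 2) (w 3) := by
    intro w hw
    have iso : CIso C p w := near_iso G fun i j hij => by
      rcases hw i with k | k <;> rw [k]
      · exact G.rfl' (pi i j hij)
      · exact near i j hij
    rcases Hp with ⟨k1, k2⟩ | ⟨k1, k2⟩
    · exact .inl ⟨(iso.2 _ _ _).1 k1, (iso.2 _ _ _).1 k2⟩
    · exact .inr ⟨(iso.2 _ _ _).1 k1, (iso.2 _ _ _).1 k2⟩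
  have m2 : QRel C (e (p 2)) (e (x 3)) (e (x 0)) (e (x 1)) := Fp 2 3 0 1 (by decide) (by decide) (by decide)
    (Q_flip (M ![x 0, x 1, p 2, x 3] (by intro i; fin_cases i <;> simp)))
  have m3 : QRel C (e (p 3)) (e (x 2)) (e (x 0)) (e (x 1)) := Fp 3 2 0 1 (by decide) (by decide) (by decide)
    (Q_swap G (Q_flip (M ![x 0, x 1, x 2, p 3] (by intro i; fin_cases i <;> simp))))
  have m : QRel C (e (x 0)) (e (x 1)) (e (x 2)) (e (x 3)) := by
    refine F (x 0) 1 2 3 (by decide) (by decide) (by decide) (fun l hl => ?_) (M x fun _ => .inr rfl)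
    have h0 : (0 : Fin 4) ≠ l := by clear * - hl; revert l; decide
    have := x3 0 l h0
    exact ⟨this.1.mono (singleton_subset_iff.2 (hx 0)) le_rfl, this.2.mono (singleton_subset_iff.2 ⟨_, hx 0, rfl⟩) le_rfl⟩
  have xx : ∀ i j, i ≠ j → e (x i) ≠ e (x j) := fun i j hij => G.Sep_ne (x3 i j hij).2 ⟨_, hx i, rfl⟩ ⟨_, hx j, rfl⟩
  have px : ∀ i j, e (p i) ≠ e (x j) := fun i j => G.Sep_ne (x4 _ ⟨i, rfl⟩ j).2 rfl ⟨_, hx j, rfl⟩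
  obtain ⟨a1, a2⟩ := R.qhalf (px 2 3) (xx 2 3 (by decide)) (F1 0 2 3 (by decide) (by decide) (by decide)) (F1 2 0 3 (by decide) (by decide) (by decide))
    (F1 1 2 3 (by decide) (by decide) (by decide)) (F1 2 1 3 (by decide) (by decide) (by decide)) m2 m
  obtain ⟨b1, b2⟩ := R.qhalf (px 3 2) (xx 3 2 (by decide)) (F1 0 3 2 (by decide) (by decide) (by decide)) (F1 3 0 2 (by decide) (by decide) (by decide))
    (F1 1 3 2 (by decide) (by decide) (by decide)) (F1 3 1 2 (by decide) (by decide) (by decide)) m3 (Q_swap2 G m)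
  have nn : e (p 1) ≠ e (p 0) := ei.ne (pi 1 0 (by decide))
  have fl : ∀ {a b c d : L}, QRel C a b c d → QRel C c d b a := fun k => Q_swap2 G (Q_flip k)
  exact Q_flip (Q_swap2 G (R.qjoin nn (fl a1) (R.qjoin nn (Q_swap G (fl a2)) (Q_swap G (fl b1)))))
end DC

namespace DC
open Set Filter

variable {σ : Type} {ar : σ → ℕ} {L E : Type} {C : L → L → L → Prop} {Γ : RelStruct σ ar L} {Δ : RelStruct σ ar E} {I J α : Type} {h : L → E} {g : E → L}

theorem Setup.orb_iso (S : Setup C Γ Δ h g) [Finite I] {s t : I → E} (H : CIso C (fun i => g (s i)) (fun i => g (t i))) : Orb Δ s t := by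
  obtain ⟨α, hα, h2⟩ := H.aut S.hL
  have h1 := S.oc.endoI (hcomp (hcomp S.hg (S.aut α hα)) S.hh) s
  simp only [h2] at h1
  exact h1.trans (S.oc.endoI (hcomp S.hg S.hh) t).symm

theorem Setup.orb_real (S : Setup C Γ Δ h g) [Finite I] {s t : I → E} (H : Orb Δ s t) : ∃ e, IsHom Γ Γ e ∧ ∀ i, e (g (s i)) = g (t i) := by
  obtain ⟨γ, hγ, h1⟩ := (S.oc.endoI (hcomp S.hg S.hh) s).symm.trans H
  exact ⟨_, hcomp (hcomp S.hh hγ.hom) S.hg, fun i => by rw [h1]⟩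

theorem Setup.noPLF2 (S : Setup C Γ Δ h g) [Nontrivial E] (H4 : ∀ (n : ℕ) (a : Fin n → E), IsEmpty (PPInterpretation (Δ.withConstants a) NAEStruct)) :
    NoPLF Δ (Fin 2) := by
  classical
  have G := CG.of S.hL
  have gi := S.g_inj
  have hi := S.h_inj
  by_contra hno
  have : Infinite L := G.inf
  have : Infinite E := Infinite.of_injective h hi
  obtain ⟨P⟩ := xor_hard S.oc (fun x y z w n1 n2 => by
      have : CIso C (fun i => g (![x, y] i)) (fun i => g (![z, w] i)) := by
        have := CIso.pair G (gi.ne n1) (gi.ne n2)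
        convert this using 1 <;> (funext i; fin_cases i <;> rfl)
      obtain ⟨γ, k1, k2⟩ := S.orb_iso this
      exact ⟨γ, k1, k2 0, k2 1⟩)
    (fun x y => by
      obtain ⟨z, hz⟩ := Infinite.exists_notMem_finset ({x, y} : Finset E)
      simp only [Finset.mem_insert, Finset.mem_singleton, not_or] at hz
      exact ⟨z, hz⟩)
    (fun a c d n1 n2 => by
      obtain ⟨X, bX, pX, hX⟩ := G.near_set (g a) {g c, g d} (toFinite _) (by simp [gi.eq_iff, n1, n2])
      obtain ⟨x0, hx0⟩ := G.big_nonempty bX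
      have hn := hX x0 hx0
      simp only [mem_insert_iff, mem_singleton_iff, forall_eq_or_imp, forall_eq] at hn
      let A : Set E := {a, c, d}
      have iso : CIso C (fun i : A => g i) (fun i : A => if (i : E) = a then x0 else g i) := near_iso G (by
        rintro ⟨i, hi1⟩ ⟨j, hj⟩ hne
        simp only [ne_eq, Subtype.mk.injEq] at hne ⊢
        split_ifs with hia
        · subst hia
          rcases hj with rfl | rfl | rfl
          exacts [absurd rfl hne, hn.1, hn.2]
        · exact G.rfl' (gi.ne hne))
      obtain ⟨α, hα, h2⟩ := iso.aut S.hL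
      have h1 := S.oc.endoI (hcomp (hcomp S.hg (S.aut α hα)) S.hh) (fun i : A => (i : E))
      obtain ⟨γ1, k1, k2⟩ := h1
      obtain ⟨δ, d1, d2⟩ := S.oc.endoI (hcomp S.hg S.hh) (fun i : A => (i : E))
      have hcv : ∀ i : A, (i : E) ≠ a → δ.symm (γ1 i) = i := by
        intro i hi'
        rw [k2]
        simp only [h2]
        rw [if_neg hi', Equiv.symm_apply_eq, d2 i]
      refine ⟨δ.symm (γ1 a), fun hc => ?_, γ1.trans δ.symm, k1.trans d1.symm, rfl, hcv ⟨c, by simp [A]⟩ n1.symm, hcv ⟨d, by simp [A]⟩ n2.symm⟩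
      have e1 := k2 ⟨a, by simp [A]⟩
      have e2 := d2 ⟨a, by simp [A]⟩
      have e3 := h2 ⟨a, by simp [A]⟩
      simp only [if_true] at e1 e2 e3
      rw [Equiv.symm_apply_eq, e1, e2, e3] at hc
      exact pX (hi hc ▸ hx0)) hno
  have tr : ∀ {m : ℕ} (φ : PPFormula σ ar m), ∃ ψ : PPFormula (σ ⊕ Fin 0) (Sum.elim ar fun _ => 1) m, ∀ t, φ.Realize Δ t ↔ ψ.Realize (Δ.withConstants Fin.elim0) t := by
    intro m φ
    obtain ⟨ψ, h⟩ := (PP.withC (⟨m, id, φ, fun t => Iff.rfl⟩ : PP Δ (fun t => φ.Realize Δ t)) Fin.elim0).fml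
    exact ⟨ψ, h⟩
  obtain ⟨φ1, t1⟩ := tr P.domFml
  obtain ⟨φ2, t2⟩ := tr P.eqFml
  obtain ⟨φ3, t3⟩ := tr (P.relFml ())
  refine (H4 0 Fin.elim0).false ⟨P.dim, φ1, φ2, fun _ => φ3, P.coord, ?_, ?_, ?_⟩
  · intro e
    obtain ⟨t, k1, k2⟩ := P.coord_surj e
    exact ⟨t, (t1 t).1 k1, k2⟩
  · intro s t hs ht
    rw [← t2]; exact P.eq_iff s t ((t1 s).2 hs) ((t1 t).2 ht)
  · intro s ts hts
    have h3 := P.rel_iff () ts (fun i => (t1 _).2 (hts i))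
    rw [t3] at h3
    exact h3

theorem HT.sym (oc : OC Δ) [Nonempty E] (hT : HT Δ) (h2 : NoPLF Δ (Fin 2)) : HasSymmetricPolymorphismModEndos Δ := by
  refine oc.sym fun I _ => oc.lg h2 fun u v H => ?_
  have pat : ∀ i j, u i = u j ↔ v i = v j := fun i j => (H ![i, j]).eq_iff 0 1
  have hu : ∀ a : range u, ∃ i, u i = a := fun a => a.2
  choose k hk using hu
  have := hT (range u) (fun a => (a : E)) (fun a => v (k a)) Subtype.val_injective (by
    intro a b hab
    apply Subtype.ext
    rw [← hk a, ← hk b, pat]; exact hab)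
  obtain ⟨γ, h1, h2⟩ := this
  exact ⟨γ, h1, fun i => (h2 ⟨u i, i, rfl⟩).trans ((pat _ _).1 (hk _))⟩

theorem f3a : ∀ p q : Fin 3, p ≠ q → ∃ r : Fin 3, r ≠ p ∧ r ≠ q ∧ ∀ s, s = p ∨ s = q ∨ s = r := by decide
theorem f3b : ∀ p q r s : Fin 3, p ≠ q → p ≠ r → q ≠ r → s ≠ r → s = p ∨ s = q := by decide
theorem f3c : ∀ p i j k : Fin 3, i ≠ j → i ≠ k → j ≠ k → (i = p ∧ j = p + 1 ∧ k = p + 2) ∨ (i = p ∧ j = p + 2 ∧ k = p + 1) ∨ (i ≠ p ∧ j = p) ∨ (i ≠ p ∧ k = p) := by decide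

theorem two_types (oc : OC Δ) [Finite J] [Nonempty J] (τ : Fin 3 → (J → E) → Prop)
    (hi : ∀ u, Function.Injective u → ∃ p, τ p u)
    (ho : ∀ p u v, Function.Injective u → Function.Injective v → τ p u → τ p v → Orb Δ u v) (hp : ∀ p u v, Orb Δ u v → τ p u → τ p v)
    (hni : ∀ u v : J → E, ¬ Function.Injective u → (∀ i j, u i = u j ↔ v i = v j) → Orb Δ u v)
    (h2 : NoPLF Δ (Fin 2)) (hno : ¬ NoPLF Δ J) : ∃ r, PP Δ (fun u => Function.Injective u ∧ ¬ τ r u) := by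
  simp only [NoPLF, not_forall] at hno
  obtain ⟨S, hS, hsym, hne, hbad⟩ := hno
  obtain ⟨S', h1, h2', ⟨u0, v0, h3⟩, h4, h5⟩ := oc.lg_aux h2 S hS hsym hne
  have nob : ∀ u v, S' u v → ¬ Orb Δ u v := fun u v k k' => hbad ⟨u, v, h4 _ _ k, k'⟩
  have inj : ∀ u v, S' u v → Function.Injective u := by
    intro u v huv
    by_contra hc
    refine nob u v huv (hni u v hc fun i j => ?_)
    obtain ⟨w, hw⟩ := h5 ![i, j]
    exact ((hw u v huv).1.symm.trans (hw u v huv).2).eq_iff 0 1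
  have inv : ∀ u v u', S' u v → Orb Δ u u' → ∃ v', Orb Δ v v' ∧ S' u' v' := by
    rintro u v u' huv ⟨γ, hγ, k⟩
    refine ⟨fun i => γ (v i), ⟨γ, hγ, fun _ => rfl⟩, ?_⟩
    exact h1.orb (s := Sum.elim u v) (t := Sum.elim u' fun i => γ (v i)) ⟨γ, hγ, by rintro (i | i) <;> simp [k]⟩ huv
  let Ed : Fin 3 → Fin 3 → Prop := fun p q => ∃ u v, τ p u ∧ τ q v ∧ S' u v
  have Es : ∀ p q, Ed p q → Ed q p := fun p q ⟨u, v, a, b, c⟩ => ⟨v, u, b, a, h2' _ _ c⟩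
  have Ei : ∀ p, ¬ Ed p p := fun p ⟨u, v, a, b, c⟩ => nob u v c (ho p u v (inj _ _ c) (inj _ _ (h2' _ _ c)) a b)
  have rc : ∀ p q, Ed p q → ∀ u, Function.Injective u → τ p u → ∃ v, τ q v ∧ S' u v := by
    rintro p q ⟨u', v', a, b, c⟩ u hu ht
    obtain ⟨v, k1, k2⟩ := inv _ _ u c (ho p _ _ (inj _ _ c) hu a ht)
    exact ⟨v, hp q _ _ k1 b, k2⟩
  have star : ∀ p q r : Fin 3, p ≠ q → p ≠ r → q ≠ r → Ed p r → Ed q r → PP Δ (fun u => Function.Injective u ∧ ¬ τ r u) := by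
    intro p q r n1 n2 n3 e1 e2
    obtain ⟨_, w, -, hw, hs⟩ := id e1
    have hwi := inj _ _ (h2' _ _ hs)
    refine (PP.exFin (R := fun u v => Orb Δ w v ∧ S' u v) (((oc.orb_pp w).comap Sum.inr).and h1)).congr fun u => ⟨fun ⟨k1, k2⟩ => ?_, fun ⟨v, k1, k2⟩ => ?_⟩
    · obtain ⟨p', hp'⟩ := hi u k1
      have : Ed p' r := by
        have n4 : p' ≠ r := fun hc => k2 (hc ▸ hp')
        have := f3b p q r p' n1 n2 n3 n4
        rcases this with rfl | rfl <;> assumption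
      obtain ⟨v, m1, m2⟩ := rc _ _ this u k1 hp'
      exact ⟨v, ho r w v hwi (inj _ _ (h2' _ _ m2)) hw m1, m2⟩
    · exact ⟨inj _ _ k2, fun hc => Ei r ⟨u, v, hc, hp r w v k1 hw, k2⟩⟩
  obtain ⟨p, hp0⟩ := hi u0 (inj _ _ h3)
  obtain ⟨q, hq0⟩ := hi v0 (inj _ _ (h2' _ _ h3))
  have e0 : Ed p q := ⟨_, _, hp0, hq0, h3⟩
  have npq : p ≠ q := fun hc => Ei p (by rw [← hc] at e0; exact e0)
  obtain ⟨r, n1, n2, n3⟩ := f3a p q npq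
  by_cases k1 : Ed r q
  · exact ⟨q, star p r q n1.symm npq n2 e0 k1⟩
  by_cases k2 : Ed r p
  · exact ⟨p, star q r p n2.symm npq.symm n1 (Es _ _ e0) k2⟩
  refine ⟨r, (PP.exFin (R := fun u v => S' u v) h1).congr fun u => ⟨fun ⟨m1, m2⟩ => ?_, fun ⟨v, m1⟩ => ⟨inj _ _ m1, fun hc => ?_⟩⟩⟩
  · obtain ⟨p', hp'⟩ := hi u m1
    rcases n3 p' with rfl | rfl | rfl
    · obtain ⟨v, -, m⟩ := rc _ _ e0 u m1 hp'; exact ⟨v, m⟩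
    · obtain ⟨v, -, m⟩ := rc _ _ (Es _ _ e0) u m1 hp'; exact ⟨v, m⟩
    · exact absurd hp' m2
  · obtain ⟨p', hp'⟩ := hi v (inj _ _ (h2' _ _ m1))
    have e : Ed r p' := ⟨u, v, hc, hp', m1⟩
    rcases n3 p' with rfl | rfl | rfl
    exacts [k2 e, k1 e, Ei _ e]

end DC

namespace DC
open Set Filter

variable {σ : Type} {ar : σ → ℕ} {L E : Type} {C : L → L → L → Prop} {Γ : RelStruct σ ar L} {Δ : RelStruct σ ar E} {I J α : Type} {h : L → E} {g : E → L}

theorem CAx.comap {V : E → Prop} {D : E → E → E → Prop} (H : CAx V D) {f : I → E} (hf : Function.Injective f) {W : I → Prop} (hW : ∀ i, W i → V (f i)) :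
    CAx W (fun z x y => D (f z) (f x) (f y)) :=
  ⟨fun z x y a b c => H.symm _ _ _ (hW _ a) (hW _ b) (hW _ c), fun z x y a b c => H.asym _ _ _ (hW _ a) (hW _ b) (hW _ c),
    fun z x y a b c k w hw => H.tr _ _ _ (hW _ a) (hW _ b) (hW _ c) k _ (hW _ hw),
    fun x y z a b c n1 n2 n3 => H.bin _ _ _ (hW _ a) (hW _ b) (hW _ c) (hf.ne n1) (hf.ne n2) (hf.ne n3)⟩

theorem CAx.typ {D : Fin 3 → Fin 3 → Fin 3 → Prop} (H : CAx (fun _ => True) D) {p : Fin 3} (hp : D p (p + 1) (p + 2)) {i j k : Fin 3}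
    (n1 : i ≠ j) (n2 : i ≠ k) (n3 : j ≠ k) : D i j k ↔ i = p := by
  have t := trivial
  have aux : ∀ {j k : Fin 3}, p ≠ j → p ≠ k → j ≠ k → D p j k := by
    intro j k m1 m2 m3
    rcases f3c p p j k m1 m2 m3 with ⟨-, rfl, rfl⟩ | ⟨-, rfl, rfl⟩ | ⟨a, -⟩ | ⟨a, -⟩
    exacts [hp, H.symm _ _ _ t t t hp, absurd rfl a, absurd rfl a]
  constructor
  · intro hD
    rcases f3c p i j k n1 n2 n3 with ⟨e, -⟩ | ⟨e, -⟩ | ⟨-, rfl⟩ | ⟨-, rfl⟩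
    · exact e
    · exact e
    · exact absurd (aux n3 n1.symm n2.symm) (H.asym _ _ _ t t t (H.symm _ _ _ t t t hD))
    · exact absurd (aux n3.symm n2.symm n1.symm) (H.asym _ _ _ t t t hD)
  · rintro rfl
    exact aux n1 n2 n3

theorem CAx.ex {D : Fin 3 → Fin 3 → Fin 3 → Prop} (H : CAx (fun _ => True) D) : ∃ p, D p (p + 1) (p + 2) := by
  have t := trivial
  rcases H.bin 0 1 2 t t t (by decide) (by decide) (by decide) with k | k | k
  · exact ⟨2, k⟩
  · exact ⟨1, H.symm _ _ _ t t t k⟩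
  · exact ⟨0, k⟩

theorem CAx.uniq {D : Fin 3 → Fin 3 → Fin 3 → Prop} (H : CAx (fun _ => True) D) {p q : Fin 3} (hp : D p (p + 1) (p + 2)) (hq : D q (q + 1) (q + 2)) : p = q :=
  (H.typ hq (by clear hp; revert p; decide) (by clear hp; revert p; decide) (by clear hp; revert p; decide)).1 hp

theorem CAx.trip {V : E → Prop} {D : E → E → E → Prop} (H : CAx V D) {x y z : E} (hx : V x) (hy : V y) (hz : V z) (n1 : x ≠ y) (n2 : x ≠ z) (n3 : y ≠ z) :
    ¬ D y x z ↔ D z x y ∨ D x y z := by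
  constructor
  · intro hn
    rcases H.bin x y z hx hy hz n1 n2 n3 with k | k | k
    exacts [.inl k, absurd k hn, .inr k]
  · rintro (k | k)
    · exact H.asym _ _ _ hx hy hz k
    · intro k'
      exact H.asym _ _ _ hz hy hx (H.symm _ _ _ hy hz hx k) (H.symm _ _ _ hx hz hy k')

theorem CG.cax (G : CG C) : CAx (fun _ => True) C :=
  ⟨fun _ _ _ _ _ _ => G.symm, fun _ _ _ _ _ _ => G.asym, fun _ _ _ _ _ _ k w _ => G.tr k w, fun _ _ _ _ _ _ => G.bin⟩

theorem near3 (G : CG C) {a b c : L} (n1 : a ≠ b) (n2 : a ≠ c) : ∃ x y z, x ≠ y ∧ x ≠ z ∧ y ≠ z ∧ (x ≠ a ∧ C b a x ∧ C c a x) ∧ (y ≠ a ∧ C b a y ∧ C c a y) ∧ (z ≠ a ∧ C b a z ∧ C c a z) := by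
  obtain ⟨X, bX, pX, hX⟩ := G.near_set a {b, c} (toFinite _) (by simp [n1, n2])
  have key : ∀ x ∈ X, x ≠ a ∧ C b a x ∧ C c a x := fun x hx =>
    ⟨fun hc => pX (hc ▸ hx), G.symm (hX x hx b (by simp)), G.symm (hX x hx c (by simp))⟩
  obtain ⟨x, hx⟩ := G.big_nonempty bX
  obtain ⟨y, hy, hy'⟩ := G.big_nonempty (G.big_diff_fin bX (toFinite {x}))
  obtain ⟨z, hz, hz'⟩ := G.big_nonempty (G.big_diff_fin bX (toFinite {x, y}))
  simp only [mem_insert_iff, mem_singleton_iff, not_or] at hy' hz'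
  exact ⟨x, y, z, Ne.symm hy', Ne.symm hz'.1, Ne.symm hz'.2, key x hx, key y hy, key z hz⟩

theorem Setup.hard (S : Setup C Γ Δ h g) [Nontrivial E] {V : E → Prop} {D : E → E → E → Prop} (H : CAx V D) {a b c : L} (n1 : a ≠ b) (n2 : a ≠ c) (n3 : b ≠ c)
    (hV : ∀ x, x ≠ c → V (h x)) (hD : ∀ a b x, C b a x → C c a x → D (h b) (h a) (h x)) {N : E → E → E → Prop} (hN : PP3 (Δ.withConstants ![h a, h b, h c]) N)
    (hNd : ∀ x y z, N x y z ↔ V x ∧ V y ∧ V z ∧ x ≠ y ∧ x ≠ z ∧ y ≠ z ∧ ¬ D y x z) : Nonempty (PPInterpretation (Δ.withConstants ![h a, h b, h c]) NAEStruct) := by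
  have G := CG.of S.hL
  have hi := S.h_inj
  have key : ∀ a b x, (x ≠ a ∧ C b a x ∧ C c a x) → (V (h x) ∧ h x ≠ h a ∧ h x ≠ h b ∧ D (h b) (h a) (h x)) := fun a b x ⟨k1, k2, k3⟩ =>
    ⟨hV x (G.ne k3).2, hi.ne k1, hi.ne (G.ne k2).2, hD _ _ _ k2 k3⟩
  refine nae_hard H hN (fun x y z => (hNd x y z).trans ?_) (h a) (h b) (hV _ n2) (hV _ n3) (fun I i => PP.const _ 0 i) (fun I i => PP.const _ 1 i) ?_ ?_
  · constructor
    · rintro ⟨a, b, c, d, e, f, k⟩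
      exact ⟨a, b, c, d, e, f, (H.trip a b c d e f).1 k⟩
    · rintro ⟨a, b, c, d, e, f, k⟩
      exact ⟨a, b, c, d, e, f, (H.trip a b c d e f).2 k⟩
  · obtain ⟨x, y, z, m1, m2, m3, k1, k2, k3⟩ := near3 G n1 n2
    exact ⟨h x, h y, h z, hi.ne m1, hi.ne m2, hi.ne m3, key _ _ _ k1, key _ _ _ k2, key _ _ _ k3⟩
  · obtain ⟨x, y, z, m1, m2, m3, k1, k2, k3⟩ := near3 G n1.symm n3
    have key' : ∀ x, (x ≠ b ∧ C a b x ∧ C c b x) → (V (h x) ∧ h x ≠ h a ∧ h x ≠ h b ∧ D (h a) (h b) (h x)) := fun x k =>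
      ⟨(key b a x k).1, (key b a x k).2.2.1, (key b a x k).2.1, (key b a x k).2.2.2⟩
    exact ⟨h x, h y, h z, hi.ne m1, hi.ne m2, hi.ne m3, key' _ k1, key' _ k2, key' _ k3⟩

theorem CG.three (G : CG C) : ∃ a b c : L, a ≠ b ∧ a ≠ c ∧ b ≠ c := by
  classical
  have := G.inf
  obtain ⟨a⟩ : Nonempty L := inferInstance
  obtain ⟨b, hb⟩ := Infinite.exists_notMem_finset ({a} : Finset L)
  obtain ⟨c, hc⟩ := Infinite.exists_notMem_finset ({a, b} : Finset L)
  simp only [Finset.mem_insert, Finset.mem_singleton, not_or] at hb hc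
  exact ⟨a, b, c, Ne.symm hb, Ne.symm hc.1, Ne.symm hc.2⟩

theorem f3d : ∀ i j k a : Fin 3, i ≠ j → i ≠ k → j ≠ k → a = i ∨ a = j ∨ a = k := by decide

/-- distribution of three arguments with `y` at place `r` -/
def w3 (r : Fin 3) (x y z : α) : Fin 3 → α := fun p => if p = r then y else if p = r + 1 then x else z
theorem w3a (r : Fin 3) (x y z : α) : w3 r x y z r = y ∧ w3 r x y z (r + 1) = x ∧ w3 r x y z (r + 2) = z := by
  fin_cases r <;> simp [w3]
theorem w3_inj (r : Fin 3) (x y z : α) : Function.Injective (w3 r x y z) ↔ x ≠ y ∧ x ≠ z ∧ y ≠ z := by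
  obtain ⟨h1, h2, h3⟩ := w3a r x y z
  constructor
  · intro hi
    refine ⟨fun k => ?_, fun k => ?_, fun k => ?_⟩
    · have := hi (h2.trans (k.trans h1.symm)); revert this; clear h1 h2 h3 hi; revert r; decide
    · have := hi (h2.trans (k.trans h3.symm)); revert this; clear h1 h2 h3 hi; revert r; decide
    · have := hi (h1.trans (k.trans h3.symm)); revert this; clear h1 h2 h3 hi; revert r; decide
  · rintro ⟨n1, n2, n3⟩
    have c : ∀ i : Fin 3, i = r ∨ i = r + 1 ∨ i = r + 2 := by clear h1 h2 h3; revert r; decide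
    intro i j hij
    rcases c i with rfl | rfl | rfl <;> rcases c j with rfl | rfl | rfl <;> first | rfl | (simp only [h1, h2, h3] at hij; first | exact absurd hij (by assumption) | exact absurd hij.symm (by assumption))
theorem w3_map (r : Fin 3) (x y z : α) {β : Type} (f : α → β) : (fun i => f (w3 r x y z i)) = w3 r (f x) (f y) (f z) := by
  funext i; simp only [w3]; split_ifs <;> rfl

end DC

namespace DC
open Set Filter

variable {σ : Type} {ar : σ → ℕ} {L E : Type} {C : L → L → L → Prop} {Γ : RelStruct σ ar L} {Δ : RelStruct σ ar E} {I J α : Type} {h : L → E} {g : E → L}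

theorem NS.ccase (N : NS C Γ Δ h g) (hC : ∀ e, IsHom Γ Γ e → ∀ x y z, C z x y → C (e z) (e x) (e y))
    (H4 : ∀ (n : ℕ) (a : Fin n → E), IsEmpty (PPInterpretation (Δ.withConstants a) NAEStruct)) : HasSymmetricPolymorphismModEndos Δ := by
  have S := N.S
  have nt := N.nt
  have G := N.G
  have gi := S.g_inj
  have pres : ∀ {u v : Fin 3 → E}, Orb Δ u v → ∀ i j k, C (g (u i)) (g (u j)) (g (u k)) → C (g (v i)) (g (v j)) (g (v k)) := by
    intro u v H i j k hc
    obtain ⟨e, he, h1⟩ := S.orb_real H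
    rw [← h1, ← h1, ← h1]
    exact hC e he _ _ _ hc
  have ax : ∀ {u : Fin 3 → E}, Function.Injective u → CAx (fun _ => True) (fun z x y : Fin 3 => C (g (u z)) (g (u x)) (g (u y))) := fun {u} hu =>
    G.cax.comap (f := fun i => g (u i)) (gi.comp hu) (fun _ _ => trivial)
  refine S.oc.sym fun I _ => S.oc.lg (K := Fin 3) ?_ fun u v H => S.orb_iso ⟨fun i j => ?_, fun i j k => ?_⟩
  · by_contra hno
    obtain ⟨r, hT⟩ := two_types S.oc (fun p u => C (g (u p)) (g (u (p + 1))) (g (u (p + 2)))) (fun u hu => (ax hu).ex)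
      (fun p u v hu hv k1 k2 => S.orb_iso (CIso.of_inj1 G (gi.comp hu) (gi.comp hv) fun i j k n1 n2 n3 hc =>
        ((ax hv).typ k2 n1 n2 n3).2 (((ax hu).typ k1 n1 n2 n3).1 hc))) (fun p u v H k => pres H _ _ _ k)
      (fun u v hu pat => by
        have key : ∀ u v : Fin 3 → E, ¬ Function.Injective u → (∀ i j, u i = u j ↔ v i = v j) → ∀ i j k, C (g (u i)) (g (u j)) (g (u k)) → C (g (v i)) (g (v j)) (g (v k)) := by
          intro u v hu pat i j k hc
          obtain ⟨n1, n2⟩ := G.ne hc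
          rw [gi.ne_iff] at n1 n2
          by_cases hjk : u j = u k
          · rw [← (pat j k).1 hjk]
            exact G.rfl' (gi.ne fun hh => n1 ((pat _ _).2 hh))
          · refine absurd (fun a b hab => ?_) hu
            have m := f3d i j k
            have ha := m a (fun hh => n1 (hh ▸ rfl)) (fun hh => n2 (hh ▸ rfl)) (fun hh => hjk (hh ▸ rfl))
            have hb := m b (fun hh => n1 (hh ▸ rfl)) (fun hh => n2 (hh ▸ rfl)) (fun hh => hjk (hh ▸ rfl))
            rcases ha with rfl | rfl | rfl <;> rcases hb with rfl | rfl | rfl <;> first | rfl | exact absurd hab (by assumption) | exact absurd hab.symm (by assumption)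
        have hv : ¬ Function.Injective v := fun hv => hu fun i j hij => hv ((pat i j).1 hij)
        exact S.orb_iso ⟨fun i j => by rw [gi.eq_iff, gi.eq_iff, pat], fun i j k => ⟨key u v hu pat i j k, key v u hv (fun i j => (pat i j).symm) i j k⟩⟩)
      (S.noPLF2 H4) hno
    obtain ⟨a, b, c, n1, n2, n3⟩ := G.three
    obtain ⟨P⟩ := S.hard (V := fun _ => True) (D := fun z x y => C (g z) (g x) (g y)) (G.cax.comap gi fun _ _ => trivial) n1 n2 n3 (fun _ _ => trivial)
      (fun a b x k _ => hC _ (hcomp S.hh S.hg) _ _ _ k) (N := fun x y z => Function.Injective (w3 r x y z) ∧ ¬ C (g (w3 r x y z r)) (g (w3 r x y z (r + 1))) (g (w3 r x y z (r + 2))))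
      (fun I i j k => ((hT.withC _).comap (w3 r i j k)).congr fun t => by simp only [← w3_map r i j k t])
      (fun x y z => by
        obtain ⟨e1, e2, e3⟩ := w3a r x y z
        rw [w3_inj, e1, e2, e3]
        simp only [true_and, and_assoc])
    exact (H4 _ _).false P
  · rw [gi.eq_iff, gi.eq_iff]
    exact (H ![i, j, j]).eq_iff 0 1
  · exact ⟨pres (H ![i, j, k]) 0 1 2, pres (H ![i, j, k]).symm 0 1 2⟩

theorem f4d : ∀ i j k l a : Option (Fin 3), i ≠ j → i ≠ k → i ≠ l → j ≠ k → j ≠ l → k ≠ l → a = i ∨ a = j ∨ a = k ∨ a = l := by decide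

theorem RS.orbQ (R : RS C Γ Δ h g) [Finite I] {u v : I → E} (pat : ∀ i j, u i = u j ↔ v i = v j)
    (H1 : ∀ i j k l, u i ≠ u j → u i ≠ u k → u i ≠ u l → u j ≠ u k → u j ≠ u l → u k ≠ u l → (QRel C (g (u i)) (g (u j)) (g (u k)) (g (u l)) ↔ QRel C (g (v i)) (g (v j)) (g (v k)) (g (v l)))) : Orb Δ u v := by
  have S := R.N.S
  have G := R.N.G
  have gi := S.g_inj
  have deg : ∀ {a c d : L}, a ≠ c → a ≠ d → QRel C a a c d := fun n1 n2 => .inl ⟨G.rfl' n1, G.rfl' n2⟩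
  have key : ∀ u v : I → E, (∀ i j, u i = u j ↔ v i = v j) →
      (∀ i j k l, u i ≠ u j → u i ≠ u k → u i ≠ u l → u j ≠ u k → u j ≠ u l → u k ≠ u l → (QRel C (g (u i)) (g (u j)) (g (u k)) (g (u l)) → QRel C (g (v i)) (g (v j)) (g (v k)) (g (v l)))) →
      ∀ i j k l, QRel C (g (u i)) (g (u j)) (g (u k)) (g (u l)) → QRel C (g (v i)) (g (v j)) (g (v k)) (g (v l)) := by
    intro u v pat H1 i j k l hQ
    obtain ⟨n1, n2, n3, n4⟩ := Q_ne G hQ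
    rw [gi.ne_iff] at n1 n2 n3 n4
    have pn : ∀ {i j}, u i ≠ u j → g (v i) ≠ g (v j) := fun {i j} hn => gi.ne fun hh => hn ((pat _ _).2 hh)
    by_cases e1 : u i = u j
    · rw [← (pat i j).1 e1]
      exact deg (pn n1) (pn n2)
    by_cases e2 : u k = u l
    · rw [← (pat k l).1 e2]
      exact Q_flip (deg (pn n1).symm (pn n3).symm)
    exact H1 i j k l e1 n1 n2 n3 n4 e2 hQ
  have key2 : ∀ i j k l, QRel C (g (u i)) (g (u j)) (g (u k)) (g (u l)) ↔ QRel C (g (v i)) (g (v j)) (g (v k)) (g (v l)) := fun i j k l =>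
    ⟨key u v pat (fun i j k l a b c d e f => (H1 i j k l a b c d e f).1) i j k l,
      key v u (fun i j => (pat i j).symm) (fun i j k l a b c d e f => (H1 i j k l (mt (pat _ _).1 a) (mt (pat _ _).1 b) (mt (pat _ _).1 c) (mt (pat _ _).1 d) (mt (pat _ _).1 e) (mt (pat _ _).1 f)).2) i j k l⟩
  have hu : ∀ a : range u, ∃ i, u i = a := fun a => a.2
  choose k hk using hu
  classical
  let φ : E → E := fun a => if ha : a ∈ range u then v (k ⟨a, ha⟩) else a
  have hφ : ∀ i, φ (u i) = v i := fun i => by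
    simp only [φ, dif_pos (mem_range_self i)]
    exact (pat _ _).1 (hk ⟨u i, _⟩)
  have := R.qe (A := range u) (finite_range u) (x := g) (y := fun a => g (φ a)) gi.injOn (by
    rintro _ ⟨i, rfl⟩ _ ⟨j, rfl⟩ hij
    have := gi hij
    rw [hφ, hφ] at this
    exact (pat _ _).2 this) (by
    rintro _ ⟨i, rfl⟩ _ ⟨j, rfl⟩ _ ⟨k, rfl⟩ _ ⟨l, rfl⟩
    simp only [hφ]
    exact key2 i j k l)
  have := Orb.comap this (fun i : I => (⟨u i, i, rfl⟩ : range u))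
  simp only [hφ] at this
  exact ((S.oc.endoI (hcomp S.hg S.hh) u).trans this).trans (S.oc.endoI (hcomp S.hg S.hh) v).symm

theorem RS.qcase (R : RS C Γ Δ h g) (hV : ¬ QV C Γ)
    (H4 : ∀ (n : ℕ) (a : Fin n → E), IsEmpty (PPInterpretation (Δ.withConstants a) NAEStruct)) : HasSymmetricPolymorphismModEndos Δ := by
  have S := R.N.S
  have nt := R.N.nt
  have G := R.N.G
  have gi := S.g_inj
  have pres : ∀ {u v : Option (Fin 3) → E}, Orb Δ u v → ∀ i j k l, QRel C (g (u i)) (g (u j)) (g (u k)) (g (u l)) → QRel C (g (v i)) (g (v j)) (g (v k)) (g (v l)) := by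
    intro u v H i j k l hc
    obtain ⟨e, he, h1⟩ := S.orb_real H
    rw [← h1, ← h1, ← h1, ← h1]
    exact R.qpres hV he hc
  have ax : ∀ {u : Option (Fin 3) → E}, Function.Injective u → CAx (fun _ => True) (fun z x y : Fin 3 => QRel C (g (u (some x))) (g (u (some y))) (g (u (some z))) (g (u none))) := fun {u} hu =>
    (R.cax (g (u none))).comap (f := fun i => g (u (some i))) (fun i j hij => Option.some_injective _ (hu (gi hij))) (fun i _ hh => by cases hu (gi hh))
  refine S.oc.sym fun I _ => S.oc.lg (K := Option (Fin 3)) ?_ fun u v H => R.orbQ (fun i j => ?_) (fun i j k l _ _ _ _ _ _ => ?_)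
  · by_contra hno
    obtain ⟨r, hT⟩ := two_types S.oc (fun p u => QRel C (g (u (some (p + 1)))) (g (u (some (p + 2)))) (g (u (some p))) (g (u none))) (fun u hu => (ax hu).ex)
      (fun p u v hu hv k1 k2 => by
        have key : ∀ {u v : Option (Fin 3) → E}, Function.Injective u → Function.Injective v → QRel C (g (u (some (p + 1)))) (g (u (some (p + 2)))) (g (u (some p))) (g (u none)) → QRel C (g (v (some (p + 1)))) (g (v (some (p + 2)))) (g (v (some p))) (g (v none)) →
            ∀ i j k l, u i ≠ u j → u i ≠ u k → u i ≠ u l → u j ≠ u k → u j ≠ u l → u k ≠ u l → QRel C (g (u i)) (g (u j)) (g (u k)) (g (u l)) → QRel C (g (v i)) (g (v j)) (g (v k)) (g (v l)) := by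
          intro u v hu hv k1 k2
          have base : ∀ i j k, u i ≠ u j → u i ≠ u k → u j ≠ u k → u i ≠ u none → u j ≠ u none → u k ≠ u none → QRel C (g (u i)) (g (u j)) (g (u k)) (g (u none)) → QRel C (g (v i)) (g (v j)) (g (v k)) (g (v none)) := by
            intro i j k n1 n2 n3 n4 n5 n6 hQ
            cases i with
            | none => exact absurd rfl n4
            | some i =>
            cases j with
            | none => exact absurd rfl n5
            | some j =>
            cases k with
            | none => exact absurd rfl n6
            | some k =>
            have m1 : k ≠ i := fun hh => n2 (hh ▸ rfl)
            have m2 : k ≠ j := fun hh => n3 (hh ▸ rfl)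
            have m3 : i ≠ j := fun hh => n1 (hh ▸ rfl)
            exact ((ax hv).typ k2 m1 m2 m3).2 (((ax hu).typ k1 m1 m2 m3).1 hQ)
          intro i j k l n1 n2 n3 n4 n5 n6 hQ
          rcases f4d i j k l none (mt (congrArg u) n1) (mt (congrArg u) n2) (mt (congrArg u) n3) (mt (congrArg u) n4) (mt (congrArg u) n5) (mt (congrArg u) n6) with hh | hh | hh | hh <;> subst hh
          · exact Q_flip (Q_swap2 G (base k l j n6 n4.symm n5.symm n2.symm n3.symm n1.symm (Q_swap2 G (Q_flip hQ))))
          · exact Q_flip (base k l i n6 n2.symm n3.symm n4.symm n5.symm n1 (Q_flip hQ))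
          · exact Q_swap2 G (base i j l n1 n3 n5 n2 n4 n6.symm (Q_swap2 G hQ))
          · exact base i j k n1 n2 n4 n3 n5 n6 hQ
        have vn : ∀ {i j}, u i ≠ u j → v i ≠ v j := fun hn hh => hn (congrArg u (hv hh))
        exact R.orbQ (fun i j => by rw [hu.eq_iff, hv.eq_iff]) fun i j k l a b c d e f =>
          ⟨key hu hv k1 k2 i j k l a b c d e f, key hv hu k2 k1 i j k l (vn a) (vn b) (vn c) (vn d) (vn e) (vn f)⟩)
      (fun p u v H k => pres H _ _ _ _ k)
      (fun u v hu pat => R.orbQ pat fun i j k l n1 n2 n3 n4 n5 n6 => by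
        refine absurd (fun a b hab => ?_) hu
        have m := fun a => f4d i j k l a (mt (congrArg u) n1) (mt (congrArg u) n2) (mt (congrArg u) n3) (mt (congrArg u) n4) (mt (congrArg u) n5) (mt (congrArg u) n6)
        rcases m a with hh | hh | hh | hh <;> rcases m b with hh' | hh' | hh' | hh' <;> rw [hh, hh'] at hab ⊢ <;> first | exact absurd hab (by assumption) | exact absurd hab.symm (by assumption))
      (S.noPLF2 H4) hno
    obtain ⟨a, b, c, n1, n2, n3⟩ := G.three
    let w : E → E → E → E → Option (Fin 3) → E := fun q x y z o => o.elim q (w3 r x y z)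
    let T : (Option (Fin 3) → E) → Prop := fun u => Function.Injective u ∧ ¬ QRel C (g (u (some (r + 1)))) (g (u (some (r + 2)))) (g (u (some r))) (g (u none))
    obtain ⟨P⟩ := S.hard (V := fun x => x ≠ h c) (D := fun z x y => QRel C (g x) (g y) (g z) (g (h c))) ((R.cax (g (h c))).comap gi fun _ hn => gi.ne hn) n1 n2 n3 (fun _ hn => S.h_inj.ne hn)
      (fun a b x k1 k2 => R.qpres hV (hcomp S.hh S.hg) (.inl ⟨k1, k2⟩)) (N := fun x y z => ∃ q, q = h c ∧ T (w q x y z))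
      (fun I i j k => PP.ex (R := fun t q => q = h c ∧ T (w q (t i) (t j) (t k))) ((PP.const _ 2 none).and (((PP.withC (R := T) hT _).comap (fun o : Option (Fin 3) => o.elim none fun i' => some (w3 r i j k i'))).congr fun t => by
        have : w (t none) (t (some i)) (t (some j)) (t (some k)) = fun o => t (o.elim none fun i' => some (w3 r i j k i')) := by
          funext o
          cases o with
          | none => rfl
          | some p => exact congrFun (w3_map r i j k (fun i => t (some i))).symm p
        rw [this])))
      (fun x y z => by
        obtain ⟨e1, e2, e3⟩ := w3a r x y z
        simp only [exists_eq_left, T, w, Option.elim, e1, e2, e3]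
        have : Function.Injective (fun o : Option (Fin 3) => o.elim (h c) (w3 r x y z)) ↔ Function.Injective (w3 r x y z) ∧ ∀ p, w3 r x y z p ≠ h c := by
          constructor
          · exact fun hi => ⟨fun p q hpq => Option.some_injective _ (hi (a₁ := some p) (a₂ := some q) hpq), fun p hp => by cases hi (a₁ := some p) (a₂ := none) hp⟩
          · rintro ⟨h1, h2⟩ (_ | p) (_ | q) hpq
            · rfl
            · exact absurd hpq.symm (h2 q)
            · exact absurd hpq (h2 p)
            · rw [h1 hpq]
        have h3 : (∀ p, w3 r x y z p ≠ h c) ↔ x ≠ h c ∧ y ≠ h c ∧ z ≠ h c := by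
          refine ⟨fun hp => ⟨e2 ▸ hp (r + 1), e1 ▸ hp r, e3 ▸ hp (r + 2)⟩, fun ⟨m1, m2, m3⟩ p => ?_⟩
          simp only [w3]; split_ifs <;> assumption
        refine (and_congr_left' (this.trans (and_congr (w3_inj r x y z) h3))).trans ?_
        constructor
        · rintro ⟨⟨⟨a, b, c⟩, d, e, f⟩, k⟩; exact ⟨d, e, f, a, b, c, k⟩
        · rintro ⟨d, e, f, a, b, c, k⟩; exact ⟨⟨⟨a, b, c⟩, d, e, f⟩, k⟩)
    exact (H4 _ _).false P
  · exact (H (fun o => o.elim i fun _ => j)).eq_iff none (some 0)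
  · exact ⟨pres (H (fun o => o.elim l ![i, j, k])) (some 0) (some 1) (some 2) none, pres (H (fun o => o.elim l ![i, j, k])).symm (some 0) (some 1) (some 2) none⟩

theorem four_one (S : Setup C Γ Δ h g) (H4 : ∀ (n : ℕ) (a : Fin n → E), IsEmpty (PPInterpretation (Δ.withConstants a) NAEStruct)) : HasSymmetricPolymorphismModEndos Δ := by
  have := (CG.of S.hL).inf
  obtain ⟨l⟩ : Nonempty L := inferInstance
  have : Nonempty E := ⟨h l⟩
  rcases subsingleton_or_nontrivial E with hs | nt
  · refine ⟨fun x _ => x, id, id, ?_, fun s t ht => ht, fun s t ht => ht, fun x y => Subsingleton.elim _ _⟩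
    intro s ts hts
    exact hts 0
  by_cases hT : ∃ e, IsHom Γ Γ e ∧ ∃ X, Big C X ∧ Tight C e X
  · obtain ⟨e, he, X, hX, ht⟩ := hT
    exact (S.tight_ht he hX ht).sym S.oc (S.noPLF2 H4)
  have N : NS C Γ Δ h g := ⟨S, nt, fun e he X hX ht => hT ⟨e, he, X, hX, ht⟩⟩
  by_cases hR : NonRR C Γ
  · rcases N.nonRR hR with k | k
    · exact HT.sym S.oc k (S.noPLF2 H4)
    · exact N.ccase k H4
  have R : RS C Γ Δ h g := ⟨N, hR⟩
  by_cases hV : QV C Γ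
  · exact HT.sym S.oc (QV_ht R hV) (S.noPLF2 H4)
  · exact R.qcase hV H4

end DC

/-- **Theorem (algebraic-topological dichotomy for all reducts of `(𝕃;C)`).**
Let `Γ` be a reduct of `(𝕃; C)` and let `Δ` be the model-complete core of `Γ`.
Then the following are equivalent:
1. `Δ` has a binary polymorphism `f` and endomorphisms `e₁, e₂` with
   `e₁(f(x,y)) = e₂(f(y,x))` for all `x, y`;
2. for all elements `a₁, …, a_n` of `Δ` there is no clone homomorphism from
   `Pol(Δ, a₁, …, a_n)` to `𝟏`;
3. for all elements `a₁, …, a_n` of `Δ` there is no continuous clone homomorphism from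
   `Pol(Δ, a₁, …, a_n)` to `𝟏`;
4. no expansion of `Δ` by finitely many constants admits a primitive positive
   interpretation of `({0,1}; NAE)`. -/
theorem dichotomy_tfae_for_model_complete_core
    (L : Type) (C : L → L → L → Prop) (hL : IsHomBBDenseC C)
    (σ : Type) (ar : σ → ℕ) (Γ : RelStruct σ ar L) (hred : IsReduct C Γ)
    (E : Type) (Δ : RelStruct σ ar E)
    (hcore : IsModelCompleteCore Δ) (hcat : IsOmegaCategorical Δ)
    (hequiv : HomEquiv Γ Δ) :
    List.TFAE
      [ HasSymmetricPolymorphismModEndos Δ,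
        ∀ (n : ℕ) (a : Fin n → E),
          IsEmpty (CloneHom (polClone (Δ.withConstants a)) (projClone Bool)),
        ∀ (n : ℕ) (a : Fin n → E),
          ¬ ∃ ξ : CloneHom (polClone (Δ.withConstants a)) (projClone Bool),
            ξ.IsContinuous,
        ∀ (n : ℕ) (a : Fin n → E),
          IsEmpty (PPInterpretation (Δ.withConstants a) NAEStruct) ] := by
  obtain ⟨⟨h, hh⟩, g, hg⟩ := hequiv
  have S := DC.Setup.mk' hL hred hcore hcat.1 hh hg
  tfae_have 1 → 2 := fun H n a => ⟨fun ξ => DC.one_two S.oc H n a ξ⟩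
  tfae_have 2 → 3 := fun H n a ⟨ξ, _⟩ => (H n a).false ξ
  tfae_have 3 → 4 := fun H n a => ⟨fun P => H n a (DC.three_four P)⟩
  tfae_have 4 → 1 := fun H => DC.four_one S H
  tfae_finish
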